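/- arXiv:math/0208138 — 2 statements merged into one kernel-verified Lean document; each statement's English description precedes it below -/
import Mathlib

section
/- Let W be an irreducible Weyl group of rank ℓ with root lattice Q and Coxeter number h, and r a positive integer coprime to h. Then the permutation representation ℂ[Q/rQ] of W has character w ↦ r^{fix(w)}, and consequently for any irreducible representation τ of W, the multiplicity of τ in ℂ[Q/rQ] equals (1/|W|)·Σ_{w∈W} Tr(w,τ)·r^{fix(w)}. -/
open Module

namespace WeylLattice

/-- A reduced crystallographic root system `Φ` in a lattice `Q`, with coroots `α a`, whose canonical
operator `∑ a, α a ⊗ a` is the scalar `2 * h`. -/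
structure IsRootSystem {Q : Type*} [AddCommGroup Q] (Φ : Finset Q) (α : Q → Dual ℤ Q) (h : ℤ) :
    Prop where
  span_eq_top : Submodule.span ℤ (Φ : Set Q) = ⊤
  self : ∀ a ∈ Φ, α a a = 2
  refl_mem : ∀ a ∈ Φ, ∀ c ∈ Φ, c - α a c • a ∈ Φ
  coroot_refl : ∀ a ∈ Φ, ∀ c ∈ Φ, ∀ x, α (c - α a c • a) x = α c (x - α a x • a)
  reduced : ∀ a ∈ Φ, (2 : ℤ) • a ∉ Φ
  sum_smul : ∀ x, ∑ c ∈ Φ, α c x • c = (2 * h) • x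

/-- The canonical invariant bilinear form `∑ c, α c ⊗ α c` on the root lattice. -/
def form {Q : Type*} [AddCommGroup Q] (Φ : Finset Q) (α : Q → Dual ℤ Q) (x y : Q) : ℤ :=
  ∑ c ∈ Φ, α c x * α c y

section Form

variable {Q : Type*} [AddCommGroup Q] (Φ : Finset Q) (α : Q → Dual ℤ Q)

lemma form_comm (x y : Q) : form Φ α x y = form Φ α y x := by
  simp only [form, mul_comm]

lemma form_add_left (x x' y : Q) : form Φ α (x + x') y = form Φ α x y + form Φ α x' y := by
  simp only [form, map_add, add_mul, Finset.sum_add_distrib]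

lemma form_smul_left (n : ℤ) (x y : Q) : form Φ α (n • x) y = n * form Φ α x y := by
  simp only [form, map_smul, smul_eq_mul, mul_assoc, Finset.mul_sum]

lemma form_add_right (x y y' : Q) : form Φ α x (y + y') = form Φ α x y + form Φ α x y' := by
  simp only [form, map_add, mul_add, Finset.sum_add_distrib]

lemma form_smul_right (n : ℤ) (x y : Q) : form Φ α x (n • y) = n * form Φ α x y := by
  rw [form_comm, form_smul_left, form_comm]

lemma form_sub_left (x x' y : Q) : form Φ α (x - x') y = form Φ α x y - form Φ α x' y := by
  simp only [form, map_sub, sub_mul, Finset.sum_sub_distrib]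

lemma form_sub_right (x y y' : Q) : form Φ α x (y - y') = form Φ α x y - form Φ α x y' := by
  simp only [form, map_sub, mul_sub, Finset.sum_sub_distrib]

lemma form_nonneg (x : Q) : 0 ≤ form Φ α x x := Finset.sum_nonneg fun _ _ => mul_self_nonneg _

end Form

namespace IsRootSystem

variable {Q : Type*} [AddCommGroup Q] {Φ : Finset Q} {α : Q → Dual ℤ Q} {h : ℤ}
  {a b c d : Q}

lemma neg_mem (H : IsRootSystem Φ α h) (ha : a ∈ Φ) : -a ∈ Φ := by
  have := H.refl_mem a ha a ha
  rw [H.self a ha] at this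
  convert this using 1
  module

lemma coroot_neg (H : IsRootSystem Φ α h) (ha : a ∈ Φ) : α (-a) = -α a := by
  ext x
  have := H.coroot_refl a ha a ha x
  rw [H.self a ha] at this
  have e : a - (2 : ℤ) • a = -a := by module
  rw [e] at this
  rw [this, map_sub, map_smul, H.self a ha, LinearMap.neg_apply, smul_eq_mul]
  ring

lemma coroot_refl_eq (H : IsRootSystem Φ α h) (ha : a ∈ Φ) (hc : c ∈ Φ) :
    α (c - α a c • a) = α c - α c a • α a := by
  ext x
  rw [H.coroot_refl a ha c hc, map_sub, map_smul, LinearMap.sub_apply, LinearMap.smul_apply,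
    smul_eq_mul, smul_eq_mul, mul_comm]

lemma refl_refl (H : IsRootSystem Φ α h) (ha : a ∈ Φ) (x : Q) :
    (x - α a x • a) - α a (x - α a x • a) • a = x := by
  rw [map_sub, map_smul, H.self a ha, smul_eq_mul]
  module

lemma form_refl (H : IsRootSystem Φ α h) (ha : a ∈ Φ) (x y : Q) :
    form Φ α (x - α a x • a) (y - α a y • a) = form Φ α x y := by
  unfold form
  refine Finset.sum_nbij' (fun c => c - α a c • a) (fun c => c - α a c • a)
    (fun c hc => H.refl_mem a ha c hc) (fun c hc => H.refl_mem a ha c hc)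
    (fun c _ => H.refl_refl ha c) (fun c _ => H.refl_refl ha c) (fun c hc => ?_)
  rw [H.coroot_refl a ha c hc, H.coroot_refl a ha c hc]

lemma two_mul_form (H : IsRootSystem Φ α h) (ha : a ∈ Φ) (x : Q) :
    2 * form Φ α x a = α a x * form Φ α a a := by
  have := H.form_refl ha x a
  rw [H.self a ha] at this
  have e : a - (2 : ℤ) • a = (-1 : ℤ) • a := by module
  rw [e, form_smul_right, form_sub_left, form_smul_left] at this
  linarith

lemma sum_coroot_mul_coroot (H : IsRootSystem Φ α h) (x : Q) (y : Q) :
    ∑ c ∈ Φ, α c x * α y c = 2 * h * α y x := by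
  have := congrArg (α y) (H.sum_smul x)
  simpa using this

lemma form_self_pos (H : IsRootSystem Φ α h) (ha : a ∈ Φ) : 0 < form Φ α a a := by
  refine Finset.sum_pos' (fun c _ => mul_self_nonneg _) ⟨a, ha, ?_⟩
  rw [H.self a ha]; norm_num

lemma weight_mul_form (H : IsRootSystem Φ α h) (ha : a ∈ Φ) (hc : c ∈ Φ) :
    α a c * α c a * (form Φ α a a * form Φ α c c) = 4 * form Φ α a c ^ 2 := by
  have h1 := H.two_mul_form ha c
  have h2 := H.two_mul_form hc a
  rw [form_comm] at h1
  linear_combination (-2 * form Φ α a c) * h1 - (α a c * form Φ α a a) * h2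

lemma weight_mul_form_self (H : IsRootSystem Φ α h) (hd : d ∈ Φ) (hc : c ∈ Φ) :
    α d c * α c d * form Φ α c c = α d c ^ 2 * form Φ α d d := by
  have h1 := H.weight_mul_form hd hc
  have h2 := H.two_mul_form hd c
  rw [form_comm] at h2
  apply mul_left_cancel₀ (H.form_self_pos hd).ne'
  linear_combination h1 + (2 * form Φ α d c + α d c * form Φ α d d) * h2

lemma weight_nonneg (H : IsRootSystem Φ α h) (ha : a ∈ Φ) (hc : c ∈ Φ) : 0 ≤ α a c * α c a := by
  have h1 := H.weight_mul_form ha hc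
  have h2 := mul_pos (H.form_self_pos ha) (H.form_self_pos hc)
  by_contra! hlt
  nlinarith [mul_pos_of_neg_of_neg hlt (neg_neg_of_pos h2), sq_nonneg (form Φ α a c)]

lemma sum_weight (H : IsRootSystem Φ α h) (ha : a ∈ Φ) : ∑ c ∈ Φ, α a c * α c a = 4 * h := by
  have := H.sum_coroot_mul_coroot a a
  rw [H.self a ha] at this
  rw [show 4 * h = 2 * h * 2 by ring, ← this]
  exact Finset.sum_congr rfl fun c _ => mul_comm _ _

lemma h_pos (H : IsRootSystem Φ α h) (ha : a ∈ Φ) : 0 < h := by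
  have : 0 < ∑ c ∈ Φ, α a c * α c a :=
    Finset.sum_pos' (fun c hc => H.weight_nonneg ha hc) ⟨a, ha, by rw [H.self a ha]; norm_num⟩
  rw [H.sum_weight ha] at this
  linarith

lemma coroot_eq_zero_comm (H : IsRootSystem Φ α h) (ha : a ∈ Φ) (hc : c ∈ Φ) :
    α a c = 0 ↔ α c a = 0 := by
  have h1 := H.two_mul_form ha c
  have h2 := H.two_mul_form hc a
  rw [form_comm] at h1
  have h3 := (H.form_self_pos ha).ne'
  have h4 := (H.form_self_pos hc).ne'
  rw [h1] at h2
  constructor <;> intro h0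
  · rw [h0, zero_mul] at h2
    exact (mul_eq_zero.1 h2.symm).resolve_right h4
  · rw [h0, zero_mul] at h2
    exact (mul_eq_zero.1 h2).resolve_right h3

lemma coroot_pos_comm (H : IsRootSystem Φ α h) (ha : a ∈ Φ) (hc : c ∈ Φ) :
    0 < α a c ↔ 0 < α c a := by
  have h0 := H.coroot_eq_zero_comm ha hc
  have h1 := H.weight_nonneg ha hc
  constructor <;> intro hp <;> by_contra! hn <;>
    rcases hn.lt_or_eq with hn | hn <;> first | nlinarith | omega

lemma sum_weight_pos (H : IsRootSystem Φ α h) (ha : a ∈ Φ) :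
    ∑ c ∈ Φ with 0 < α a c, α a c * α c a = 2 * h := by
  have h1 := H.sum_weight ha
  have h2 : ∑ c ∈ Φ with 0 < α a c, α a c * α c a =
      ∑ c ∈ Φ with α a c < 0, α a c * α c a := by
    refine Finset.sum_nbij' (fun c => -c) (fun c => -c) ?_ ?_ ?_ ?_ ?_ <;>
      simp +contextual [H.neg_mem, H.coroot_neg]
  have h3 : ∑ c ∈ Φ with ¬ 0 < α a c, α a c * α c a =
      ∑ c ∈ Φ with α a c < 0, α a c * α c a := by
    symm
    refine Finset.sum_subset (fun c => ?_) (fun c => ?_)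
    · simp only [Finset.mem_filter]; grind
    · simp only [Finset.mem_filter]; grind
  rw [← Finset.sum_filter_add_sum_filter_not Φ (fun c => 0 < α a c), h3, ← h2] at h1
  linarith

lemma weight_le_four (H : IsRootSystem Φ α h) (ha : a ∈ Φ) (hc : c ∈ Φ) : α a c * α c a ≤ 4 := by
  have h1 := H.weight_mul_form ha hc
  have h2 := mul_pos (H.form_self_pos ha) (H.form_self_pos hc)
  have h3 := form_nonneg Φ α (form Φ α a a • c - form Φ α a c • a)
  simp only [form_sub_left, form_sub_right, form_smul_left, form_smul_right,
    form_comm Φ α c a] at h3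
  have h4 : 0 ≤ form Φ α a a * (form Φ α a a * form Φ α c c - form Φ α a c ^ 2) := by
    linarith
  have h5 := nonneg_of_mul_nonneg_right h4 (H.form_self_pos ha)
  by_contra! hlt
  nlinarith

lemma negRefl_mem (H : IsRootSystem Φ α h) (hd : d ∈ Φ) (hc : c ∈ Φ) : α d c • d - c ∈ Φ := by
  have := H.neg_mem (H.refl_mem d hd c hc)
  rwa [neg_sub] at this

lemma add_mem (H : IsRootSystem Φ α h) (ha : a ∈ Φ) (hb : b ∈ Φ) (hab : α a b = -1) :
    a + b ∈ Φ := by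
  have := H.refl_mem a ha b hb
  rwa [hab, neg_one_smul, sub_neg_eq_add, add_comm] at this

lemma sub_mem (H : IsRootSystem Φ α h) (ha : a ∈ Φ) (hb : b ∈ Φ) (hab : α a b = 1) :
    a - b ∈ Φ := by
  have := H.negRefl_mem ha hb
  rwa [hab, one_smul] at this

lemma coroot_negRefl (H : IsRootSystem Φ α h) (hd : d ∈ Φ) (hc : c ∈ Φ) :
    α (α d c • d - c) d = α c d := by
  rw [← neg_sub, H.coroot_neg (H.refl_mem d hd c hc), LinearMap.neg_apply,
    H.coroot_refl d hd c hc, H.self d hd, map_sub, map_smul, smul_eq_mul]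
  ring

lemma coroot_self_negRefl (H : IsRootSystem Φ α h) (hd : d ∈ Φ) (c : Q) :
    α d (α d c • d - c) = α d c := by
  rw [map_sub, map_smul, H.self d hd, smul_eq_mul]
  ring

/-- If `d` and `e` are orthogonal roots whose coroots are congruent modulo `2`, then `h` is even as
soon as the roots in the plane of `d` and `e` do not obstruct it. -/
lemma even_of_orthogonal [DecidableEq Q] (H : IsRootSystem Φ α h) {e : Q} (hd : d ∈ Φ) (he : e ∈ Φ)
    (hde : α d e = 0) (hpar : ∀ c ∈ Φ, Even (α d c + α e c))
    (hfix : Even (∑ c ∈ Φ with 0 < α d c ∧ 0 < α e c ∧ (2 : ℤ) • c = α d c • d + α e c • e,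
      α d c * α c d)) : Even h := by
  have hed : α e d = 0 := (H.coroot_eq_zero_comm hd he).1 hde
  have hdse : ∀ c, α d (c - α e c • e) = α d c := fun c => by
    rw [map_sub, map_smul, hde, smul_zero, sub_zero]
  have hsed : ∀ c ∈ Φ, α (c - α e c • e) d = α c d := fun c hc => by
    rw [H.coroot_refl e he c hc, hed, zero_smul, sub_zero]
  have hzero : (4 : ℤ) ∣ ∑ c ∈ Φ with 0 < α d c ∧ α e c = 0, α d c * α c d := by
    refine (ZMod.intCast_zmod_eq_zero_iff_dvd _ 4).1 ?_
    rw [Int.cast_sum]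
    refine Finset.sum_involution (fun c _ => α d c • d - c) ?_ ?_ ?_ ?_
    · intro c hc
      simp only [Finset.mem_filter] at hc
      rw [H.coroot_self_negRefl hd, H.coroot_negRefl hd hc.1, ← Int.cast_add,
        ZMod.intCast_zmod_eq_zero_iff_dvd]
      obtain ⟨k, hk⟩ := hpar c hc.1
      rw [hc.2.2] at hk
      exact ⟨k * α c d, by push_cast; rw [show α d c = k + k by omega]; ring⟩
    · intro c hc hne hcc
      simp only [Finset.mem_filter] at hc
      apply hne
      have h1 := congrArg (α c) hcc
      rw [map_sub, map_smul, H.self c hc.1, smul_eq_mul] at h1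
      rw [show α d c * α c d = 4 by omega]
      rfl
    · intro c hc
      simp only [Finset.mem_filter] at hc ⊢
      refine ⟨H.negRefl_mem hd hc.1, by rw [H.coroot_self_negRefl hd]; exact hc.2.1, ?_⟩
      rw [map_sub, map_smul, hed, hc.2.2, smul_zero, sub_zero]
    · intro c hc
      rw [H.coroot_self_negRefl hd]
      abel
  have hneg : ∑ c ∈ Φ with 0 < α d c ∧ α e c < 0, α d c * α c d =
      ∑ c ∈ Φ with 0 < α d c ∧ 0 < α e c, α d c * α c d := by
    refine Finset.sum_nbij' (fun c => c - α e c • e) (fun c => c - α e c • e) ?_ ?_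
      (fun c _ => H.refl_refl he c) (fun c _ => H.refl_refl he c) ?_
    · intro c hc
      simp only [Finset.mem_filter] at hc ⊢
      refine ⟨H.refl_mem e he c hc.1, by rw [hdse]; exact hc.2.1, ?_⟩
      rw [map_sub, map_smul, H.self e he, smul_eq_mul]
      linarith
    · intro c hc
      simp only [Finset.mem_filter] at hc ⊢
      refine ⟨H.refl_mem e he c hc.1, by rw [hdse]; exact hc.2.1, ?_⟩
      rw [map_sub, map_smul, H.self e he, smul_eq_mul]
      linarith
    · intro c hc
      simp only [Finset.mem_filter] at hc
      rw [hdse, hsed c hc.1]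
  have hpos : Even (∑ c ∈ Φ with 0 < α d c ∧ 0 < α e c, α d c * α c d) := by
    rw [← Finset.sum_filter_add_sum_filter_not _
      (fun c => (2 : ℤ) • c = α d c • d + α e c • e)]
    refine Even.add ?_ ?_
    · simpa only [Finset.filter_filter, and_assoc] using hfix
    · rw [even_iff_two_dvd]
      refine (ZMod.intCast_zmod_eq_zero_iff_dvd _ 2).1 ?_
      rw [Int.cast_sum]
      have hk : ∀ c, α d c • d - (c - α e c • e) =
          α d (c - α e c • e) • d - (c - α e c • e) := fun c => by rw [hdse]
      have hkd : ∀ c, α d (α d c • d - (c - α e c • e)) = α d c := fun c => by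
        rw [hk, H.coroot_self_negRefl hd, hdse]
      have hke : ∀ c, α e (α d c • d - (c - α e c • e)) = α e c := fun c => by
        rw [map_sub, map_sub, map_smul, map_smul, hed, H.self e he, smul_eq_mul, smul_eq_mul]
        ring
      refine Finset.sum_involution (fun c _ => α d c • d - (c - α e c • e)) ?_ ?_ ?_ ?_
      · intro c hc
        simp only [Finset.mem_filter] at hc
        rw [hkd, hk, H.coroot_negRefl hd (H.refl_mem e he c hc.1.1), hsed c hc.1.1,
          ← Int.cast_add, ZMod.intCast_zmod_eq_zero_iff_dvd]
        exact ⟨α d c * α c d, by push_cast; ring⟩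
      · intro c hc _ hcc
        simp only [Finset.mem_filter] at hc
        apply hc.2
        rw [two_smul]
        nth_rewrite 1 [← hcc]
        abel
      · intro c hc
        simp only [Finset.mem_filter] at hc ⊢
        refine ⟨⟨?_, by rw [hkd]; exact hc.1.2.1, by rw [hke]; exact hc.1.2.2⟩, ?_⟩
        · rw [hk]
          exact H.negRefl_mem hd (H.refl_mem e he c hc.1.1)
        · rw [hkd, hke]
          intro hcc
          apply hc.2
          have : (2 : ℤ) • c = (2 : ℤ) • (α d c • d + α e c • e) -
            (2 : ℤ) • (α d c • d - (c - α e c • e)) := by module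
          rw [this, hcc]
          module
      · intro c hc
        rw [hkd, hke]
        abel
  have hsum := H.sum_weight_pos hd
  have hsplit : ∑ c ∈ Φ with 0 < α d c, α d c * α c d =
      ∑ c ∈ Φ with 0 < α d c ∧ α e c = 0, α d c * α c d +
      (∑ c ∈ Φ with 0 < α d c ∧ 0 < α e c, α d c * α c d +
      ∑ c ∈ Φ with 0 < α d c ∧ α e c < 0, α d c * α c d) := by
    simp only [Finset.sum_filter, ← Finset.sum_add_distrib]
    refine Finset.sum_congr rfl fun c _ => ?_
    rcases lt_trichotomy (α e c) 0 with h1 | h1 | h1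
    · simp [h1, h1.ne, h1.not_gt]
    · simp [h1]
    · simp [h1, h1.ne', h1.not_gt]
  rw [hsplit, hneg] at hsum
  obtain ⟨k, hk⟩ := hzero
  obtain ⟨l, hl⟩ := hpos
  rw [hk, hl] at hsum
  exact ⟨k + l, by omega⟩

/-- A root `b` with `α d b = 2` and `α b d = 1` (a subsystem of type `B₂`) forces `h` to be even. -/
lemma even_of_coroot_eq_two (H : IsRootSystem Φ α h) (hd : d ∈ Φ) (hb : b ∈ Φ)
    (hdb : α d b = 2) (hbd : α b d = 1) : Even h := by
  classical
  have he : b - d ∈ Φ := by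
    have := H.negRefl_mem hb hd
    rwa [hbd, one_smul] at this
  have hαe : α (b - d) = (2 : ℤ) • α b - α d := by
    have h1 := H.coroot_refl_eq hb hd
    rw [hbd, one_smul, hdb] at h1
    rw [← neg_sub, H.coroot_neg (by simpa using H.neg_mem he), h1, neg_sub]
  have hde : α d (b - d) = 0 := by rw [map_sub, hdb, H.self d hd]; norm_num
  have hfe : form Φ α (b - d) (b - d) = form Φ α d d := by
    have := H.form_refl hb d d
    rw [hbd, one_smul] at this
    rw [← this]
    simp only [form, map_sub]
    exact Finset.sum_congr rfl fun x _ => by ring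
  have hfde : form Φ α d (b - d) = 0 := by
    have := H.two_mul_form hd (b - d)
    rw [hde, form_comm] at this
    omega
  refine H.even_of_orthogonal hd he hde (fun c _ => ⟨α b c, by rw [hαe]; simp; ring⟩) ?_
  refine Finset.even_sum _ fun c hc => ?_
  simp only [Finset.mem_filter] at hc
  obtain ⟨hc, -, -, h2c⟩ := hc
  have h1 := H.weight_mul_form_self hd hc
  have h2 : form Φ α ((2 : ℤ) • c) ((2 : ℤ) • c) =
      (α d c ^ 2 + α (b - d) c ^ 2) * form Φ α d d := by
    rw [h2c]
    simp only [form_add_left, form_add_right, form_smul_left, form_smul_right, hfe, hfde,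
      form_comm Φ α (b - d) d]
    ring
  rw [form_smul_left, form_smul_right] at h2
  have h3 : α d c * α c d * (α d c ^ 2 + α (b - d) c ^ 2) = 4 * α d c ^ 2 := by
    apply mul_right_cancel₀ (H.form_self_pos hd).ne'
    linear_combination 4 * h1 - α d c * α c d * h2
  have h4 : α (b - d) c = 2 * α b c - α d c := by rw [hαe]; simp
  by_contra hodd
  rw [Int.not_even_iff_odd, Int.odd_mul] at hodd
  obtain ⟨⟨s, hs⟩, t, ht⟩ := hodd
  rw [h4] at h3
  have h5 : (2 : ℤ) * (2 * s + 1) * (2 * t + 1) * (α b c ^ 2 + (α b c - (2 * s + 1)) ^ 2) =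
      2 * (2 * (2 * s + 1) ^ 2) := by
    rw [hs, ht] at h3; linear_combination h3
  have h6 : Odd ((2 * s + 1) * (2 * t + 1) * (α b c ^ 2 + (α b c - (2 * s + 1)) ^ 2)) := by
    refine Odd.mul (Odd.mul ⟨s, rfl⟩ ⟨t, rfl⟩) ?_
    rcases Int.even_or_odd (α b c) with ⟨u, hu⟩ | ⟨u, hu⟩ <;> rw [hu]
    · exact ⟨2 * u ^ 2 + 2 * (u - s) ^ 2 - 2 * (u - s), by ring⟩
    · exact ⟨2 * u ^ 2 + 2 * u + 2 * (u - s) ^ 2, by ring⟩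
  rw [show (2 * s + 1) * (2 * t + 1) * (α b c ^ 2 + (α b c - (2 * s + 1)) ^ 2) =
    2 * (2 * s + 1) ^ 2 by linarith] at h6
  exact (Int.not_even_iff_odd.2 h6) ⟨(2 * s + 1) ^ 2, by ring⟩

variable [Module.Free ℤ Q]

lemma eq_zero_of_form_self (H : IsRootSystem Φ α h) (ha : a ∈ Φ) {x : Q} (hx : form Φ α x x = 0) :
    x = 0 := by
  have h1 := (Finset.sum_eq_zero_iff_of_nonneg (fun _ _ => mul_self_nonneg _)).1 hx
  have h2 := H.sum_smul x
  rw [Finset.sum_eq_zero fun c hc => by rw [mul_self_eq_zero.1 (h1 c hc), zero_smul]] at h2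
  have := H.h_pos ha
  exact (smul_eq_zero.1 h2.symm).resolve_left (by omega)

lemma two_smul_eq_of_weight_eq_four (H : IsRootSystem Φ α h) (ha : a ∈ Φ) (hc : c ∈ Φ)
    (hw : α a c * α c a = 4) :
    (2 : ℤ) • c = α a c • a := by
  have h1 := H.weight_mul_form ha hc
  have h2 := H.two_mul_form ha c
  rw [form_comm] at h2
  rw [← sub_eq_zero]
  apply H.eq_zero_of_form_self ha
  simp only [form_sub_left, form_sub_right, form_smul_left, form_smul_right,
    form_comm Φ α c a]
  rw [hw] at h1
  have h3 := (H.form_self_pos ha).ne'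
  apply mul_left_cancel₀ h3
  linear_combination h1 + (2 * form Φ α a c - α a c * form Φ α a a) * h2

lemma eq_or_eq_neg_of_weight_eq_four (H : IsRootSystem Φ α h) (ha : a ∈ Φ) (hc : c ∈ Φ)
    (hw : α a c * α c a = 4) :
    c = a ∨ c = -a := by
  have h1 := H.two_smul_eq_of_weight_eq_four ha hc hw
  have h2 := H.two_smul_eq_of_weight_eq_four hc ha (by rw [mul_comm, hw])
  have hi : ∀ x y : Q, (2 : ℤ) • x = (2 : ℤ) • y → x = y := fun x y hxy =>
    smul_right_injective Q (two_ne_zero (α := ℤ)) hxy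
  have key : ∀ m n : ℤ, m * n = 4 → m = 1 ∨ m = -1 ∨ m = 2 ∨ m = -2 ∨ n = 1 ∨ n = -1 := by
    intro m n hmn
    have hm : m ∣ 4 := ⟨n, hmn.symm⟩
    have h3 := Int.le_of_dvd (by norm_num) hm
    have h4 := Int.le_of_dvd (by norm_num) (Int.neg_dvd.2 hm)
    have : -4 ≤ m := by omega
    interval_cases m <;> omega
  have hna := H.neg_mem ha
  have hnc := H.neg_mem hc
  rcases key _ _ hw with e | e | e | e | e | e
  · rw [e, one_smul] at h1; exact absurd (h1 ▸ ha) (H.reduced c hc)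
  · rw [e, neg_one_smul] at h1; exact absurd (h1 ▸ hna) (H.reduced c hc)
  · rw [e] at h1; exact .inl (hi _ _ h1)
  · rw [e] at h1; exact .inr (hi _ _ (h1.trans (by module)))
  · rw [e, one_smul] at h2; exact absurd (h2 ▸ hc) (H.reduced a ha)
  · rw [e, neg_one_smul] at h2; exact absurd (h2 ▸ hnc) (H.reduced a ha)

lemma weight_lt_four (H : IsRootSystem Φ α h) (ha : a ∈ Φ) (hc : c ∈ Φ) (h1 : c ≠ a) (h2 : c ≠ -a) :
    α a c * α c a < 4 :=
  (H.weight_le_four ha hc).lt_of_ne fun hw =>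
    (H.eq_or_eq_neg_of_weight_eq_four ha hc hw).elim h1 h2

/-- A root `b` with `α d b = 3` and `α b d = 1` (a subsystem of type `G₂`) forces `h` to be even. -/
lemma even_of_coroot_eq_three (H : IsRootSystem Φ α h) (hd : d ∈ Φ) (hb : b ∈ Φ)
    (hdb : α d b = 3) (hbd : α b d = 1) : Even h := by
  classical
  have hbb := H.self b hb
  have hdd := H.self d hd
  have hg : b - d ∈ Φ := by
    have := H.negRefl_mem hb hd
    rwa [hbd, one_smul] at this
  have hαg : α (b - d) = (3 : ℤ) • α b - α d := by
    have h1 := H.coroot_refl_eq hb hd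
    rw [hbd, one_smul, hdb] at h1
    rw [← neg_sub, H.coroot_neg (by simpa using H.neg_mem hg), h1, neg_sub]
  have hf : b - (3 : ℤ) • d ∈ Φ := by
    have := H.refl_mem d hd b hb
    rwa [hdb] at this
  have hαf : α (b - (3 : ℤ) • d) = α b - α d := by
    have := H.coroot_refl_eq hd hb
    rwa [hdb, hbd, one_smul] at this
  have hbf : α b (b - (3 : ℤ) • d) = -1 := by rw [map_sub, map_smul, hbb, hbd]; norm_num
  have hfe : b - (3 : ℤ) • d - α b (b - (3 : ℤ) • d) • b = (2 : ℤ) • b - (3 : ℤ) • d := by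
    rw [hbf]; module
  set e := (2 : ℤ) • b - (3 : ℤ) • d with he_def
  have he : e ∈ Φ := hfe ▸ H.refl_mem b hb _ hf
  have hαe : α e = (2 : ℤ) • α b - α d := by
    have := H.coroot_refl_eq hb hf
    rw [hfe, hαf, LinearMap.sub_apply, hbb, hdb] at this
    rw [this]; module
  have hde : α d e = 0 := by rw [he_def, map_sub, map_smul, map_smul, hdb, hdd]; norm_num
  have hee : form Φ α e e = 3 * form Φ α d d := by
    have h1 := H.form_refl hd b b
    have h2 := H.form_refl hb (b - (3 : ℤ) • d) (b - (3 : ℤ) • d)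
    rw [hfe] at h2
    rw [hdb] at h1
    have h3 := H.weight_mul_form_self hd hb
    rw [hdb, hbd] at h3
    linarith
  have hfde : form Φ α d e = 0 := by
    have := H.two_mul_form hd e
    rw [hde, form_comm] at this
    omega
  refine H.even_of_orthogonal hd he hde (fun c _ => ⟨α b c, by rw [hαe]; simp; ring⟩) ?_
  have hinj : ∀ x y : Q, (2 : ℤ) • x = (2 : ℤ) • y → x = y := fun x y hxy =>
    smul_right_injective Q (two_ne_zero (α := ℤ)) hxy
  rw [← Finset.sum_filter_add_sum_filter_not _ (fun c => Even (α d c * α c d))]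
  refine Even.add (Finset.even_sum _ fun c hc => (Finset.mem_filter.1 hc).2) ?_
  have hset : {c ∈ {c ∈ Φ | 0 < α d c ∧ 0 < α e c ∧ (2 : ℤ) • c = α d c • d + α e c • e} |
      ¬ Even (α d c * α c d)} = {b - d, b} := by
    ext c
    simp only [Finset.mem_filter, Finset.mem_insert, Finset.mem_singleton]
    constructor
    · rintro ⟨⟨hc, hp, hq, h2c⟩, hodd⟩
      have h1 := H.weight_mul_form_self hd hc
      have h2 : form Φ α ((2 : ℤ) • c) ((2 : ℤ) • c) =
          (α d c ^ 2 + 3 * α e c ^ 2) * form Φ α d d := by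
        rw [h2c]
        simp only [form_add_left, form_add_right, form_smul_left, form_smul_right, hee, hfde,
          form_comm Φ α e d]
        ring
      rw [form_smul_left, form_smul_right] at h2
      have h3 : α d c * α c d * (α d c ^ 2 + 3 * α e c ^ 2) = 4 * α d c ^ 2 := by
        apply mul_right_cancel₀ (H.form_self_pos hd).ne'
        linear_combination 4 * h1 - α d c * α c d * h2
      have h4 := H.weight_le_four hd hc
      have h5 : 0 < α c d := (H.coroot_pos_comm hd hc).1 hp
      generalize hpdef : α d c = p at *
      generalize α c d = n at *
      generalize α e c = q at *
      have hp4 : p ≤ 4 := by nlinarith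
      have hn4 : n ≤ 4 := by nlinarith
      have : (p = 1 ∨ p = 3) ∧ q = 1 := by
        have hq2 : q ≤ 4 := by
          by_contra! hq4
          interval_cases p <;> interval_cases n <;> first | omega | nlinarith
        interval_cases p <;> interval_cases n <;> interval_cases q <;> omega
      rcases this with ⟨rfl | rfl, rfl⟩
      · left
        apply hinj
        rw [h2c, he_def]; module
      · right
        apply hinj
        rw [h2c, he_def]; module
    · rintro (rfl | rfl)
      · have h1 : α d (b - d) = 1 := by rw [map_sub, hdb, hdd]; norm_num
        have h2 : α e (b - d) = 1 := by rw [hαe]; simp [hdb, hdd, hbd, hbb]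
        have h3 : α (b - d) d = 1 := by rw [hαg]; simp [hdd, hbd]
        refine ⟨⟨hg, by omega, by omega, ?_⟩, by rw [h1, h3]; decide⟩
        rw [h1, h2, he_def]; module
      · have h2 : α e c = 1 := by rw [hαe]; simp [hdb, hbb]
        refine ⟨⟨hb, by omega, by omega, ?_⟩, by rw [hdb, hbd]; decide⟩
        rw [hdb, h2, he_def]; module
  have hne : b - d ≠ b := by
    intro hbd0
    have := congrArg (α d) hbd0
    rw [map_sub, hdb, hdd] at this
    omega
  have h3 : α (b - d) d = 1 := by rw [hαg]; simp [hdd, hbd]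
  rw [hset, Finset.sum_pair hne, h3, hdb, hbd, map_sub, hdb, hdd]
  decide

lemma abs_coroot_le_one (H : IsRootSystem Φ α h) (hodd : Odd h) (hd : d ∈ Φ) (hb : b ∈ Φ)
    (h1 : b ≠ d) (h2 : b ≠ -d) : |α d b| ≤ 1 := by
  have key : ∀ b ∈ Φ, b ≠ d → b ≠ -d → α d b ≤ 1 := by
    intro b hb h1 h2
    by_contra! hlt
    have h3 := H.weight_lt_four hd hb h1 h2
    have h4 := (H.coroot_pos_comm hd hb).1 (by omega)
    have h5 : α b d = 1 := by nlinarith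
    have h6 : α d b = 2 ∨ α d b = 3 := by rw [h5] at h3; omega
    rw [← Int.not_even_iff_odd] at hodd
    exact hodd (h6.elim (H.even_of_coroot_eq_two hd hb · h5)
      (H.even_of_coroot_eq_three hd hb · h5))
  have h3 := key b hb h1 h2
  have h4 := key (-b) (H.neg_mem hb) (fun h0 => h2 (by rw [← h0, neg_neg])) (by simpa using h1)
  rw [map_neg] at h4
  rw [abs_le]
  omega

/-- When `h` is odd, the root system is simply laced: the pairing is symmetric on roots. -/
lemma coroot_comm (H : IsRootSystem Φ α h) (hodd : Odd h) (hd : d ∈ Φ) (hb : b ∈ Φ) :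
    α d b = α b d := by
  by_cases h1 : b = d
  · rw [h1]
  by_cases h2 : b = -d
  · rw [h2, H.coroot_neg hd, map_neg, LinearMap.neg_apply]
  have h3 := abs_le.1 (H.abs_coroot_le_one hodd hd hb h1 h2)
  have h4 := abs_le.1 (H.abs_coroot_le_one hodd hb hd (Ne.symm h1)
    (fun h0 => h2 (by rw [h0, neg_neg])))
  have h5 := H.coroot_pos_comm hd hb
  have h6 := H.coroot_eq_zero_comm hd hb
  omega

lemma coroot_cases (H : IsRootSystem Φ α h) (hodd : Odd h) (hd : d ∈ Φ) (hc : c ∈ Φ) :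
    c = d ∨ c = -d ∨ α d c = 0 ∨ α d c = 1 ∨ α d c = -1 := by
  by_cases h1 : c = d
  · exact .inl h1
  by_cases h2 : c = -d
  · exact .inr (.inl h2)
  have := abs_le.1 (H.abs_coroot_le_one hodd hd hc h1 h2)
  omega

lemma coroot_ge (H : IsRootSystem Φ α h) (hodd : Odd h) (hd : d ∈ Φ) (hc : c ∈ Φ) :
    -2 ≤ α d c := by
  have := H.self d hd
  rcases H.coroot_cases hodd hd hc with rfl | rfl | h1 | h1 | h1 <;> simp_all

lemma eq_of_coroot_eq_two (H : IsRootSystem Φ α h) (hodd : Odd h) (hd : d ∈ Φ) (hc : c ∈ Φ)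
    (h1 : 2 ≤ α d c) : c = d := by
  have := H.self d hd
  rcases H.coroot_cases hodd hd hc with rfl | rfl | h1 | h1 | h1
  · rfl
  · rw [map_neg] at h1; omega
  all_goals omega

lemma coroot_add (H : IsRootSystem Φ α h) (hodd : Odd h) (ha : a ∈ Φ) (hb : b ∈ Φ)
    (hab : α a b = -1) : α (a + b) = α a + α b := by
  have := H.coroot_refl_eq ha hb
  rw [← H.coroot_comm hodd ha hb, hab, neg_one_smul, neg_one_smul, sub_neg_eq_add,
    sub_neg_eq_add, add_comm, add_comm (α b)] at this
  exact this

lemma coroot_sub (H : IsRootSystem Φ α h) (hodd : Odd h) (ha : a ∈ Φ) (hb : b ∈ Φ)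
    (hab : α a b = 1) : α (a - b) = α a - α b := by
  rw [sub_eq_add_neg, H.coroot_add hodd ha (H.neg_mem hb) (by rw [map_neg, hab]),
    H.coroot_neg hb, sub_eq_add_neg]

lemma card_coroot_eq_one (H : IsRootSystem Φ α h) (hodd : Odd h) (ha : a ∈ Φ) :
    (({c ∈ Φ | α a c = 1}.card : ℕ) : ℤ) = 2 * h - 4 := by
  classical
  have hins : {c ∈ Φ | 0 < α a c} = insert a {c ∈ Φ | α a c = 1} := by
    ext c
    simp only [Finset.mem_filter, Finset.mem_insert]
    constructor
    · rintro ⟨hc, hp⟩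
      by_cases h2 : 2 ≤ α a c
      · exact .inl (H.eq_of_coroot_eq_two hodd ha hc h2)
      · exact .inr ⟨hc, by omega⟩
    · rintro (rfl | ⟨hc, h1⟩)
      · exact ⟨ha, by rw [H.self _ ha]; norm_num⟩
      · exact ⟨hc, by omega⟩
  have hsum := H.sum_weight_pos ha
  rw [hins, Finset.sum_insert (by simp [H.self a ha]), H.self a ha,
    Finset.sum_congr rfl (g := fun _ => (1 : ℤ))] at hsum
  · simp at hsum
    omega
  · intro c hc
    simp only [Finset.mem_filter] at hc
    rw [← H.coroot_comm hodd ha hc.1, hc.2, mul_one]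

/-- The two commuting involutions given by `b` and an orthogonal root `b'` act freely on the roots
pairing to `1` with `b` and nontrivially with `b'`. -/
lemma four_dvd_card_filter (H : IsRootSystem Φ α h) (hodd : Odd h) {b' : Q} (hb : b ∈ Φ)
    (hb' : b' ∈ Φ) (hbb' : α b b' = 0) (E : Finset Q)
    (hE : ∀ g ∈ E, α g b = 0 ∧ α g b' = 0) :
    4 ∣ {c ∈ Φ | α b c = 1 ∧ α b' c ≠ 0 ∧ ∀ g ∈ E, α g c = 0}.card := by
  have hb'b : α b' b = 0 := (H.coroot_eq_zero_comm hb hb').1 hbb'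
  have hself := H.self b hb
  have hself' := H.self b' hb'
  set F : Finset Q := {c ∈ Φ | α b c = 1 ∧ α b' c ≠ 0 ∧ ∀ g ∈ E, α g c = 0} with hF
  have hcases : ∀ c ∈ F, α b' c = 1 ∨ α b' c = -1 := by
    intro c hc
    rw [hF, Finset.mem_filter] at hc
    rcases H.coroot_cases hodd hb' hc.1 with rfl | rfl | h1 | h1 | h1
    · omega
    · rw [map_neg] at hc; omega
    all_goals omega
  have hrefl : ∀ c ∈ F, c - α b' c • b' ∈ F := by
    intro c hc
    rw [hF, Finset.mem_filter] at hc ⊢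
    refine ⟨H.refl_mem b' hb' c hc.1, ?_, ?_, fun g hg => ?_⟩
    · rw [map_sub, map_smul, hbb', hc.2.1]; simp
    · rw [map_sub, map_smul, hself', smul_eq_mul]; have := hc.2.2.1; omega
    · rw [map_sub, map_smul, (hE g hg).2, hc.2.2.2 g hg]; simp
  have hneg : ∀ c ∈ F, b - (c - α b' c • b') ∈ F := by
    intro c hc
    have h1 := hrefl c hc
    rw [hF, Finset.mem_filter] at h1 ⊢
    refine ⟨H.sub_mem hb h1.1 h1.2.1, ?_, ?_, fun g hg => ?_⟩
    · rw [map_sub, h1.2.1, hself]; norm_num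
    · rw [map_sub, hb'b]; have := h1.2.2.1; omega
    · rw [map_sub, (hE g hg).1, h1.2.2.2 g hg]; simp
  have heq : {c ∈ F | ¬ α b' c = 1}.card = {c ∈ F | α b' c = 1}.card := by
    refine Finset.card_nbij' (fun c => c - α b' c • b') (fun c => c - α b' c • b') ?_ ?_
      (fun c _ => H.refl_refl hb' c) (fun c _ => H.refl_refl hb' c)
    all_goals
      intro c hc
      rw [Finset.mem_coe, Finset.mem_filter] at hc ⊢
      refine ⟨hrefl c hc.1, ?_⟩
      have := hcases c hc.1
      rw [map_sub, map_smul, hself', smul_eq_mul]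
      omega
  have heven : Even {c ∈ F | α b' c = 1}.card := by
    rw [even_iff_two_dvd, ← ZMod.natCast_eq_zero_iff, Finset.card_eq_sum_ones, Nat.cast_sum]
    refine Finset.sum_involution (fun c _ => b - (c - α b' c • b')) ?_ ?_ ?_ ?_
    · intro c hc; decide
    · intro c hc _ hcc
      rw [Finset.mem_filter] at hc
      have hc' := (Finset.mem_filter.1 hc.1)
      have h1 := congrArg (α c) hcc
      rw [map_sub, map_sub, map_smul, ← H.coroot_comm hodd hb hc'.1,
        ← H.coroot_comm hodd hb' hc'.1, H.self c hc'.1, hc.2, hc'.2.1] at h1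
      norm_num at h1
    · intro c hc
      rw [Finset.mem_filter] at hc ⊢
      refine ⟨hneg c hc.1, ?_⟩
      rw [map_sub, map_sub, map_smul, hb'b, hself', hc.2]
      norm_num
    · intro c hc
      rw [Finset.mem_filter] at hc
      rw [hc.2, map_sub, map_sub, map_smul, hb'b, hself', hc.2]
      norm_num
      abel
  have hcard := Finset.card_filter_add_card_filter_not (s := F) (fun c => α b' c = 1)
  obtain ⟨k, hk⟩ := heven
  omega

/-- When `h` is odd, there is no subsystem of type `D₄`. -/
lemma not_three_orthogonal (H : IsRootSystem Φ α h) (hodd : Odd h) {b₁ b₂ b₃ : Q} (ha : a ∈ Φ)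
    (h₁ : b₁ ∈ Φ) (h₂ : b₂ ∈ Φ) (h₃ : b₃ ∈ Φ) (h12 : α b₁ b₂ = 0) (h13 : α b₁ b₃ = 0)
    (h23 : α b₂ b₃ = 0) (h1a : α b₁ a = 1) (h2a : α b₂ a = 1) (h3a : α b₃ a = 1) : False := by
  classical
  have s₁ := H.self b₁ h₁
  have s₂ := H.self b₂ h₂
  have s₃ := H.self b₃ h₃
  have sa := H.self a ha
  have h21 : α b₂ b₁ = 0 := (H.coroot_eq_zero_comm h₁ h₂).1 h12
  have h31 : α b₃ b₁ = 0 := (H.coroot_eq_zero_comm h₁ h₃).1 h13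
  have h32 : α b₃ b₂ = 0 := (H.coroot_eq_zero_comm h₂ h₃).1 h23
  have ha1 : α a b₁ = 1 := (H.coroot_comm hodd ha h₁).trans h1a
  have ha2 : α a b₂ = 1 := (H.coroot_comm hodd ha h₂).trans h2a
  have ha3 : α a b₃ = 1 := (H.coroot_comm hodd ha h₃).trans h3a
  have e1 : a - b₁ ∈ Φ := H.sub_mem ha h₁ ha1
  have f1 : α (a - b₁) = α a - α b₁ := H.coroot_sub hodd ha h₁ ha1
  have g1 : α (a - b₁) b₂ = 1 := by rw [f1]; simp [ha2, h12]
  have e2 : a - b₁ - b₂ ∈ Φ := H.sub_mem e1 h₂ g1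
  have f2 : α (a - b₁ - b₂) = α a - α b₁ - α b₂ := by rw [H.coroot_sub hodd e1 h₂ g1, f1]
  have g2 : α (a - b₁ - b₂) b₃ = 1 := by rw [f2]; simp [ha3, h13, h23]
  have e3 : a - b₁ - b₂ - b₃ ∈ Φ := H.sub_mem e2 h₃ g2
  have f3 : α (a - b₁ - b₂ - b₃) = α a - α b₁ - α b₂ - α b₃ := by
    rw [H.coroot_sub hodd e2 h₃ g2, f2]
  have g3 : α a (a - b₁ - b₂ - b₃) = -1 := by simp [sa, ha1, ha2, ha3]
  obtain ⟨b₄, hb₄⟩ : ∃ b₄, b₄ = a + (a - b₁ - b₂ - b₃) := ⟨_, rfl⟩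
  have h₄ : b₄ ∈ Φ := hb₄ ▸ H.add_mem ha e3 g3
  have f4 : α b₄ = (2 : ℤ) • α a - α b₁ - α b₂ - α b₃ := by
    rw [hb₄, H.coroot_add hodd ha e3 g3, f3]; module
  have h14 : α b₁ b₄ = 0 := by rw [hb₄]; simp [s₁, h12, h13, h1a]
  have h24 : α b₂ b₄ = 0 := by rw [hb₄]; simp [s₂, h21, h23, h2a]
  have h34 : α b₃ b₄ = 0 := by rw [hb₄]; simp [s₃, h31, h32, h3a]
  have d2 := H.four_dvd_card_filter hodd h₁ h₂ h12 ∅ (by simp)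
  have d3 := H.four_dvd_card_filter hodd h₁ h₃ h13 {b₂} (by simp [h21, h23])
  have d4 := H.four_dvd_card_filter hodd h₁ h₄ h14 {b₂, b₃} (by simp [h21, h31, h24, h34])
  have hcard := H.card_coroot_eq_one hodd h₁
  have hsplit : {c ∈ Φ | α b₁ c = 1}.card =
      {c ∈ Φ | α b₁ c = 1 ∧ α b₂ c ≠ 0 ∧ ∀ g ∈ (∅ : Finset Q), α g c = 0}.card +
      {c ∈ Φ | α b₁ c = 1 ∧ α b₃ c ≠ 0 ∧ ∀ g ∈ ({b₂} : Finset Q), α g c = 0}.card +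
      {c ∈ Φ | α b₁ c = 1 ∧ α b₄ c ≠ 0 ∧ ∀ g ∈ ({b₂, b₃} : Finset Q), α g c = 0}.card := by
    simp only [Finset.card_filter, ← Finset.sum_add_distrib]
    refine Finset.sum_congr rfl fun c hc => ?_
    have h4 : α b₄ c = 2 * α a c - α b₁ c - α b₂ c - α b₃ c := by rw [f4]; simp
    by_cases h1 : α b₁ c = 1
    · by_cases h2 : α b₂ c = 0
      · by_cases h3 : α b₃ c = 0
        · have : α b₄ c ≠ 0 := by omega
          simp [h1, h2, h3, this]
        · simp [h1, h2, h3]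
      · simp [h1, h2]
    · simp [h1]
  obtain ⟨k, hk⟩ := hodd
  omega

/-- When `h` is odd, positivity of the pairing is transitive on the roots pairing to `1` with
`a`. -/
lemma coroot_pos_trans (H : IsRootSystem Φ α h) (hodd : Odd h) (ha : a ∈ Φ) (hb : b ∈ Φ)
    (hc : c ∈ Φ) (hd : d ∈ Φ) (hab : α a b = 1) (hac : α a c = 1) (had : α a d = 1)
    (hbc : 0 < α b c) (hcd : 0 < α c d) : 0 < α b d := by
  have sa := H.self a ha
  have sb := H.self b hb
  have hca : α c a = 1 := (H.coroot_comm hodd hc ha).trans hac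
  have hba : α b a = 1 := (H.coroot_comm hodd hb ha).trans hab
  have hda : α d a = 1 := (H.coroot_comm hodd hd ha).trans had
  have hcb := H.coroot_comm hodd hb hc
  have hdc := H.coroot_comm hodd hc hd
  rcases H.coroot_cases hodd hb hd with rfl | rfl | h1 | h1 | h1
  · omega
  · rw [map_neg] at had; omega
  · exfalso
    have hbc1 : α b c = 1 := by
      by_contra hne
      obtain rfl := H.eq_of_coroot_eq_two hodd hb hc (by omega)
      omega
    have hcd1 : α c d = 1 := by
      by_contra hne
      obtain rfl := H.eq_of_coroot_eq_two hodd hc hd (by omega)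
      omega
    refine H.not_three_orthogonal hodd ha hb hd (H.sub_mem ha hc hac) h1 ?_ ?_ hba hda ?_
    · rw [map_sub]; omega
    · rw [map_sub]; omega
    · rw [H.coroot_sub hodd ha hc hac, LinearMap.sub_apply]; omega
  · omega
  · exfalso
    have h2 := H.eq_of_coroot_eq_two hodd ha (H.add_mem hb hd h1) (by rw [map_add]; omega)
    have h3 := congrArg (α c) h2
    rw [map_add] at h3
    omega

/-- When `h` is odd, there is a vector `v` on which the coroots take only the values `0` and `± h`,
and the coroots taking the value `h` pair positively with each other. -/
lemma exists_minuscule (H : IsRootSystem Φ α h) (hodd : Odd h) (ha : a ∈ Φ) :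
    ∃ v, α a v = h ∧ (∀ c ∈ Φ, α c v = 0 ∨ α c v = h ∨ α c v = -h) ∧
      ∀ b ∈ Φ, ∀ c ∈ Φ, α b v = h → α c v = h → 0 < α b c := by
  classical
  have hpos := H.h_pos ha
  have sa := H.self a ha
  have hcard := H.card_coroot_eq_one hodd ha
  obtain ⟨b₀, hb₀⟩ : {c ∈ Φ | α a c = 1}.Nonempty := by
    rw [← Finset.card_pos]
    obtain ⟨k, hk⟩ := hodd
    omega
  rw [Finset.mem_filter] at hb₀
  obtain ⟨hb₀, hab₀⟩ := hb₀
  have hb₀a : α b₀ a = 1 := (H.coroot_comm hodd hb₀ ha).trans hab₀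
  obtain ⟨S, hS⟩ : ∃ S : Finset Q, ∀ c, c ∈ S ↔ c ∈ Φ ∧ α a c = 1 ∧ 0 < α b₀ c :=
    ⟨{c ∈ Φ | α a c = 1 ∧ 0 < α b₀ c}, fun c => by rw [Finset.mem_filter]⟩
  have hflip : ∀ c ∈ Φ, α a c = 1 → (c ∉ S ↔ a - c ∈ S) := by
    intro c hc hac
    have h1 := H.coroot_ge hodd hb₀ hc
    have h2 := H.sub_mem ha hc hac
    have h3 : α a (a - c) = 1 := by rw [map_sub]; omega
    have h4 : α b₀ (a - c) = 1 - α b₀ c := by rw [map_sub]; omega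
    rw [hS, hS, h4]
    simp only [hc, hac, h2, h3, true_and]
    omega
  have hcardS : (S.card : ℤ) = h - 2 := by
    have h1 : {c ∈ Φ | α a c = 1}.card = S.card + S.card := by
      rw [← Finset.card_filter_add_card_filter_not (fun c => c ∈ S)]
      congr 1
      · congr 1
        ext c
        simp only [Finset.mem_filter]
        exact ⟨fun hc => hc.2, fun hc => ⟨⟨((hS c).1 hc).1, ((hS c).1 hc).2.1⟩, hc⟩⟩
      · refine Finset.card_nbij' (fun c => a - c) (fun c => a - c) ?_ ?_
          (fun c _ => sub_sub_cancel a c) (fun c _ => sub_sub_cancel a c)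
        · intro c hc
          simp only [Finset.mem_coe, Finset.mem_filter] at hc ⊢
          exact (hflip c hc.1.1 hc.1.2).1 hc.2
        · intro c hc
          have hc' := (hS c).1 hc
          have h2 : α a (a - c) = 1 := by rw [map_sub]; omega
          simp only [Finset.mem_coe, Finset.mem_filter]
          refine ⟨⟨H.sub_mem ha hc'.1 hc'.2.1, h2⟩, ?_⟩
          rw [hflip _ (H.sub_mem ha hc'.1 hc'.2.1) h2, sub_sub_cancel]
          exact hc
    omega
  have hclique : ∀ b ∈ S, ∀ c ∈ S, 0 < α b c := by
    intro b hb c hc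
    rw [hS] at hb hc
    exact H.coroot_pos_trans hodd ha hb.1 hb₀ hc.1 hb.2.1 hab₀ hc.2.1
      ((H.coroot_pos_comm hb₀ hb.1).1 hb.2.2) hc.2.2
  set v := a + ∑ b ∈ S, b with hv
  have hav : α a v = h := by
    rw [hv, map_add, map_sum, Finset.sum_congr rfl fun b hb => ((hS b).1 hb).2.1, sa]
    simp only [Finset.sum_const, nsmul_eq_mul, mul_one]
    omega
  have hSv : ∀ c ∈ S, α c v = h := by
    intro c hc
    have hc' := (hS c).1 hc
    have h1 : ∀ b ∈ S.erase c, α c b = 1 := by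
      intro b hb
      rw [Finset.mem_erase] at hb
      have h2 := hclique c hc b hb.2
      by_contra h3
      exact hb.1 (H.eq_of_coroot_eq_two hodd hc'.1 ((hS b).1 hb.2).1 (by omega))
    rw [hv, map_add, map_sum, ← Finset.add_sum_erase _ _ hc, Finset.sum_congr rfl h1,
      H.self c hc'.1, H.coroot_comm hodd hc'.1 ha, hc'.2.1]
    have h2 := Finset.card_erase_add_one hc
    simp only [Finset.sum_const, nsmul_eq_mul, mul_one]
    omega
  have hone : ∀ c ∈ Φ, α a c = 1 → (c ∈ S ∧ α c v = h) ∨ α c v = 0 := by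
    intro c hc hac
    by_cases hcS : c ∈ S
    · exact .inl ⟨hcS, hSv c hcS⟩
    · right
      have h1 := hSv _ ((hflip c hc hac).1 hcS)
      rw [H.coroot_sub hodd ha hc hac, LinearMap.sub_apply] at h1
      omega
  have hzero : ∀ c ∈ Φ, α a c = 0 → α c v = 0 := by
    intro c hc hac
    have sc := H.self c hc
    have hst : ∀ b ∈ S, b - α c b • c ∈ S := by
      intro b hb
      have hb' := (hS b).1 hb
      have h1 : α a (b - α c b • c) = 1 := by rw [map_sub, map_smul, hac, hb'.2.1]; norm_num
      have h2 := H.refl_mem c hc b hb'.1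
      refine (hS _).2 ⟨h2, h1, H.coroot_pos_trans hodd ha hb₀ hb'.1 h2 hab₀ hb'.2.1 h1 hb'.2.2 ?_⟩
      rw [map_sub, map_smul, H.self b hb'.1, ← H.coroot_comm hodd hc hb'.1, smul_eq_mul]
      rcases H.coroot_cases hodd hc hb'.1 with rfl | rfl | h3 | h3 | h3
      · omega
      · rw [map_neg] at hb'; omega
      all_goals rw [h3]; norm_num
    have hsum : ∑ b ∈ S, α c b = ∑ b ∈ S, -α c b := by
      refine Finset.sum_nbij' (fun b => b - α c b • c) (fun b => b - α c b • c) hst hst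
        (fun b _ => H.refl_refl hc b) (fun b _ => H.refl_refl hc b) (fun b _ => ?_)
      rw [map_sub, map_smul, sc, smul_eq_mul]
      ring
    rw [Finset.sum_neg_distrib] at hsum
    rw [hv, map_add, map_sum, ← H.coroot_comm hodd ha hc, hac]
    omega
  have hall : ∀ c ∈ Φ, ((c = a ∨ c ∈ S) ∧ α c v = h) ∨ α c v = 0 ∨ α c v = -h := by
    intro c hc
    rcases H.coroot_cases hodd ha hc with rfl | rfl | h1 | h1 | h1
    · exact .inl ⟨.inl rfl, hav⟩
    · rw [H.coroot_neg ha, LinearMap.neg_apply]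
      omega
    · exact .inr (.inl (hzero c hc h1))
    · rcases hone c hc h1 with h2 | h2
      · exact .inl ⟨.inr h2.1, h2.2⟩
      · exact .inr (.inl h2)
    · have h2 := hone (-c) (H.neg_mem hc) (by rw [map_neg]; omega)
      rw [H.coroot_neg hc, LinearMap.neg_apply] at h2
      omega
  refine ⟨v, hav, fun c hc => ?_, fun b hb c hc hbv hcv => ?_⟩
  · have := hall c hc
    omega
  · have h1 : b = a ∨ b ∈ S := (hall b hb).elim And.left fun h0 => by omega
    have h2 : c = a ∨ c ∈ S := (hall c hc).elim And.left fun h0 => by omega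
    rcases h1 with rfl | h1 <;> rcases h2 with rfl | h2
    · omega
    · rw [((hS c).1 h2).2.1]; norm_num
    · rw [H.coroot_comm hodd hb hc, ((hS b).1 h1).2.1]; norm_num
    · exact hclique b h1 c h2

/-- When `h` is odd, there is a finite set of lattice vectors stable under the reflections, whose
canonical operator multiplies some root by `h ^ 2`. -/
lemma exists_minuscule_orbit (H : IsRootSystem Φ α h) (hodd : Odd h) (ha : a ∈ Φ) :
    ∃ X : Finset Q, (∀ d ∈ Φ, ∀ u ∈ X, u - α d u • d ∈ X) ∧
      ∑ u ∈ X, α a u • u = h ^ 2 • a := by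
  classical
  have hpos := H.h_pos ha
  obtain ⟨v, hav, hv, hclique⟩ := H.exists_minuscule hodd ha
  have hone : ∀ b ∈ Φ, ∀ c ∈ Φ, α b v = h → α c v = h → c ≠ b → α b c = 1 := by
    intro b hb c hc hbv hcv hne
    have h1 := hclique b hb c hc hbv hcv
    by_contra h2
    exact hne (H.eq_of_coroot_eq_two hodd hb hc (by omega))
  obtain ⟨X, hX⟩ : ∃ X : Finset Q, ∀ u, u ∈ X ↔ u = v ∨ ∃ c ∈ Φ, α c v = h ∧ u = v - h • c :=
    ⟨insert v (({c ∈ Φ | α c v = h}).image fun c => v - h • c), fun u => by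
      simp [and_assoc, eq_comm]⟩
  have hrefl : ∀ d ∈ Φ, α d v = h → ∀ u ∈ X, u - α d u • d ∈ X := by
    intro d hd hdv u hu
    rw [hX] at hu ⊢
    rcases hu with rfl | ⟨c, hc, hcv, rfl⟩
    · exact .inr ⟨d, hd, hdv, by rw [hdv]⟩
    · by_cases hcd : c = d
      · left
        rw [hcd, map_sub, map_smul, hdv, H.self d hd, smul_eq_mul]
        module
      · right
        refine ⟨c, hc, hcv, ?_⟩
        rw [map_sub, map_smul, hdv, hone d hd c hc hdv hcv hcd, smul_eq_mul]
        module
  refine ⟨X, fun d hd u hu => ?_, ?_⟩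
  · rcases hv d hd with h0 | h0 | h0
    · rw [hX] at hu ⊢
      rcases hu with rfl | ⟨c, hc, hcv, rfl⟩
      · exact .inl (by rw [h0, zero_smul, sub_zero])
      · refine .inr ⟨c - α d c • d, H.refl_mem d hd c hc, ?_, ?_⟩
        · rw [H.coroot_refl d hd c hc, h0, zero_smul, sub_zero, hcv]
        · rw [map_sub, map_smul, h0, smul_eq_mul]
          module
    · exact hrefl d hd h0 u hu
    · have := hrefl (-d) (H.neg_mem hd) (by rw [H.coroot_neg hd, LinearMap.neg_apply]; omega) u hu
      rwa [H.coroot_neg hd, LinearMap.neg_apply, neg_smul_neg] at this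
  · have hne : v ≠ v - h • a := by
      intro h1
      have h2 := congrArg (α a) h1
      rw [map_sub, map_smul, H.self a ha, smul_eq_mul] at h2
      omega
    rw [← Finset.sum_subset (s₁ := {v, v - h • a}), Finset.sum_pair hne, map_sub, map_smul,
      H.self a ha, hav, smul_eq_mul]
    · module
    · intro u hu
      rw [hX]
      rcases Finset.mem_insert.1 hu with h1 | h1
      · exact .inl h1
      · exact .inr ⟨a, ha, hav, Finset.mem_singleton.1 h1⟩
    · intro u hu hnu
      rw [hX] at hu
      simp only [Finset.mem_insert, Finset.mem_singleton, not_or] at hnu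
      obtain ⟨c, hc, hcv, rfl⟩ := hu.resolve_left hnu.1
      have hca : c ≠ a := fun h1 => hnu.2 (by rw [h1])
      rw [map_sub, map_smul, hav, hone a ha c hc hav hcv hca, smul_eq_mul, mul_one, sub_self,
        zero_smul]

/-- When `h` is odd, the pairing extends to the whole lattice in its second variable. -/
lemma exists_dual (H : IsRootSystem Φ α h) (hodd : Odd h) (u : Q) :
    ∃ f : Dual ℤ Q, ∀ c ∈ Φ, f c = α c u := by
  have hu : u ∈ Submodule.span ℤ (Φ : Set Q) := H.span_eq_top ▸ Submodule.mem_top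
  induction hu using Submodule.span_induction with
  | mem b hb => exact ⟨α b, fun c hc => H.coroot_comm hodd hb hc⟩
  | zero => exact ⟨0, by simp⟩
  | add x y _ _ hx hy =>
    obtain ⟨f, hf⟩ := hx
    obtain ⟨g, hg⟩ := hy
    exact ⟨f + g, fun c hc => by simp [hf c hc, hg c hc]⟩
  | smul n x _ hx =>
    obtain ⟨f, hf⟩ := hx
    exact ⟨n • f, fun c hc => by simp [hf c hc]⟩

end IsRootSystem

lemma image_eq_of_mapsTo {Q : Type*} [DecidableEq Q] {X : Finset Q} {g : Q → Q}
    (hg : Function.Injective g)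
    (hX : ∀ u ∈ X, g u ∈ X) : X.image g = X :=
  Finset.eq_of_subset_of_card_le (Finset.image_subset_iff.2 hX)
    (Finset.card_image_of_injective X hg).ge

lemma sum_comp_of_mapsTo {Q M : Type*} [AddCommMonoid M] {X : Finset Q} {g : Q → Q}
    (hg : Function.Injective g) (hX : ∀ u ∈ X, g u ∈ X) (F : Q → M) :
    ∑ u ∈ X, F (g u) = ∑ u ∈ X, F u := by
  classical
  conv_rhs => rw [← image_eq_of_mapsTo hg hX]
  exact (Finset.sum_image fun _ _ _ _ h => hg h).symm

section Lifting

variable {Q : Type*} [AddCommGroup Q]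

/-- Suppose that a finite `g`-stable set `X` and a `g`-equivariant family of functionals decompose
the multiplication by `m`. If `m` is prime to `r`, then every vector fixed by `g` modulo `r` is
congruent modulo `r` to a vector fixed by `g`. -/
lemma exists_fixed_add_smul {g : Q →ₗ[ℤ] Q} (hg : Function.Injective g) {X : Finset Q}
    (hX : ∀ u ∈ X, g u ∈ X) {f : Q → Dual ℤ Q} (hf : ∀ u ∈ X, ∀ x, f (g u) (g x) = f u x)
    {m r : ℤ} (hsum : ∀ x, ∑ u ∈ X, f u x • u = m • x) (hmr : IsCoprime m r) {x z : Q}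
    (hx : g x - x = r • z) : ∃ y t, g y = y ∧ x = y + r • t := by
  obtain ⟨p, q, hpq⟩ := hmr
  have hfix : g (∑ u ∈ X, (f u x % r) • u) = ∑ u ∈ X, (f u x % r) • u := by
    rw [map_sum, ← sum_comp_of_mapsTo hg hX fun u => (f u x % r) • u]
    refine Finset.sum_congr rfl fun u hu => ?_
    rw [map_smul, ← hf u hu, eq_add_of_sub_eq hx, map_add, map_smul, smul_eq_mul, add_comm,
      Int.add_mul_emod_self_left]
  have hmod : m • x = ∑ u ∈ X, (f u x % r) • u + r • ∑ u ∈ X, (f u x / r) • u := by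
    rw [← hsum, Finset.smul_sum, ← Finset.sum_add_distrib]
    refine Finset.sum_congr rfl fun u _ => ?_
    rw [smul_smul, ← add_smul, Int.emod_add_mul_ediv]
  refine ⟨p • ∑ u ∈ X, (f u x % r) • u, p • ∑ u ∈ X, (f u x / r) • u + q • x, ?_, ?_⟩
  · rw [map_smul, hfix]
  · calc x = p • (m • x) + r • (q • x) := by rw [smul_smul, smul_smul, ← add_smul, mul_comm r, hpq,
          one_smul]
      _ = _ := by rw [hmod]; module

/-- If every vector fixed by `g` modulo `r` lifts to a vector fixed by `g`, then the number of
vectors fixed by `g` modulo `r` is `r` to the rank of the fixed lattice. -/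
lemma card_fixed_mod [Module.Free ℤ Q] [Module.Finite ℤ Q] (g : Module.End ℤ Q) {r : ℕ} (hr : 0 < r)
    (hlift : ∀ x z, g x - x = (r : ℤ) • z → ∃ y t, g y = y ∧ x = y + (r : ℤ) • t) :
    Nat.card {y : Q ⧸ LinearMap.range ((r : ℤ) • (LinearMap.id : Q →ₗ[ℤ] Q)) //
      ∃ x : Q, Submodule.Quotient.mk x = y ∧
        g x - x ∈ LinearMap.range ((r : ℤ) • (LinearMap.id : Q →ₗ[ℤ] Q))} =
      r ^ Module.finrank ℤ (LinearMap.ker (g - 1)) := by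
  have : NeZero r := ⟨hr.ne'⟩
  have hr' : (r : ℤ) ≠ 0 := by exact_mod_cast hr.ne'
  have hmem : ∀ x, x ∈ LinearMap.range ((r : ℤ) • (LinearMap.id : Q →ₗ[ℤ] Q)) ↔
      ∃ z, (r : ℤ) • z = x := fun x => by simp
  have hker : ∀ x, x ∈ LinearMap.ker (g - 1) ↔ g x = x := fun x => by simp [sub_eq_zero]
  rw [← ModN.natCard_eq (LinearMap.ker (g - 1)) r]
  let φ : LinearMap.ker (g - 1) →ₗ[ℤ]
      Q ⧸ LinearMap.range ((r : ℤ) • (LinearMap.id : Q →ₗ[ℤ] Q)) :=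
    (Submodule.mkQ _).comp (LinearMap.ker (g - 1)).subtype
  have hφ : LinearMap.ker φ = LinearMap.range (LinearMap.lsmul ℤ (LinearMap.ker (g - 1)) r) := by
    ext ⟨x, hx⟩
    rw [LinearMap.mem_ker, LinearMap.comp_apply, Submodule.mkQ_apply,
      Submodule.Quotient.mk_eq_zero, Submodule.subtype_apply, hmem, LinearMap.mem_range]
    constructor
    · rintro ⟨z, rfl⟩
      refine ⟨⟨z, ?_⟩, rfl⟩
      rw [hker, map_smul] at hx
      rw [hker]
      exact smul_right_injective Q hr' hx
    · rintro ⟨z, hz⟩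
      exact ⟨z, congrArg Subtype.val hz⟩
  have hrange : ∀ y, y ∈ LinearMap.range φ ↔ ∃ x : Q, Submodule.Quotient.mk x = y ∧
      g x - x ∈ LinearMap.range ((r : ℤ) • (LinearMap.id : Q →ₗ[ℤ] Q)) := by
    intro y
    constructor
    · rintro ⟨⟨x, hx⟩, rfl⟩
      refine ⟨x, rfl, ?_⟩
      rw [(hker x).1 hx, sub_self]
      exact zero_mem _
    · rintro ⟨x, rfl, hx⟩
      obtain ⟨z, hz⟩ := (hmem _).1 hx
      obtain ⟨y, t, hy, hxy⟩ := hlift x z hz.symm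
      refine ⟨⟨y, (hker y).2 hy⟩, (Submodule.Quotient.eq _).2 ((hmem _).2 ⟨-t, ?_⟩)⟩
      rw [hxy, Submodule.subtype_apply]
      module
  exact Nat.card_congr ((Equiv.subtypeEquivRight hrange).symm.trans
    ((Submodule.quotEquivOfEq _ _ hφ.symm).trans φ.quotKerEquivRange).symm.toEquiv)

end Lifting

section WeylGroup

variable {Q : Type*} [AddCommGroup Q] {W : Type*} [Group W] (ρ : Representation ℤ W Q)
  {Φ : Finset Q} {α : Q → Dual ℤ Q}

lemma rho_injective (w : W) : Function.Injective (ρ w) :=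
  (ρ.apply_bijective w).1

/-- A finite set stable under the reflections is stable under the whole group. -/
lemma apply_mem_of_refl_mem (hgen : Subgroup.closure
      {s : W | ∃ a ∈ Φ, ∀ x : Q, ρ s x = x - α a x • a} = ⊤) {X : Finset Q}
    (hX : ∀ d ∈ Φ, ∀ u ∈ X, u - α d u • d ∈ X) (w : W) : ∀ u ∈ X, ρ w u ∈ X := by
  classical
  have hw : w ∈ Subgroup.closure {s : W | ∃ a ∈ Φ, ∀ x : Q, ρ s x = x - α a x • a} :=
    hgen ▸ Subgroup.mem_top w
  induction hw using Subgroup.closure_induction with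
  | mem s hs =>
    obtain ⟨a, ha, hs⟩ := hs
    exact fun u hu => hs u ▸ hX a ha u hu
  | one => simp
  | mul s t _ _ hs ht => exact fun u hu => by simpa using hs _ (ht u hu)
  | inv s _ hs =>
    intro u hu
    rw [← image_eq_of_mapsTo (rho_injective ρ s) hs] at hu
    obtain ⟨v, hv, rfl⟩ := Finset.mem_image.1 hu
    rwa [ρ.inv_self_apply]

variable [Module.Free ℤ Q]

lemma coroot_equivariant (hspan : Submodule.span ℤ (Φ : Set Q) = ⊤)
    (hpair : ∀ a ∈ Φ, α a a = 2) (hstab : ∀ a ∈ Φ, ∀ w : W, ρ w a ∈ Φ)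
    (hrefl : ∀ a ∈ Φ, ∃ s : W, ∀ x : Q, ρ s x = x - α a x • a) (w : W) {c : Q} (hc : c ∈ Φ)
    (x : Q) : α (ρ w c) (ρ w x) = α c x := by
  have hinv : ∀ x, ρ w⁻¹ (ρ w x) = x := fun x => ρ.inv_self_apply w x
  have hinv' : ∀ x, ρ w (ρ w⁻¹ x) = x := fun x => ρ.self_inv_apply w x
  have key : α (ρ w c) = (α c).comp (ρ w⁻¹) := by
    refine Dual.eq_of_preReflection_mapsTo Φ.finite_toSet hspan (x := ρ w c)
      (hpair _ (hstab c hc w)) ?_ ?_ ?_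
    · intro b hb
      obtain ⟨s, hs⟩ := hrefl _ (hstab c hc w)
      rw [preReflection_apply, ← hs]
      exact hstab b hb s
    · rw [LinearMap.comp_apply, hinv, hpair c hc]
    · intro b hb
      obtain ⟨s, hs⟩ := hrefl c hc
      have h1 : preReflection (ρ w c) ((α c).comp (ρ w⁻¹)) b = ρ w (ρ s (ρ w⁻¹ b)) := by
        rw [hs, map_sub, map_smul, hinv', preReflection_apply, LinearMap.comp_apply]
      rw [h1]
      exact hstab _ (hstab _ (hstab b hb _) _) _
  rw [key, LinearMap.comp_apply, hinv]

variable [Module.Finite ℤ Q]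

/-- Schur's lemma: an equivariant endomorphism of an irreducible lattice with an eigenvector is a
scalar. -/
lemma eq_smul_of_equivariant
    (hirr : ∀ p : Submodule ℤ Q, (∀ w : W, ∀ x ∈ p, ρ w x ∈ p) →
      p = ⊥ ∨ Module.finrank ℤ p = Module.finrank ℤ Q)
    {T : Module.End ℤ Q} (hT : ∀ w x, T (ρ w x) = ρ w (T x)) {m : ℤ} {a : Q} (ha : a ≠ 0)
    (hTa : T a = m • a) (x : Q) : T x = m • x := by
  have hker : ∀ x, x ∈ LinearMap.ker (T - m • (1 : Module.End ℤ Q)) ↔ T x = m • x := fun x => by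
    simp [sub_eq_zero]
  have hfin := (hirr (LinearMap.ker (T - m • (1 : Module.End ℤ Q))) fun w x hx => by
    rw [hker] at hx ⊢
    rw [hT, hx, map_smul]).resolve_left fun h0 => ha <| by
      rw [← Submodule.mem_bot ℤ, ← h0, hker]
      exact hTa
  have h1 := Submodule.finrank_quotient_add_finrank
    (LinearMap.ker (T - m • (1 : Module.End ℤ Q)))
  rw [LinearEquiv.finrank_eq (LinearMap.quotKerEquivRange _), hfin] at h1
  have h2 : LinearMap.range (T - m • (1 : Module.End ℤ Q)) = ⊥ :=
    Submodule.finrank_eq_zero.1 (by omega)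
  rw [LinearMap.range_eq_bot] at h2
  rw [← hker, h2, LinearMap.ker_zero]
  exact Submodule.mem_top

lemma isRootSystem_of_irreducible [Nontrivial Q]
    (hspan : Submodule.span ℤ (Φ : Set Q) = ⊤)
    (hpair : ∀ a ∈ Φ, α a a = 2) (hstab : ∀ a ∈ Φ, ∀ w : W, ρ w a ∈ Φ)
    (hrefl : ∀ a ∈ Φ, ∃ s : W, ∀ x : Q, ρ s x = x - α a x • a)
    (hred : ∀ a ∈ Φ, (2 : ℤ) • a ∉ Φ)
    (hirr : ∀ p : Submodule ℤ Q, (∀ w : W, ∀ x ∈ p, ρ w x ∈ p) →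
      p = ⊥ ∨ Module.finrank ℤ p = Module.finrank ℤ Q)
    {h : ℕ} (hcox : Φ.card = h * Module.finrank ℤ Q) {a : Q} (ha : a ∈ Φ) :
    IsRootSystem Φ α (h : ℤ) where
  span_eq_top := hspan
  self := hpair
  refl_mem := fun a ha c hc => by
    obtain ⟨s, hs⟩ := hrefl a ha
    exact hs c ▸ hstab c hc s
  coroot_refl := fun a ha c hc x => by
    obtain ⟨s, hs⟩ := hrefl a ha
    have h1 := coroot_equivariant ρ hspan hpair hstab hrefl s hc (ρ s x)
    have h2 : ρ s (ρ s x) = x := by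
      rw [hs, hs, map_sub, map_smul, hpair a ha, smul_eq_mul]
      module
    rwa [h2, hs, hs] at h1
  reduced := hred
  sum_smul := by
    set T : Module.End ℤ Q := ∑ c ∈ Φ, (α c).smulRight c with hTdef
    have hTx : ∀ x, T x = ∑ c ∈ Φ, α c x • c := fun x => by simp [hTdef]
    have hT : ∀ w x, T (ρ w x) = ρ w (T x) := by
      intro w x
      rw [hTx, hTx, map_sum, ← sum_comp_of_mapsTo (rho_injective ρ w) fun c hc => hstab c hc w]
      refine Finset.sum_congr rfl fun c hc => ?_
      rw [coroot_equivariant ρ hspan hpair hstab hrefl w hc, map_smul]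
    have ha0 : a ≠ 0 := by
      rintro rfl
      simpa using hpair 0 ha
    have hTa : ((2 : ℤ) • T) a = α a (T a) • a := by
      obtain ⟨s, hs⟩ := hrefl a ha
      have h1 := hT s a
      rw [hs, hs, hpair a ha, map_sub, map_smul] at h1
      rw [LinearMap.smul_apply, ← sub_eq_zero, ← sub_eq_zero.2 h1.symm]
      module
    have hscal := eq_smul_of_equivariant ρ hirr (T := (2 : ℤ) • T)
      (fun w x => by rw [LinearMap.smul_apply, hT, LinearMap.smul_apply, map_smul]) ha0 hTa
    have htr : LinearMap.trace ℤ Q ((2 : ℤ) • T) = 4 * (h * Module.finrank ℤ Q) := by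
      rw [map_smul, hTdef, map_sum, Finset.sum_congr rfl fun c hc =>
        (LinearMap.trace_smulRight (α c) c).trans (hpair c hc)]
      simp only [Finset.sum_const, hcox, nsmul_eq_mul, smul_eq_mul]
      push_cast
      ring
    rw [show (2 : ℤ) • T = α a (T a) • LinearMap.id from LinearMap.ext hscal, map_smul,
      LinearMap.trace_id, smul_eq_mul, ← mul_assoc] at htr
    have hlam : α a (T a) = 4 * h :=
      mul_right_cancel₀ (by exact_mod_cast (Module.finrank_pos (R := ℤ) (M := Q)).ne') htr
    intro x
    have h2 := hscal x
    rw [LinearMap.smul_apply, hlam] at h2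
    rw [← hTx]
    apply smul_right_injective Q (two_ne_zero (α := ℤ))
    change (2 : ℤ) • T x = (2 : ℤ) • _
    rw [h2]
    module

lemma exists_fixed_lift [Nontrivial Q]
    (hspan : Submodule.span ℤ (Φ : Set Q) = ⊤)
    (hpair : ∀ a ∈ Φ, α a a = 2) (hstab : ∀ a ∈ Φ, ∀ w : W, ρ w a ∈ Φ)
    (hrefl : ∀ a ∈ Φ, ∃ s : W, ∀ x : Q, ρ s x = x - α a x • a)
    (hgen : Subgroup.closure
      {s : W | ∃ a ∈ Φ, ∀ x : Q, ρ s x = x - α a x • a} = ⊤)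
    (hred : ∀ a ∈ Φ, (2 : ℤ) • a ∉ Φ)
    (hirr : ∀ p : Submodule ℤ Q, (∀ w : W, ∀ x ∈ p, ρ w x ∈ p) →
      p = ⊥ ∨ Module.finrank ℤ p = Module.finrank ℤ Q)
    {h : ℕ} (hcox : Φ.card = h * Module.finrank ℤ Q) {r : ℕ} (hcop : Nat.Coprime r h) (w : W)
    (x z : Q) (hx : ρ w x - x = (r : ℤ) • z) : ∃ y t, ρ w y = y ∧ x = y + (r : ℤ) • t := by
  obtain ⟨a, ha⟩ : Φ.Nonempty := by
    rw [Finset.nonempty_iff_ne_empty]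
    rintro rfl
    rw [Finset.coe_empty, Submodule.span_empty] at hspan
    exact bot_ne_top hspan
  have H := isRootSystem_of_irreducible ρ hspan hpair hstab hrefl hred hirr hcox ha
  have heq := coroot_equivariant ρ hspan hpair hstab hrefl
  have hcop' : IsCoprime (h : ℤ) r := (Nat.isCoprime_iff_coprime.2 hcop).symm
  rcases Nat.even_or_odd h with heven | hodd
  · have h2 : IsCoprime (2 : ℤ) r := by
      obtain ⟨k, rfl⟩ := heven
      rw [← two_mul] at hcop'
      push_cast at hcop'
      exact hcop'.of_mul_left_left
    exact exists_fixed_add_smul (rho_injective ρ w) (fun c hc => hstab c hc w)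
      (fun c hc x => heq w hc x) H.sum_smul (h2.mul_left hcop') hx
  · have hodd' : Odd (h : ℤ) := by exact_mod_cast hodd
    obtain ⟨X, hX, hXa⟩ := H.exists_minuscule_orbit hodd' ha
    choose f hf using H.exists_dual hodd'
    have hXw := apply_mem_of_refl_mem ρ hgen hX
    have hfw : ∀ w u x, f (ρ w u) (ρ w x) = f u x := by
      intro w u x
      have hext : (f (ρ w u)).comp (ρ w) = f u := by
        refine LinearMap.ext_on hspan fun c hc => ?_
        rw [LinearMap.comp_apply, hf _ _ (hstab c hc w), heq w hc, hf _ _ hc]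
      rw [← hext, LinearMap.comp_apply]
    set T : Module.End ℤ Q := ∑ u ∈ X, (f u).smulRight u with hTdef
    have hTx : ∀ x, T x = ∑ u ∈ X, f u x • u := fun x => by simp [hTdef]
    have ha0 : a ≠ 0 := by
      rintro rfl
      simpa using hpair 0 ha
    have hscal := eq_smul_of_equivariant ρ hirr (T := T) (m := (h : ℤ) ^ 2) (fun w x => by
      rw [hTx, hTx, map_sum, ← sum_comp_of_mapsTo (rho_injective ρ w) (hXw w)]
      exact Finset.sum_congr rfl fun u hu => by rw [hfw, map_smul]) ha0
      (by rw [hTx, ← hXa]; exact Finset.sum_congr rfl fun u _ => by rw [hf u a ha])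
    exact exists_fixed_add_smul (rho_injective ρ w) (hXw w) (fun u _ => hfw w u)
      (fun x => (hTx x).symm.trans (hscal x)) hcop'.pow_left hx

end WeylGroup

end WeylLattice

/-- let `W` be an irreducible Weyl group of rank `ℓ` with root
lattice `Q` and Coxeter number `h = |Φ|/ℓ`, and `r` a positive integer coprime
to `h`.  Then the permutation representation `ℂ[Q/rQ]` of `W` has character
`w ↦ r^{fix(w)}` (its value at `w` is the number of fixed points of `w` on
`Q/rQ`), and consequently for any irreducible representation `τ` of `W` the
multiplicity of `τ` in `ℂ[Q/rQ]`, i.e. the inner product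
`(1/|W|)·Σ_w Tr(w,τ)·#Fix(w)`, equals `(1/|W|)·Σ_{w∈W} Tr(w,τ)·r^{fix(w)}`. -/
theorem stmt11 {Q : Type*} [AddCommGroup Q] [Module ℤ Q]
    [Module.Free ℤ Q] [Module.Finite ℤ Q]
    {W : Type} [Group W] [Fintype W] (ρ : Representation ℤ W Q)
    (hfaith : Function.Injective ρ)
    (ℓ : ℕ) (hl : Module.finrank ℤ Q = ℓ) (hl0 : 0 < ℓ)
    (Φ : Finset Q) (α : Q → Module.Dual ℤ Q)
    (hspan : Submodule.span ℤ (Φ : Set Q) = ⊤)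
    (hpair : ∀ a ∈ Φ, α a a = 2)
    (hstab : ∀ a ∈ Φ, ∀ w : W, ρ w a ∈ Φ)
    (hrefl : ∀ a ∈ Φ, ∃ s : W, ∀ x : Q, ρ s x = x - α a x • a)
    (hgen : Subgroup.closure
        {s : W | ∃ a ∈ Φ, ∀ x : Q, ρ s x = x - α a x • a} = ⊤)
    (hred : ∀ a ∈ Φ, (2 : ℤ) • a ∉ Φ)
    (hirr : ∀ p : Submodule ℤ Q, (∀ w : W, ∀ x ∈ p, ρ w x ∈ p) →
        p = ⊥ ∨ Module.finrank ℤ p = ℓ)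
    (h : ℕ) (hcox : Φ.card = h * ℓ)
    (r : ℕ) (hr : 0 < r) (hcop : Nat.Coprime r h) :
    (∀ w : W,
      Nat.card {y : Q ⧸ LinearMap.range ((r : ℤ) • (LinearMap.id : Q →ₗ[ℤ] Q)) //
          ∃ x : Q, Submodule.Quotient.mk x = y ∧
            ρ w x - x ∈ LinearMap.range ((r : ℤ) • (LinearMap.id : Q →ₗ[ℤ] Q))} =
        r ^ (Module.finrank ℤ (LinearMap.ker ((ρ w : Module.End ℤ Q) - 1))))
    ∧ ∀ (τ : FDRep ℂ W), CategoryTheory.Simple τ →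
      (∑ w : W, τ.character w *
          (Nat.card {y : Q ⧸ LinearMap.range ((r : ℤ) • (LinearMap.id : Q →ₗ[ℤ] Q)) //
            ∃ x : Q, Submodule.Quotient.mk x = y ∧
              ρ w x - x ∈ LinearMap.range ((r : ℤ) • (LinearMap.id : Q →ₗ[ℤ] Q))} : ℂ)) /
          (Fintype.card W : ℂ) =
        (∑ w : W, τ.character w *
            (r : ℂ) ^ (Module.finrank ℤ (LinearMap.ker ((ρ w : Module.End ℤ Q) - 1)))) /
          (Fintype.card W : ℂ) := by
  obtain rfl : ‹Module ℤ Q› = AddCommGroup.toIntModule Q := Subsingleton.elim _ _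
  subst hl
  have : Nontrivial Q := Module.nontrivial_of_finrank_pos hl0
  have hcard := fun w => WeylLattice.card_fixed_mod (ρ w) hr
    (WeylLattice.exists_fixed_lift ρ hspan hpair hstab hrefl hgen hred hirr hcox hcop w)
  refine ⟨hcard, fun τ _ => ?_⟩
  simp only [hcard, Nat.cast_pow]
end

section
/- Let h be the reflection representation of a finite Coxeter group W, r a positive integer, and ℓ = dim h. Define f(w,t) = t^{−(r−1)ℓ/2}·det(1 − t^r·w)/det(1 − t·w). Then (1/|W|)·Σ_{w∈W} f(w,t) = t^{−(r−1)ℓ/2}·Π_{i=1}^{ℓ} (1 − t^{d_i + r − 1})/(1 − t^{d_i}), where d_1,…,d_ℓ are the degrees of W. -/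
open Module

namespace ReflectionSolomon

/-- The `p`-th compound matrix: the matrix of `p × p` minors. -/
noncomputable def compound {R : Type*} [CommRing R] {n : ℕ} (p : ℕ)
    (A : Matrix (Fin n) (Fin n) R) :
    Matrix (Set.powersetCard (Fin n) p) (Set.powersetCard (Fin n) p) R :=
  Matrix.of fun s t => (A.submatrix (Set.powersetCard.ofFinEmbEquiv.symm s)
    (Set.powersetCard.ofFinEmbEquiv.symm t)).det

section compound

variable {R : Type*} [CommRing R] {n : ℕ} (p : ℕ)

theorem compound_eq_toMatrix (A : Matrix (Fin n) (Fin n) R) :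
    compound p A = LinearMap.toMatrix ((Pi.basisFun R (Fin n)).exteriorPower p)
      ((Pi.basisFun R (Fin n)).exteriorPower p) (exteriorPower.map p (Matrix.toLin' A)) := by
  ext s t
  rw [LinearMap.toMatrix_apply, exteriorPower.basis_repr_apply, exteriorPower.basis_apply,
    exteriorPower.map_apply_ιMulti_family, exteriorPower.ιMulti_family,
    exteriorPower.ιMultiDual_apply_ιMulti, compound, Matrix.of_apply, ← Matrix.det_transpose]
  congr 1
  ext i j
  simp

theorem compound_mul (A B : Matrix (Fin n) (Fin n) R) :
    compound p (A * B) = compound p A * compound p B := by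
  simp only [compound_eq_toMatrix, Matrix.toLin'_mul]
  rw [exteriorPower.map_comp, LinearMap.toMatrix_comp _ ((Pi.basisFun R (Fin n)).exteriorPower p)]

theorem compound_one : compound p (1 : Matrix (Fin n) (Fin n) R) = 1 := by
  rw [compound_eq_toMatrix, Matrix.toLin'_one, exteriorPower.map_id, LinearMap.toMatrix_id]

theorem compound_map {R' : Type*} [CommRing R'] (f : R →+* R') (A : Matrix (Fin n) (Fin n) R) :
    compound p (A.map f) = (compound p A).map f := by
  ext s t
  simp only [compound, Matrix.of_apply, Matrix.map_apply, RingHom.map_det]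
  rfl

theorem trace_compound_diagonal (l : Fin n → R) :
    (compound p (Matrix.diagonal l)).trace =
      ∑ s : Set.powersetCard (Fin n) p, ∏ i ∈ s.1, l i := by
  refine Finset.sum_congr rfl fun s _ => ?_
  rw [Matrix.diag_apply, compound, Matrix.of_apply,
    Matrix.submatrix_diagonal _ _ (Set.powersetCard.ofFinEmbEquiv.symm s).injective,
    Matrix.det_diagonal]
  conv_rhs => rw [← Finset.image_orderEmbOfFin_univ s.1 s.2]
  rw [Finset.prod_image fun i _ j _ h => (Finset.orderEmbOfFin s.1 s.2).injective h]
  rfl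

/-- A common left complement of the `p`-th compound matrix: multiplying gives the determinant. -/
theorem exists_mul_compound_eq (A : Matrix (Fin n) (Fin n) R) :
    ∃ B : Matrix (Set.powersetCard (Fin n) p) (Set.powersetCard (Fin n) p) R,
      B * compound p A = A.det • (1 : Matrix _ _ R) := by
  classical
  let e (s : Set.powersetCard (Fin n) p) : Fin p ↪o Fin n := Set.powersetCard.ofFinEmbEquiv.symm s
  let fill (s : Set.powersetCard (Fin n) p) (v : Fin p → Fin n → R) : Fin n → Fin n → R :=
    Function.extend (e s) v fun i => A.transpose i
  have fill_upd (s v k x) : fill s (Function.update v k x) =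
      Function.update (fill s v) (e s k) x := by
    ext i : 1
    by_cases hi : ∃ j, e s j = i
    · obtain ⟨j, rfl⟩ := hi
      simp only [fill, (e s).injective.extend_apply, Function.update_apply, (e s).injective.eq_iff]
    · rw [Function.update_of_ne fun h => hi ⟨k, h.symm⟩]
      simp only [fill, Function.extend_apply' _ _ _ hi]
  let c (s : Set.powersetCard (Fin n) p) : (Fin n → R) [⋀^Fin p]→ₗ[R] R :=
    { toFun := fun v => Matrix.det (fill s v)
      map_update_add' := by
        intro _ v i x y
        have := Subsingleton.elim ‹DecidableEq (Fin p)› (instDecidableEqFin p)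
        subst this
        simp only [fill_upd]
        exact Matrix.det_updateRow_add _ _ _ _
      map_update_smul' := by
        intro _ v i x y
        have := Subsingleton.elim ‹DecidableEq (Fin p)› (instDecidableEqFin p)
        subst this
        simp only [fill_upd]
        exact Matrix.det_updateRow_smul _ _ _ _
      map_eq_zero_of_eq' := by
        intro v i j hij hne
        refine Matrix.det_zero_of_row_eq (i := e s i) (j := e s j)
          (fun h => hne ((e s).injective h)) ?_
        simp only [fill, (e s).injective.extend_apply, hij] }
  let b := (Pi.basisFun R (Fin n)).exteriorPower p
  refine ⟨Matrix.of fun s t => exteriorPower.alternatingMapLinearEquiv (c s) (b t), ?_⟩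
  ext s t
  have key : (∑ u, exteriorPower.alternatingMapLinearEquiv (c s) (b u) * compound p A u t) =
      exteriorPower.alternatingMapLinearEquiv (c s)
        (exteriorPower.map p (Matrix.toLin' A) (b t)) := by
    conv_rhs => rw [← b.sum_repr (exteriorPower.map p (Matrix.toLin' A) (b t))]
    rw [map_sum]
    refine Finset.sum_congr rfl fun u _ => ?_
    rw [map_smul, compound_eq_toMatrix, LinearMap.toMatrix_apply, smul_eq_mul, mul_comm]
  rw [Matrix.mul_apply]
  simp only [Matrix.of_apply]
  rw [key, exteriorPower.basis_apply, exteriorPower.map_apply_ιMulti_family,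
    exteriorPower.ιMulti_family, exteriorPower.alternatingMapLinearEquiv_apply_ιMulti,
    Matrix.smul_apply, Matrix.one_apply]
  have hA : ∀ i, (Matrix.toLin' A) (Pi.basisFun R (Fin n) i) = A.transpose i := by
    intro i; ext j; simp
  change Matrix.det (fill s _) = _
  by_cases hst : s = t
  · subst hst
    rw [if_pos rfl, smul_eq_mul, mul_one, ← Matrix.det_transpose A]
    congr 1
    ext i j
    by_cases hi : ∃ k, e s k = i
    · obtain ⟨k, rfl⟩ := hi
      simp only [fill, (e s).injective.extend_apply]
      exact congrFun (hA _) j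
    · simp only [fill, Function.extend_apply' _ _ _ hi]
  · rw [if_neg hst, smul_zero]
    obtain ⟨i, hit, his⟩ := (Set.powersetCard.exists_mem_notMem_iff_ne t s).mp (Ne.symm hst)
    obtain ⟨k, rfl⟩ := (Set.powersetCard.mem_range_ofFinEmbEquiv_symm_iff_mem t i).mpr hit
    have hk : ¬ ∃ j, e s j = e t k := fun h =>
      his ((Set.powersetCard.mem_range_ofFinEmbEquiv_symm_iff_mem s _).mp h)
    refine Matrix.det_zero_of_row_eq (i := e s k) (j := e t k) (fun h => hk ⟨k, h⟩) ?_
    simp only [fill, (e s).injective.extend_apply, Function.extend_apply' _ _ _ hk]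
    exact hA _

end compound

section

open MvPolynomial

section substitution

variable {n : ℕ}

/-- The algebra endomorphism of the polynomial ring induced by a linear change of variables. -/
noncomputable def linSubst (A : Matrix (Fin n) (Fin n) ℂ) :
    MvPolynomial (Fin n) ℂ →ₐ[ℂ] MvPolynomial (Fin n) ℂ :=
  aeval fun j => ∑ i, C (A i j) * X i

theorem linSubst_X (A : Matrix (Fin n) (Fin n) ℂ) (j : Fin n) :
    linSubst A (X j) = ∑ i, C (A i j) * X i := by
  simp [linSubst]

@[simp]
theorem linSubst_C (A : Matrix (Fin n) (Fin n) ℂ) (c : ℂ) : linSubst A (C c) = C c :=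
  (linSubst A).commutes c

theorem linSubst_mul (A B : Matrix (Fin n) (Fin n) ℂ) :
    linSubst (A * B) = (linSubst A).comp (linSubst B) := by
  ext1 j
  simp only [AlgHom.comp_apply, linSubst_X, map_sum, map_mul, linSubst_C, Matrix.mul_apply,
    Finset.sum_mul, Finset.mul_sum]
  rw [Finset.sum_comm]
  refine Finset.sum_congr rfl fun i _ => Finset.sum_congr rfl fun k _ => ?_
  ring

theorem linSubst_one : linSubst (1 : Matrix (Fin n) (Fin n) ℂ) = AlgHom.id ℂ _ := by
  ext1 j
  simp [linSubst_X, Matrix.one_apply, apply_ite (C : ℂ → MvPolynomial (Fin n) ℂ), ite_mul]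

theorem linSubst_isHomogeneous (A : Matrix (Fin n) (Fin n) ℂ) {p : MvPolynomial (Fin n) ℂ} {k : ℕ}
    (hp : p.IsHomogeneous k) : (linSubst A p).IsHomogeneous k := by
  have := hp.aeval (fun j => ∑ i, C (A i j) * X i) (n := 1) fun j =>
    IsHomogeneous.sum _ _ _ fun _ _ => isHomogeneous_C_mul_X _ _
  rwa [one_mul] at this

theorem homogeneousComponent_linSubst (A : Matrix (Fin n) (Fin n) ℂ) (p : MvPolynomial (Fin n) ℂ)
    (k : ℕ) : homogeneousComponent k (linSubst A p) = linSubst A (homogeneousComponent k p) := by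
  conv_lhs => rw [← sum_homogeneousComponent p]
  rw [map_sum, map_sum]
  have h (i : ℕ) : homogeneousComponent k (linSubst A (homogeneousComponent i p)) =
      if i = k then linSubst A (homogeneousComponent k p) else 0 := by
    rw [homogeneousComponent_of_mem
      (linSubst_isHomogeneous A (homogeneousComponent_isHomogeneous i p))]
    split_ifs with h1 h2 h2 <;> first | rfl | (subst h1; rfl) | omega
  simp only [h, Finset.sum_ite_eq', Finset.mem_range]
  split_ifs with hk
  · rfl
  · rw [homogeneousComponent_eq_zero _ _ (by omega), map_zero]

/-- A linear change of variables on the homogeneous polynomials of degree `k`. -/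
noncomputable def linSubstDeg (k : ℕ) (A : Matrix (Fin n) (Fin n) ℂ) :
    homogeneousSubmodule (Fin n) ℂ k →ₗ[ℂ] homogeneousSubmodule (Fin n) ℂ k :=
  (linSubst A).toLinearMap.restrict fun _ hp => linSubst_isHomogeneous A hp

theorem linSubstDeg_mul (k : ℕ) (A B : Matrix (Fin n) (Fin n) ℂ) :
    linSubstDeg k (A * B) = linSubstDeg k A * linSubstDeg k B := by
  ext1 p
  apply Subtype.ext
  change linSubst (A * B) p.1 = _
  rw [linSubst_mul]
  rfl

theorem linSubstDeg_one (k : ℕ) : linSubstDeg k (1 : Matrix (Fin n) (Fin n) ℂ) = 1 := by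
  ext1 p
  apply Subtype.ext
  change linSubst 1 p.1 = _
  rw [linSubst_one]
  rfl

instance (k : ℕ) : Module.Finite ℂ (homogeneousSubmodule (Fin n) ℂ k) :=
  Module.Finite.iff_fg.mpr (homogeneousSubmodule_fg _ _ k)

theorem mem_finsuppAntidiag_univ (k : ℕ) (d : Fin n →₀ ℕ) :
    d ∈ Finset.finsuppAntidiag Finset.univ k ↔ d.degree = k := by
  simp [Finset.mem_finsuppAntidiag, Finsupp.degree_eq_sum]

/-- The monomial basis of the homogeneous polynomials of degree `k`. -/
noncomputable def monomialBasisDeg (n k : ℕ) :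
    Basis (Finset.finsuppAntidiag (Finset.univ : Finset (Fin n)) k) ℂ
      (homogeneousSubmodule (Fin n) ℂ k) :=
  Basis.mk (v := fun d => ⟨monomial d.1 1,
      isHomogeneous_monomial 1 ((mem_finsuppAntidiag_univ k _).mp d.2)⟩)
    (by
      apply LinearIndependent.of_comp (homogeneousSubmodule (Fin n) ℂ k).subtype
      have := (basisMonomials (Fin n) ℂ).linearIndependent.comp
        (fun d : Finset.finsuppAntidiag (Finset.univ : Finset (Fin n)) k => d.1)
        Subtype.val_injective
      rw [coe_basisMonomials] at this
      exact this)
    (by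
      rintro ⟨p, hp⟩ -
      rw [Submodule.mem_span_range_iff_exists_fun]
      refine ⟨fun d => coeff d.1 p, Subtype.ext ?_⟩
      rw [AddSubmonoidClass.coe_finsetSum]
      simp only [SetLike.val_smul, smul_monomial, smul_eq_mul, mul_one]
      rw [Finset.sum_coe_sort (Finset.finsuppAntidiag Finset.univ k)
        fun d => monomial d (coeff d p)]
      conv_rhs => rw [p.as_sum]
      refine (Finset.sum_subset (fun d hd => ?_) fun d _ hd => ?_).symm
      · rw [mem_finsuppAntidiag_univ]
        by_contra h
        exact (mem_support_iff.mp hd) (hp.coeff_eq_zero h)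
      · rw [notMem_support_iff.mp hd, map_zero])

theorem linSubst_diagonal_monomial (l : Fin n → ℂ) (d : Fin n →₀ ℕ) :
    linSubst (Matrix.diagonal l) (monomial d 1) = (∏ i, l i ^ d i) • monomial d (1 : ℂ) := by
  have hX (j : Fin n) : linSubst (Matrix.diagonal l) (X j) = C (l j) * X j := by
    rw [linSubst_X, Finset.sum_eq_single j]
    · simp
    · intro i _ hij
      simp [Matrix.diagonal_apply_ne _ hij]
    · simp
  rw [monomial_eq, Finsupp.prod_fintype _ _ fun i => pow_zero _]
  simp [map_prod, hX, mul_pow, Finset.prod_mul_distrib, smul_eq_C_mul]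

theorem trace_linSubstDeg_diagonal (l : Fin n → ℂ) (k : ℕ) :
    LinearMap.trace ℂ _ (linSubstDeg k (Matrix.diagonal l)) =
      ∑ d ∈ Finset.finsuppAntidiag Finset.univ k, ∏ i, l i ^ d i := by
  classical
  rw [LinearMap.trace_eq_matrix_trace ℂ (monomialBasisDeg n k), Matrix.trace]
  refine Eq.trans (Finset.sum_congr rfl fun d _ => ?_)
    (Finset.sum_coe_sort (Finset.finsuppAntidiag Finset.univ k) fun d => ∏ i, l i ^ d i)
  have : linSubstDeg k (Matrix.diagonal l) (monomialBasisDeg n k d) =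
      (∏ i, l i ^ d.1 i) • monomialBasisDeg n k d := by
    apply Subtype.ext
    rw [SetLike.val_smul, monomialBasisDeg, Basis.mk_apply]
    exact linSubst_diagonal_monomial l d.1
  rw [Matrix.diag_apply, LinearMap.toMatrix_apply, this]
  simp

theorem mk_pow_mul_one_sub (c : ℂ) :
    (PowerSeries.mk fun k => c ^ k) * (1 - PowerSeries.C c * PowerSeries.X) = 1 := by
  ext k
  rw [mul_sub, mul_one, mul_comm (PowerSeries.C c), ← mul_assoc, map_sub]
  cases k with
  | zero => simp
  | succ k => simp [PowerSeries.coeff_succ_mul_X, PowerSeries.coeff_one, pow_succ]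

theorem trace_linSubstDeg_series_diagonal (l : Fin n → ℂ) :
    (PowerSeries.mk fun k => LinearMap.trace ℂ _ (linSubstDeg k (Matrix.diagonal l))) *
      ∏ i, (1 - PowerSeries.C (l i) * PowerSeries.X) = 1 := by
  classical
  have : (PowerSeries.mk fun k => LinearMap.trace ℂ _ (linSubstDeg k (Matrix.diagonal l))) =
      ∏ i, PowerSeries.mk fun k => l i ^ k := by
    ext k
    rw [PowerSeries.coeff_mk, trace_linSubstDeg_diagonal, PowerSeries.coeff_prod]
    simp
  rw [this, ← Finset.prod_mul_distrib]
  exact Finset.prod_eq_one fun i _ => mk_pow_mul_one_sub _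

theorem trace_linSubstDeg_conj (k : ℕ) (A B P Q : Matrix (Fin n) (Fin n) ℂ) (hQP : Q * P = 1)
    (hA : A = P * B * Q) :
    LinearMap.trace ℂ _ (linSubstDeg k A) = LinearMap.trace ℂ _ (linSubstDeg k B) := by
  rw [hA, linSubstDeg_mul, LinearMap.trace_mul_comm, ← linSubstDeg_mul, ← mul_assoc, hQP, one_mul]

end substitution

section diagonalization

variable {n : ℕ}

theorem exists_diagonalization (A : Matrix (Fin n) (Fin n) ℂ) {m : ℕ} (hm : m ≠ 0)
    (hA : A ^ m = 1) : ∃ (P Q : Matrix (Fin n) (Fin n) ℂ) (l : Fin n → ℂ),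
      P * Q = 1 ∧ Q * P = 1 ∧ A = P * Matrix.diagonal l * Q := by
  classical
  let f : Module.End ℂ (Fin n → ℂ) := Matrix.toLin' A
  have hf : f.IsSemisimple := by
    have hm' : (m : ℂ) ≠ 0 := Nat.cast_ne_zero.mpr hm
    apply Module.End.isSemisimple_of_squarefree_aeval_eq_zero
      (p := Polynomial.X ^ m - Polynomial.C (1 : ℂ))
    · exact (Polynomial.separable_X_pow_sub_C (1 : ℂ) hm' one_ne_zero).squarefree
    · have : f ^ m = 1 := by
        change (Matrix.toLin' A) ^ m = 1
        rw [← Matrix.toLin'_pow, hA, Matrix.toLin'_one]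
        rfl
      simp [this]
  let eigenDecomp := DirectSum.isInternal_submodule_of_iSupIndep_of_iSup_eq_top
    f.eigenspaces_iSupIndep hf.iSup_eigenspace_eq_top
  let v := eigenDecomp.collectedBasis fun μ ↦ finBasis ℂ (f.eigenspace μ)
  have : Fintype ((ν : ℂ) × Fin (finrank ℂ (f.eigenspace ν))) :=
    FiniteDimensional.fintypeBasisIndex v
  have hv (i) : f (v i) = i.1 • v i :=
    Module.End.mem_eigenspace_iff.mp (eigenDecomp.collectedBasis_mem _ i)
  have hcard : Fintype.card ((ν : ℂ) × Fin (finrank ℂ (f.eigenspace ν))) = n := by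
    rw [← finrank_eq_card_basis v, finrank_fin_fun]
  let w : Basis (Fin n) ℂ (Fin n → ℂ) := v.reindex (Fintype.equivFinOfCardEq hcard)
  let l : Fin n → ℂ := fun i => ((Fintype.equivFinOfCardEq hcard).symm i).1
  have hw (i) : f (w i) = l i • w i := by
    simp only [w, Basis.reindex_apply, l]
    exact hv _
  let e := Pi.basisFun ℂ (Fin n)
  have h1 : e.toMatrix w * w.toMatrix e = 1 := by
    rw [Basis.toMatrix_mul_toMatrix, Basis.toMatrix_self]
  have h2 : w.toMatrix e * e.toMatrix w = 1 := by
    rw [Basis.toMatrix_mul_toMatrix, Basis.toMatrix_self]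
  refine ⟨e.toMatrix w, w.toMatrix e, l, h1, h2, ?_⟩
  have hd : LinearMap.toMatrix w w f = Matrix.diagonal l := by
    ext i j
    rw [LinearMap.toMatrix_apply, hw, map_smul, Basis.repr_self, Matrix.diagonal_apply]
    by_cases h : i = j
    · subst h; simp
    · simp [h]
  rw [← hd, basis_toMatrix_mul_linearMap_toMatrix_mul_basis_toMatrix]
  change A = LinearMap.toMatrix' (Matrix.toLin' A)
  rw [LinearMap.toMatrix'_toLin']

theorem charpolyRev_conj_diagonal {A P Q : Matrix (Fin n) (Fin n) ℂ} {l : Fin n → ℂ}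
    (hPQ : P * Q = 1) (hA : A = P * Matrix.diagonal l * Q) :
    A.charpolyRev = ∏ i, (1 - Polynomial.C (l i) * Polynomial.X) := by
  have hmap : P.map Polynomial.C * Q.map Polynomial.C = (1 : Matrix _ _ (Polynomial ℂ)) := by
    rw [← Matrix.map_mul, hPQ, Matrix.map_one _ (map_zero _) (map_one _)]
  have : (1 - (Polynomial.X : Polynomial ℂ) • A.map Polynomial.C) =
      P.map Polynomial.C * (1 - (Polynomial.X : Polynomial ℂ) •
        (Matrix.diagonal l).map Polynomial.C) * Q.map Polynomial.C := by
    rw [mul_sub, sub_mul, mul_one, hmap, hA, Matrix.map_mul, Matrix.map_mul, Matrix.mul_smul,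
      Matrix.smul_mul]
  have hdet : (P.map Polynomial.C).det * (Q.map Polynomial.C).det = (1 : Polynomial ℂ) := by
    rw [← Matrix.det_mul, hmap, Matrix.det_one]
  rw [Matrix.charpolyRev, this, Matrix.det_mul, Matrix.det_mul, mul_right_comm, hdet, one_mul]
  have : (1 - (Polynomial.X : Polynomial ℂ) • (Matrix.diagonal l).map Polynomial.C) =
      Matrix.diagonal fun i => (1 - Polynomial.C (l i) * Polynomial.X) := by
    ext1 i j
    by_cases h : i = j
    · subst h
      rw [Matrix.sub_apply, Matrix.smul_apply, Matrix.map_apply, Matrix.one_apply_eq,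
        Matrix.diagonal_apply_eq, Matrix.diagonal_apply_eq, smul_eq_mul, mul_comm]
    · rw [Matrix.sub_apply, Matrix.smul_apply, Matrix.map_apply, Matrix.one_apply_ne h,
        Matrix.diagonal_apply_ne _ h, Matrix.diagonal_apply_ne _ h, map_zero, smul_zero, sub_zero]
  rw [this, Matrix.det_diagonal]

theorem trace_linSubstDeg_series {A : Matrix (Fin n) (Fin n) ℂ} {m : ℕ} (hm : m ≠ 0)
    (hA : A ^ m = 1) :
    (PowerSeries.mk fun k => LinearMap.trace ℂ _ (linSubstDeg k A)) *
      (A.charpolyRev : PowerSeries ℂ) = 1 := by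
  obtain ⟨P, Q, l, hPQ, hQP, h⟩ := exists_diagonalization A hm hA
  have hk (k : ℕ) := trace_linSubstDeg_conj k A _ P Q hQP h
  simp only [hk]
  rw [charpolyRev_conj_diagonal hPQ h]
  have := trace_linSubstDeg_series_diagonal l
  convert this using 2
  rw [← Polynomial.coeToPowerSeries.ringHom_apply, map_prod]
  simp

theorem prod_one_sub_mul_eq_sum {R : Type*} [CommRing R] (f : Fin n → R) (y : R) :
    ∏ i, (1 - y * f i) = ∑ p ∈ Finset.range (n + 1),
      (∑ s : Set.powersetCard (Fin n) p, ∏ i ∈ s.1, f i) * (-y) ^ p := by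
  classical
  simp only [sub_eq_add_neg, Finset.prod_one_add, Finset.sum_powerset, Finset.card_univ,
    Fintype.card_fin]
  refine Finset.sum_congr rfl fun p _ => ?_
  rw [Finset.sum_mul, Finset.sum_subtype (p := (· ∈ Set.powersetCard (Fin n) p)) _ (fun s => by
    rw [Finset.mem_powersetCard_univ]; rfl)]
  refine Finset.sum_congr rfl fun s _ => ?_
  simp only [← neg_mul]
  rw [Finset.prod_mul_distrib, Finset.prod_const, mul_comm, s.2]

/-- The traces of compound matrices are the coefficients of the reversed characteristic
polynomial. -/
theorem charpolyRev_eq_sum_trace_compound {A : Matrix (Fin n) (Fin n) ℂ} {m : ℕ} (hm : m ≠ 0)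
    (hA : A ^ m = 1) :
    A.charpolyRev = ∑ p ∈ Finset.range (n + 1),
      Polynomial.C (compound p A).trace * (-Polynomial.X) ^ p := by
  obtain ⟨P, Q, l, hPQ, hQP, h⟩ := exists_diagonalization A hm hA
  have hc (p : ℕ) : (compound p A).trace = ∑ s : Set.powersetCard (Fin n) p, ∏ i ∈ s.1, l i := by
    rw [h, compound_mul, Matrix.trace_mul_comm, ← compound_mul, ← mul_assoc, hQP, one_mul,
      trace_compound_diagonal]
  rw [charpolyRev_conj_diagonal hPQ h]
  simp only [hc, map_sum, map_prod]
  rw [← prod_one_sub_mul_eq_sum]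
  simp only [mul_comm]

end diagonalization

theorem trace_averageMap {G V : Type*} [Group G] [Fintype G] [Invertible (Fintype.card G : ℂ)]
    [AddCommGroup V] [Module ℂ V] [Module.Finite ℂ V] (ρ : Representation ℂ G V) :
    LinearMap.trace ℂ _ ρ.averageMap = finrank ℂ ρ.invariants :=
  LinearMap.IsProj.trace ρ.isProj_averageMap

section molien

variable {G : Type*} [Group G] {n : ℕ} {κ : Type*} [Fintype κ] [DecidableEq κ]
  (M : G →* Matrix (Fin n) (Fin n) ℂ) (B : G →* Matrix κ κ ℂ)

/-- The action of `g` on vectors of polynomials, twisted by the matrix `B g`. -/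
noncomputable def twist (g : G) :
    (κ → MvPolynomial (Fin n) ℂ) →ₗ[ℂ] κ → MvPolynomial (Fin n) ℂ where
  toFun F a := ∑ b, B g a b • linSubst (M g) (F b)
  map_add' F F' := by
    ext1 a
    simp [Finset.sum_add_distrib]
  map_smul' c F := by
    ext1 a
    simp only [Pi.smul_apply, map_smul, Finset.smul_sum, RingHom.id_apply]
    exact Finset.sum_congr rfl fun b _ => smul_comm _ _ _

theorem twist_apply (g : G) (F : κ → MvPolynomial (Fin n) ℂ) (a : κ) :
    twist M B g F a = ∑ b, B g a b • linSubst (M g) (F b) := rfl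

theorem twist_mul (g h : G) : twist M B (g * h) = twist M B g ∘ₗ twist M B h := by
  refine LinearMap.ext fun F => funext fun a => ?_
  simp only [twist_apply, LinearMap.comp_apply, map_mul, Matrix.mul_apply, linSubst_mul,
    AlgHom.comp_apply, Finset.sum_smul, map_sum, map_smul, Finset.smul_sum, smul_smul]
  exact Finset.sum_comm

theorem twist_smul (g : G) (p : MvPolynomial (Fin n) ℂ) (F : κ → MvPolynomial (Fin n) ℂ) :
    twist M B g (p • F) = linSubst (M g) p • twist M B g F := by
  ext1 a
  simp [twist_apply, Finset.mul_sum]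

/-- The homogeneous invariant vectors of degree `k`. -/
noncomputable def invDeg (k : ℕ) : Submodule ℂ (κ → MvPolynomial (Fin n) ℂ) where
  carrier := {F | (∀ a, (F a).IsHomogeneous k) ∧ ∀ g, twist M B g F = F}
  add_mem' := fun h h' => ⟨fun a => (h.1 a).add (h'.1 a), fun g => by rw [map_add, h.2, h'.2]⟩
  zero_mem' := ⟨fun _ => isHomogeneous_zero _ _ _, fun g => map_zero _⟩
  smul_mem' := fun c F h => ⟨fun a => by
    rw [Pi.smul_apply, smul_eq_C_mul]; exact (h.1 a).C_mul c, fun g => by rw [map_smul, h.2]⟩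

/-- The Hilbert series of the module of invariant vectors. -/
noncomputable def hilbertSeries : PowerSeries ℂ :=
  PowerSeries.mk fun k => (finrank ℂ (invDeg M B k) : ℂ)

/-- The twisted action on the homogeneous vectors of degree `k`. -/
noncomputable def twistDeg (k : ℕ) : Representation ℂ G (κ → homogeneousSubmodule (Fin n) ℂ k) where
  toFun g :=
    { toFun := fun F a => ∑ b, B g a b • linSubstDeg k (M g) (F b)
      map_add' := fun F F' => by
        ext1 a
        simp [Finset.sum_add_distrib]
      map_smul' := fun c F => by
        ext1 a
        simp only [Pi.smul_apply, map_smul, Finset.smul_sum, RingHom.id_apply]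
        exact Finset.sum_congr rfl fun b _ => smul_comm _ _ _ }
  map_one' := by
    refine LinearMap.ext fun F => funext fun a => ?_
    simp [linSubstDeg_one, Matrix.one_apply, ite_smul]
  map_mul' g h := by
    refine LinearMap.ext fun F => funext fun a => ?_
    simp only [map_mul, linSubstDeg_mul, LinearMap.coe_mk, AddHom.coe_mk, Module.End.mul_apply,
      Matrix.mul_apply, Finset.sum_smul, map_sum, map_smul, Finset.smul_sum, smul_smul]
    exact Finset.sum_comm

theorem twistDeg_apply (k : ℕ) (g : G) (F : κ → homogeneousSubmodule (Fin n) ℂ k) (a : κ) :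
    twistDeg M B k g F a = ∑ b, B g a b • linSubstDeg k (M g) (F b) := rfl

theorem coe_twistDeg (k : ℕ) (g : G) (F : κ → homogeneousSubmodule (Fin n) ℂ k) (a : κ) :
    (twistDeg M B k g F a : MvPolynomial (Fin n) ℂ) = twist M B g (fun b => (F b).1) a := by
  rw [twistDeg_apply, twist_apply, AddSubmonoidClass.coe_finsetSum]
  rfl

theorem trace_twistDeg (k : ℕ) (g : G) :
    LinearMap.trace ℂ _ (twistDeg M B k g) =
      (B g).trace * LinearMap.trace ℂ _ (linSubstDeg k (M g)) := by
  classical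
  let b := monomialBasisDeg n k
  rw [LinearMap.trace_eq_matrix_trace ℂ (Pi.basis fun _ : κ => b),
    LinearMap.trace_eq_matrix_trace ℂ b, Matrix.trace, Fintype.sum_sigma, Matrix.trace,
    Finset.sum_mul]
  refine Finset.sum_congr rfl fun a _ => ?_
  rw [Matrix.trace, Finset.mul_sum]
  refine Finset.sum_congr rfl fun i _ => ?_
  rw [Matrix.diag_apply, Matrix.diag_apply, Matrix.diag_apply, LinearMap.toMatrix_apply,
    LinearMap.toMatrix_apply, Pi.basis_repr, Pi.basis_apply, twistDeg_apply,
    Finset.sum_eq_single a]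
  · simp
  · intro c _ hc
    simp [Pi.single_eq_of_ne hc]
  · simp

/-- The homogeneous invariants are the invariants of `twistDeg`. -/
noncomputable def invariantsEquiv (k : ℕ) : (twistDeg M B k).invariants ≃ₗ[ℂ] invDeg M B k where
  toFun F := ⟨fun a => (F.1 a).1, fun a => (F.1 a).2, fun g => by
    ext1 a
    rw [← coe_twistDeg M B k g F.1 a, (Representation.mem_invariants _ _).mp F.2 g]⟩
  invFun F := ⟨fun a => ⟨F.1 a, F.2.1 a⟩, (Representation.mem_invariants _ _).mpr fun g => by
    ext1 a
    apply Subtype.ext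
    rw [coe_twistDeg]
    exact congrFun (F.2.2 g) a⟩
  map_add' _ _ := rfl
  map_smul' _ _ := rfl
  left_inv _ := rfl
  right_inv _ := rfl

instance (k : ℕ) : Module.Finite ℂ (invDeg M B k) :=
  Module.Finite.equiv (invariantsEquiv M B k)

variable [Fintype G]

theorem pow_card_eq_one_matrix (g : G) : M g ^ Fintype.card G = 1 := by
  rw [← map_pow, pow_card_eq_one, map_one]

theorem card_mul_finrank_invDeg (k : ℕ) :
    (Fintype.card G : ℂ) * finrank ℂ (invDeg M B k) =
      ∑ g, (B g).trace * LinearMap.trace ℂ _ (linSubstDeg k (M g)) := by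
  have hG : (Fintype.card G : ℂ) ≠ 0 := Nat.cast_ne_zero.mpr Fintype.card_ne_zero
  let := invertibleOfNonzero hG
  have h := trace_averageMap (twistDeg M B k)
  rw [← (invariantsEquiv M B k).finrank_eq, ← h]
  simp only [Representation.averageMap, GroupAlgebra.average, map_smul, map_sum,
    Representation.asAlgebraHom_of, trace_twistDeg, smul_eq_mul]
  rw [mul_invOf_cancel_left]

theorem charpolyRev_inv (g : G) :
    ((M g).charpolyRev : PowerSeries ℂ)⁻¹ =
      PowerSeries.mk fun k => LinearMap.trace ℂ _ (linSubstDeg k (M g)) := by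
  symm
  rw [PowerSeries.eq_inv_iff_mul_eq_one]
  · exact trace_linSubstDeg_series Fintype.card_ne_zero (pow_card_eq_one_matrix M g)
  · rw [Polynomial.constantCoeff_coe, Polynomial.coeff_zero_eq_eval_zero, Matrix.eval_charpolyRev]
    exact one_ne_zero

/-- Molien's formula. -/
theorem card_mul_hilbertSeries :
    (Fintype.card G : PowerSeries ℂ) * hilbertSeries M B =
      ∑ g, PowerSeries.C (B g).trace * ((M g).charpolyRev : PowerSeries ℂ)⁻¹ := by
  ext k
  have : (Fintype.card G : PowerSeries ℂ) = PowerSeries.C (Fintype.card G : ℂ) := by simp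
  rw [this, PowerSeries.coeff_C_mul, hilbertSeries, PowerSeries.coeff_mk, card_mul_finrank_invDeg,
    map_sum]
  refine Finset.sum_congr rfl fun g _ => ?_
  rw [PowerSeries.coeff_C_mul, charpolyRev_inv, PowerSeries.coeff_mk]

end molien

section components

variable {n : ℕ}

/-- The homogeneous component of integral degree `k`, which vanishes if `k` is negative. -/
noncomputable def intComponent (k : ℤ) : MvPolynomial (Fin n) ℂ →ₗ[ℂ] MvPolynomial (Fin n) ℂ :=
  if 0 ≤ k then homogeneousComponent k.toNat else 0

theorem intComponent_natCast (k : ℕ) :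
    (intComponent (k : ℤ) : MvPolynomial (Fin n) ℂ →ₗ[ℂ] _) = homogeneousComponent k := by
  simp [intComponent]

theorem intComponent_of_neg {k : ℤ} (hk : k < 0) :
    (intComponent k : MvPolynomial (Fin n) ℂ →ₗ[ℂ] _) = 0 := by
  simp [intComponent, hk]

theorem homogeneousComponent_mul_of_isHomogeneous {p q : MvPolynomial (Fin n) ℂ} {e : ℕ}
    (hq : q.IsHomogeneous e) (k : ℕ) :
    homogeneousComponent k (p * q) =
      if e ≤ k then homogeneousComponent (k - e) p * q else 0 := by
  conv_lhs => rw [← sum_homogeneousComponent p, Finset.sum_mul, map_sum]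
  have h (i : ℕ) : homogeneousComponent k (homogeneousComponent i p * q) =
      if i + e = k then homogeneousComponent i p * q else 0 := by
    rw [homogeneousComponent_of_mem ((homogeneousComponent_isHomogeneous i p).mul hq)]
    split_ifs with h1 h2 h2 <;> first | rfl | omega
  simp only [h]
  split_ifs with hk
  · rw [Finset.sum_eq_single (k - e)]
    · rw [if_pos (by omega)]
    · intro i _ hi
      rw [if_neg (by omega)]
    · intro hi
      rw [if_pos (by omega), homogeneousComponent_eq_zero _ _ ?_, zero_mul]
      rw [Finset.mem_range] at hi
      omega
  · exact Finset.sum_eq_zero fun i _ => if_neg (by omega)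

theorem intComponent_idem (k : ℤ) (p : MvPolynomial (Fin n) ℂ) :
    intComponent k (intComponent k p) = intComponent k p := by
  unfold intComponent
  split_ifs
  · exact homogeneousComponent_eq_self (homogeneousComponent_isHomogeneous _ _)
  · rfl

theorem intComponent_mul {p q : MvPolynomial (Fin n) ℂ} {e : ℤ} (hq : intComponent e q = q)
    (k : ℤ) : intComponent (k + e) (p * q) = intComponent k p * q := by
  rcases lt_or_ge e 0 with he | he
  · rw [intComponent_of_neg he] at hq
    rw [← hq, LinearMap.zero_apply, mul_zero, mul_zero, map_zero]
  lift e to ℕ using he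
  rw [intComponent_natCast] at hq
  have hq' : q.IsHomogeneous e := hq ▸ homogeneousComponent_isHomogeneous e q
  rcases lt_or_ge (k + e) 0 with hk | hk
  · rw [intComponent_of_neg hk, intComponent_of_neg (by omega)]
    simp
  obtain ⟨j, hj⟩ := Int.eq_ofNat_of_zero_le hk
  rw [hj, intComponent_natCast, homogeneousComponent_mul_of_isHomogeneous hq']
  split_ifs with h
  · rw [show k = ((j - e : ℕ) : ℤ) by omega, intComponent_natCast]
  · rw [intComponent_of_neg (by omega)]
    simp

theorem intComponent_linSubst (A : Matrix (Fin n) (Fin n) ℂ) (p : MvPolynomial (Fin n) ℂ)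
    (k : ℤ) : intComponent k (linSubst A p) = linSubst A (intComponent k p) := by
  unfold intComponent
  split_ifs
  · exact homogeneousComponent_linSubst A p _
  · simp

theorem eq_zero_of_homogeneousComponent {p : MvPolynomial (Fin n) ℂ}
    (h : ∀ k, homogeneousComponent k p = 0) : p = 0 := by
  rw [← sum_homogeneousComponent p]
  exact Finset.sum_eq_zero fun i _ => h i

theorem isHomogeneous_of_mul_eq {p q r : MvPolynomial (Fin n) ℂ} {e k : ℕ}
    (hq : q.IsHomogeneous e) (hq0 : q ≠ 0) (hr : r.IsHomogeneous (k + e)) (h : r = p * q) :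
    p.IsHomogeneous k := by
  have h1 := homogeneousComponent_mul_of_isHomogeneous (p := p) hq (k + e)
  rw [if_pos (by omega), ← h, homogeneousComponent_eq_self hr, h, Nat.add_sub_cancel] at h1
  rw [mul_right_cancel₀ hq0 h1]
  exact homogeneousComponent_isHomogeneous _ _

end components

section reflections

variable {n : ℕ}

/-- The linear form with coefficients `α`. -/
noncomputable def linForm (α : Fin n → ℂ) : MvPolynomial (Fin n) ℂ := ∑ i, C (α i) * X i

theorem linForm_isHomogeneous (α : Fin n → ℂ) : (linForm α).IsHomogeneous 1 :=
  IsHomogeneous.sum _ _ _ fun _ _ => isHomogeneous_C_mul_X _ _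

theorem coeff_linForm (α : Fin n → ℂ) (j : Fin n) :
    (linForm α).coeff (Finsupp.single j 1) = α j := by
  simp [linForm, coeff_sum, coeff_C_mul, coeff_X, Finsupp.single_left_inj]

theorem linForm_ne_zero {α : Fin n → ℂ} (h : α ≠ 0) : linForm α ≠ 0 := by
  contrapose! h
  ext j
  rw [← coeff_linForm α j, h]
  simp

/-- A matrix which differs from the identity by a matrix of rank one. -/
def IsReflection (A : Matrix (Fin n) (Fin n) ℂ) : Prop :=
  A ≠ 1 ∧ ∃ α φ : Fin n → ℂ, A = 1 + Matrix.vecMulVec α φ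

theorem linForm_dvd_sub (α φ : Fin n → ℂ) (p : MvPolynomial (Fin n) ℂ) :
    linForm α ∣ p - linSubst (1 + Matrix.vecMulVec α φ) p := by
  induction p using MvPolynomial.induction_on with
  | C a => simp
  | add p q hp hq =>
    rw [map_add, add_sub_add_comm]
    exact dvd_add hp hq
  | mul_X p i hp =>
    have h : linSubst (1 + Matrix.vecMulVec α φ) (X i) = X i + C (φ i) * linForm α := by
      simp [linSubst_X, Matrix.add_apply, Matrix.one_apply, add_mul, Finset.sum_add_distrib,
        apply_ite (C : ℂ → MvPolynomial (Fin n) ℂ), ite_mul, Matrix.vecMulVec_apply, linForm,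
        Finset.mul_sum, mul_assoc, mul_left_comm]
    obtain ⟨q, hq⟩ := hp
    refine ⟨q * X i - linSubst (1 + Matrix.vecMulVec α φ) p * C (φ i), ?_⟩
    rw [map_mul, h]
    linear_combination X i * hq

theorem IsReflection.exists_root {A : Matrix (Fin n) (Fin n) ℂ} (h : IsReflection A) :
    ∃ α φ : Fin n → ℂ, α ≠ 0 ∧ φ ≠ 0 ∧ A = 1 + Matrix.vecMulVec α φ := by
  obtain ⟨h1, α, φ, h2⟩ := h
  refine ⟨α, φ, ?_, ?_, h2⟩ <;> rintro rfl <;> simp at h2 <;> exact h1 h2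

end reflections

section invariants

variable {G : Type*} [Group G] {n : ℕ} (M : G →* Matrix (Fin n) (Fin n) ℂ)

/-- The algebra of invariant polynomials. -/
noncomputable def invAlg : Subalgebra ℂ (MvPolynomial (Fin n) ℂ) :=
  ⨅ g, AlgHom.equalizer (linSubst (M g)) (AlgHom.id ℂ _)

variable {M} in
theorem mem_invAlg {p : MvPolynomial (Fin n) ℂ} :
    p ∈ invAlg M ↔ ∀ g, linSubst (M g) p = p := by
  simp [invAlg, Algebra.mem_iInf, AlgHom.mem_equalizer]

theorem intComponent_mem_invAlg {p : MvPolynomial (Fin n) ℂ} (hp : p ∈ invAlg M) (k : ℤ) :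
    intComponent k p ∈ invAlg M :=
  mem_invAlg.mpr fun g => by rw [← intComponent_linSubst, mem_invAlg.mp hp g]

theorem homogeneousComponent_mem_invAlg {p : MvPolynomial (Fin n) ℂ} (hp : p ∈ invAlg M) (k : ℕ) :
    homogeneousComponent k p ∈ invAlg M :=
  mem_invAlg.mpr fun g => by rw [← homogeneousComponent_linSubst, mem_invAlg.mp hp g]

/-- The ideal generated by the invariants without constant term. -/
noncomputable def hilbertIdeal : Ideal (MvPolynomial (Fin n) ℂ) :=
  Ideal.span {p | p ∈ invAlg M ∧ constantCoeff p = 0}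

theorem linSubst_mem_hilbertIdeal (g : G) {p : MvPolynomial (Fin n) ℂ} (hp : p ∈ hilbertIdeal M) :
    linSubst (M g) p ∈ hilbertIdeal M := by
  induction hp using Submodule.span_induction with
  | mem x hx =>
    rw [mem_invAlg.mp hx.1]
    exact Ideal.subset_span hx
  | zero => simp
  | add x y _ _ hx hy => rw [map_add]; exact add_mem hx hy
  | smul a x _ hx =>
    rw [smul_eq_mul, map_mul]
    exact Ideal.mul_mem_left _ _ hx

theorem linSubst_linSubst (g h : G) (p : MvPolynomial (Fin n) ℂ) :
    linSubst (M g) (linSubst (M h) p) = linSubst (M (g * h)) p := by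
  rw [map_mul, linSubst_mul]
  rfl

/-- Being congruent modulo the Hilbert ideal to its translate under a generating set. -/
theorem sub_mem_hilbertIdeal_of_closure {R : Set G} (hR : Subgroup.closure R = ⊤)
    {p : MvPolynomial (Fin n) ℂ} (hp : ∀ s ∈ R, p - linSubst (M s) p ∈ hilbertIdeal M) (g : G) :
    p - linSubst (M g) p ∈ hilbertIdeal M := by
  have hg : g ∈ Subgroup.closure R := hR ▸ Subgroup.mem_top g
  induction hg using Subgroup.closure_induction with
  | mem s hs => exact hp s hs
  | one => simp [linSubst_one]
  | mul x y _ _ hx hy =>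
    have := add_mem hx (linSubst_mem_hilbertIdeal M x hy)
    rwa [map_sub, linSubst_linSubst, sub_add_sub_cancel] at this
  | inv x _ hx =>
    have := neg_mem (linSubst_mem_hilbertIdeal M x⁻¹ hx)
    rwa [map_sub, linSubst_linSubst, inv_mul_cancel, map_one, linSubst_one, neg_sub] at this

variable [Fintype G]

/-- The Reynolds operator. -/
noncomputable def reynolds : MvPolynomial (Fin n) ℂ →ₗ[ℂ] MvPolynomial (Fin n) ℂ :=
  (Fintype.card G : ℂ)⁻¹ • ∑ g, (linSubst (M g)).toLinearMap

theorem reynolds_apply (p : MvPolynomial (Fin n) ℂ) :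
    reynolds M p = (Fintype.card G : ℂ)⁻¹ • ∑ g, linSubst (M g) p := by
  simp [reynolds]

theorem reynolds_mem (p : MvPolynomial (Fin n) ℂ) : reynolds M p ∈ invAlg M := by
  refine mem_invAlg.mpr fun g => ?_
  rw [reynolds_apply, map_smul, map_sum]
  refine congrArg _ (Fintype.sum_equiv (Equiv.mulLeft g) _ _ fun h => ?_)
  rw [linSubst_linSubst, Equiv.coe_mulLeft]

theorem reynolds_mul {a : MvPolynomial (Fin n) ℂ} (ha : a ∈ invAlg M)
    (p : MvPolynomial (Fin n) ℂ) : reynolds M (p * a) = reynolds M p * a := by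
  simp only [reynolds_apply, map_mul, mem_invAlg.mp ha, ← Finset.sum_mul, smul_mul_assoc]

theorem reynolds_of_mem {a : MvPolynomial (Fin n) ℂ} (ha : a ∈ invAlg M) : reynolds M a = a := by
  simp only [reynolds_apply, mem_invAlg.mp ha, Finset.sum_const, Finset.card_univ]
  rw [← Nat.cast_smul_eq_nsmul ℂ, smul_smul, inv_mul_cancel₀, one_smul]
  exact Nat.cast_ne_zero.mpr Fintype.card_ne_zero

theorem reynolds_isHomogeneous {p : MvPolynomial (Fin n) ℂ} {k : ℕ} (hp : p.IsHomogeneous k) :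
    (reynolds M p).IsHomogeneous k := by
  rw [reynolds_apply, smul_eq_C_mul]
  exact (IsHomogeneous.sum _ _ _ fun g _ => linSubst_isHomogeneous _ hp).C_mul _

theorem mem_hilbertIdeal_of_sub_mem {p : MvPolynomial (Fin n) ℂ} {k : ℕ}
    (hp : p.IsHomogeneous (k + 1)) (h : ∀ g, p - linSubst (M g) p ∈ hilbertIdeal M) :
    p ∈ hilbertIdeal M := by
  have h1 : reynolds M p ∈ hilbertIdeal M :=
    Ideal.subset_span ⟨reynolds_mem M p, (reynolds_isHomogeneous M hp).coeff_eq_zero (by simp)⟩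
  have h2 : p - reynolds M p ∈ hilbertIdeal M := by
    have h3 : p - reynolds M p = (Fintype.card G : ℂ)⁻¹ • ∑ g, (p - linSubst (M g) p) := by
      rw [Finset.sum_sub_distrib, smul_sub, ← reynolds_apply, Finset.sum_const, Finset.card_univ,
        ← Nat.cast_smul_eq_nsmul ℂ, smul_smul, inv_mul_cancel₀, one_smul]
      exact Nat.cast_ne_zero.mpr Fintype.card_ne_zero
    rw [h3, smul_eq_C_mul]
    exact Ideal.mul_mem_left _ _ (sum_mem fun g _ => h g)
  simpa using add_mem h2 h1

/-- Chevalley's lemma: a homogeneous coefficient of a relation between invariants, one of which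
is not generated by the others, lies in the Hilbert ideal. -/
theorem mem_hilbertIdeal_of_relation (hgen : Subgroup.closure {g | IsReflection (M g)} = ⊤)
    {ι : Type*} (T : Finset ι) {a : ι → MvPolynomial (Fin n) ℂ} (ha : ∀ i ∈ T, a i ∈ invAlg M)
    {a₀ : MvPolynomial (Fin n) ℂ} (ha₀ : a₀ ∉ Submodule.span (invAlg M) (a '' T)) :
    ∀ (k : ℕ) (p₀ : MvPolynomial (Fin n) ℂ) (p : ι → MvPolynomial (Fin n) ℂ),
      p₀.IsHomogeneous k → p₀ * a₀ = ∑ i ∈ T, p i * a i → a₀ ∈ invAlg M →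
        p₀ ∈ hilbertIdeal M := by
  intro k
  induction k with
  | zero =>
    intro p₀ p hp₀ h ha₀'
    obtain ⟨c, rfl⟩ : ∃ c, p₀ = C c :=
      ⟨_, totalDegree_eq_zero_iff_eq_C.mp ((totalDegree_zero_iff_isHomogeneous ..).mpr hp₀)⟩
    by_cases hc : c = 0
    · simp [hc]
    refine absurd ?_ ha₀
    have h1 := congrArg (reynolds M) h
    rw [← smul_eq_C_mul, map_smul, reynolds_of_mem M ha₀', map_sum] at h1
    have h2 : a₀ = c⁻¹ • ∑ i ∈ T, reynolds M (p i * a i) := by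
      rw [← h1, smul_smul, inv_mul_cancel₀ hc, one_smul]
    rw [h2, Finset.smul_sum]
    refine sum_mem fun i hi => ?_
    rw [reynolds_mul M (ha i hi), ← smul_mul_assoc]
    exact Submodule.smul_mem _ (⟨_, (invAlg M).smul_mem (reynolds_mem M (p i)) c⁻¹⟩ : invAlg M)
      (Submodule.subset_span ⟨i, hi, rfl⟩)
  | succ k ih =>
    intro p₀ p hp₀ h ha₀'
    refine mem_hilbertIdeal_of_sub_mem M hp₀ (sub_mem_hilbertIdeal_of_closure M hgen fun s hs => ?_)
    obtain ⟨α, φ, hα, -, hM⟩ := IsReflection.exists_root hs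
    have hdvd (q : MvPolynomial (Fin n) ℂ) : linForm α ∣ q - linSubst (M s) q :=
      hM ▸ linForm_dvd_sub α φ q
    choose q hq using hdvd
    have hα' := linForm_ne_zero hα
    rw [hq]
    refine Ideal.mul_mem_left _ _ (ih (q p₀) (fun i => q (p i)) ?_ ?_ ha₀')
    · exact isHomogeneous_of_mul_eq (linForm_isHomogeneous α) hα'
        (hp₀.sub (linSubst_isHomogeneous (M s) hp₀)) ((hq p₀).trans (mul_comm _ _))
    · apply mul_left_cancel₀ hα'
      rw [Finset.mul_sum, ← mul_assoc, ← hq, sub_mul, h]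
      have h1 := congrArg (linSubst (M s)) h
      rw [map_mul, mem_invAlg.mp ha₀', map_sum] at h1
      rw [h1, ← Finset.sum_sub_distrib]
      refine Finset.sum_congr rfl fun i hi => ?_
      rw [map_mul, mem_invAlg.mp (ha i hi), ← mul_assoc, ← hq, sub_mul]

end invariants

section components

variable {n : ℕ} {κ : Type*}

/-- The homogeneous component of a vector of polynomials. -/
noncomputable def vecComponent (k : ℕ) :
    (κ → MvPolynomial (Fin n) ℂ) →ₗ[ℂ] κ → MvPolynomial (Fin n) ℂ :=
  (homogeneousComponent k).compLeft κ

theorem vecComponent_apply (k : ℕ) (F : κ → MvPolynomial (Fin n) ℂ) (x : κ) :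
    vecComponent k F x = homogeneousComponent k (F x) := rfl

theorem homogeneousComponent_mul (p q : MvPolynomial (Fin n) ℂ) (k : ℕ) :
    homogeneousComponent k (p * q) =
      ∑ j ∈ Finset.range (k + 1), homogeneousComponent (k - j) p * homogeneousComponent j q := by
  conv_lhs => rw [← sum_homogeneousComponent q, Finset.mul_sum, map_sum]
  simp only [homogeneousComponent_mul_of_isHomogeneous (homogeneousComponent_isHomogeneous _ q)]
  rw [Finset.sum_ite, Finset.sum_const_zero, add_zero]
  refine Finset.sum_subset_zero_on_sdiff ?_ ?_ fun _ _ => rfl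
  · intro j hj
    simp only [Finset.mem_filter, Finset.mem_range] at hj ⊢
    omega
  · intro j hj
    simp only [Finset.mem_sdiff, Finset.mem_filter, Finset.mem_range] at hj
    rw [homogeneousComponent_eq_zero j q (by omega), mul_zero]

theorem vecComponent_smul (p : MvPolynomial (Fin n) ℂ) (F : κ → MvPolynomial (Fin n) ℂ) (k : ℕ) :
    vecComponent k (p • F) =
      ∑ j ∈ Finset.range (k + 1), homogeneousComponent (k - j) p • vecComponent j F := by
  ext1 x
  simp only [vecComponent_apply, Pi.smul_apply, smul_eq_mul, homogeneousComponent_mul,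
    Finset.sum_apply]

theorem sum_vecComponent [Fintype κ] (F : κ → MvPolynomial (Fin n) ℂ) :
    ∃ K, F = ∑ k ∈ Finset.range K, vecComponent k F := by
  refine ⟨(Finset.univ.sup fun x => (F x).totalDegree) + 1, funext fun x => ?_⟩
  rw [Finset.sum_apply]
  conv_lhs => rw [← sum_homogeneousComponent (F x)]
  have hx : (F x).totalDegree ≤ Finset.univ.sup fun x => (F x).totalDegree :=
    Finset.le_sup (f := fun x => (F x).totalDegree) (Finset.mem_univ x)
  refine Finset.sum_subset (Finset.range_mono (by omega)) fun j _ hj => ?_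
  rw [Finset.mem_range] at hj
  exact homogeneousComponent_eq_zero _ _ (by omega)

theorem linSubst_injective {G : Type*} [Group G] (M : G →* Matrix (Fin n) (Fin n) ℂ) (g : G) :
    Function.Injective (linSubst (M g)) := by
  refine Function.LeftInverse.injective (g := linSubst (M g⁻¹)) fun p => ?_
  rw [linSubst_linSubst, inv_mul_cancel, map_one, linSubst_one]
  rfl

end components

section freeness

variable {G : Type*} [Group G] {n : ℕ} {κ : Type*} [Fintype κ] [DecidableEq κ]
  (M : G →* Matrix (Fin n) (Fin n) ℂ) (B : G →* Matrix κ κ ℂ)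

/-- The invariant vectors. -/
noncomputable def invMod : Submodule ℂ (κ → MvPolynomial (Fin n) ℂ) where
  carrier := {F | ∀ g, twist M B g F = F}
  add_mem' := fun h h' g => by rw [map_add, h, h']
  zero_mem' := fun g => map_zero _
  smul_mem' := fun c F h g => by rw [map_smul, h]

variable {M B} in
theorem mem_invMod {F : κ → MvPolynomial (Fin n) ℂ} :
    F ∈ invMod M B ↔ ∀ g, twist M B g F = F := Iff.rfl

variable {M B} in
theorem invDeg_le_invMod {k : ℕ} {F : κ → MvPolynomial (Fin n) ℂ} (h : F ∈ invDeg M B k) :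
    F ∈ invMod M B := h.2

variable {M B} in
theorem smul_mem_invMod {a : MvPolynomial (Fin n) ℂ} (ha : a ∈ invAlg M)
    {F : κ → MvPolynomial (Fin n) ℂ} (hF : F ∈ invMod M B) : a • F ∈ invMod M B := fun g => by
  rw [twist_smul, mem_invAlg.mp ha, hF g]

/-- The span of the products of invariant vectors with invariants without constant term. -/
noncomputable def posMod : Submodule ℂ (κ → MvPolynomial (Fin n) ℂ) :=
  Submodule.span ℂ {x | ∃ a ∈ invAlg M, constantCoeff a = 0 ∧ ∃ F ∈ invMod M B, x = a • F}

variable {M B} in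
theorem vecComponent_mem_invDeg {F : κ → MvPolynomial (Fin n) ℂ} (hF : F ∈ invMod M B) (k : ℕ) :
    vecComponent k F ∈ invDeg M B k := by
  refine ⟨fun a => homogeneousComponent_isHomogeneous _ _, fun g => ?_⟩
  ext1 a
  rw [vecComponent_apply, ← congrFun (hF g) a]
  simp only [twist_apply, vecComponent_apply, map_sum, map_smul, homogeneousComponent_linSubst]

variable [Fintype G]

/-- The Reynolds operator on vectors of polynomials. -/
noncomputable def vecReynolds :
    (κ → MvPolynomial (Fin n) ℂ) →ₗ[ℂ] κ → MvPolynomial (Fin n) ℂ :=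
  (Fintype.card G : ℂ)⁻¹ • ∑ g, twist M B g

theorem vecReynolds_apply (F : κ → MvPolynomial (Fin n) ℂ) :
    vecReynolds M B F = (Fintype.card G : ℂ)⁻¹ • ∑ g, twist M B g F := by
  simp [vecReynolds]

theorem vecReynolds_mem (F : κ → MvPolynomial (Fin n) ℂ) : vecReynolds M B F ∈ invMod M B := by
  intro g
  rw [vecReynolds_apply, map_smul, map_sum]
  refine congrArg _ (Fintype.sum_equiv (Equiv.mulLeft g) _ _ fun h => ?_)
  rw [Equiv.coe_mulLeft, twist_mul, LinearMap.comp_apply]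

variable {M B} in
theorem vecReynolds_of_mem {F : κ → MvPolynomial (Fin n) ℂ} (hF : F ∈ invMod M B) :
    vecReynolds M B F = F := by
  simp only [vecReynolds_apply, mem_invMod.mp hF, Finset.sum_const, Finset.card_univ]
  rw [← Nat.cast_smul_eq_nsmul ℂ, smul_smul, inv_mul_cancel₀, one_smul]
  exact Nat.cast_ne_zero.mpr Fintype.card_ne_zero

theorem vecReynolds_smul {a : MvPolynomial (Fin n) ℂ} (ha : a ∈ invAlg M)
    (F : κ → MvPolynomial (Fin n) ℂ) : vecReynolds M B (a • F) = a • vecReynolds M B F := by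
  simp only [vecReynolds_apply, twist_smul, mem_invAlg.mp ha, ← Finset.smul_sum]
  rw [smul_comm]

theorem vecReynolds_smul_of_mem (p : MvPolynomial (Fin n) ℂ)
    {F : κ → MvPolynomial (Fin n) ℂ} (hF : F ∈ invMod M B) :
    vecReynolds M B (p • F) = reynolds M p • F := by
  simp only [vecReynolds_apply, twist_smul, mem_invMod.mp hF, reynolds_apply, ← Finset.sum_smul]
  rw [smul_assoc]

theorem vecReynolds_smul_mem_posMod {p : MvPolynomial (Fin n) ℂ} (hp : p ∈ hilbertIdeal M)
    (F : κ → MvPolynomial (Fin n) ℂ) : vecReynolds M B (p • F) ∈ posMod M B := by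
  induction hp using Submodule.span_induction generalizing F with
  | mem a ha =>
    rw [vecReynolds_smul M B ha.1]
    exact Submodule.subset_span ⟨a, ha.1, ha.2, _, vecReynolds_mem M B F, rfl⟩
  | zero => simp
  | add x y _ _ hx hy => rw [add_smul, map_add]; exact add_mem (hx F) (hy F)
  | smul a x _ hx =>
    rw [smul_eq_mul, mul_comm, mul_smul]
    exact hx _

theorem mem_posMod_of_mem_hilbertIdeal {F : κ → MvPolynomial (Fin n) ℂ} (hF : F ∈ invMod M B)
    (h : ∀ x, F x ∈ hilbertIdeal M) : F ∈ posMod M B := by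
  rw [← vecReynolds_of_mem hF, pi_eq_sum_univ F, map_sum]
  exact sum_mem fun x _ => vecReynolds_smul_mem_posMod M B (h x) _

variable {ι : Type*} [Fintype ι] {m : ι → ℕ} {ω : ι → κ → MvPolynomial (Fin n) ℂ}

theorem eq_zero_of_homogeneous_relation (hgen : Subgroup.closure {g | IsReflection (M g)} = ⊤)
    (hω : ∀ i, ω i ∈ invDeg M B (m i))
    (hind : LinearIndependent ℂ fun i => (posMod M B).mkQ (ω i))
    {a : ι → MvPolynomial (Fin n) ℂ} (ha : ∀ i, a i ∈ invAlg M) (D : ℤ)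
    (hD : ∀ i, intComponent (D - m i) (a i) = a i) (h : ∑ i, a i • ω i = 0) (i : ι) : a i = 0 := by
  classical
  by_contra hi
  obtain ⟨T, hT⟩ := exists_minimal_of_wellFoundedLT
    (fun T : Finset ι => ∀ i, a i ∈ Submodule.span (invAlg M) (a '' T))
    ⟨Finset.univ, fun i => Submodule.subset_span ⟨i, by simp, rfl⟩⟩
  have hTne : T.Nonempty := by
    rw [Finset.nonempty_iff_ne_empty]
    rintro rfl
    exact hi (by simpa using hT.prop i)
  obtain ⟨i₀, hi₀⟩ := hTne
  have hnot : a i₀ ∉ Submodule.span (invAlg M) (a '' (T.erase i₀)) := by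
    intro hmem
    refine hT.not_prop_of_lt (Finset.erase_ssubset hi₀) fun j => ?_
    refine Submodule.span_le.mpr ?_ (hT.prop j)
    rintro _ ⟨l, hl, rfl⟩
    by_cases hli : l = i₀
    · rw [hli]; exact hmem
    · exact Submodule.subset_span ⟨l, by simpa [hli] using hl, rfl⟩
  have hc (i : ι) : ∃ c : ι → invAlg M, ∑ j ∈ T, c j • a j = a i :=
    Submodule.mem_span_image_finset_iff_exists_fun' _ |>.mp (hT.prop i)
  choose c hc using hc
  set c' : ι → ι → MvPolynomial (Fin n) ℂ := fun i j =>
    intComponent ((m j : ℤ) - m i) (c i j).1 with hc'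
  have hc'mem (i j : ι) : c' i j ∈ invAlg M := intComponent_mem_invAlg M (c i j).2 _
  have hac (i : ι) : a i = ∑ j ∈ T, c' i j * a j := by
    rw [← hD i, ← hc i, map_sum]
    refine Finset.sum_congr rfl fun j _ => ?_
    rw [← intComponent_mul (hD j), show (m j : ℤ) - m i + (D - m j) = D - m i by ring]
    rfl
  set p : ι → κ → MvPolynomial (Fin n) ℂ := fun j => ω j + ∑ i ∈ Tᶜ, c' i j • ω i with hp
  have hrel : ∑ j ∈ T, a j • p j = 0 := by
    rw [← h, ← Finset.sum_add_sum_compl T]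
    simp only [hp, smul_add, Finset.sum_add_distrib, Finset.smul_sum]
    congr 1
    rw [Finset.sum_comm]
    refine Finset.sum_congr rfl fun i _ => ?_
    rw [hac i, Finset.sum_smul]
    refine Finset.sum_congr rfl fun j _ => ?_
    rw [smul_smul, mul_comm]
  have hpinv : p i₀ ∈ invMod M B :=
    add_mem (invDeg_le_invMod (hω i₀)) (sum_mem fun i _ =>
      smul_mem_invMod (hc'mem i i₀) (invDeg_le_invMod (hω i)))
  have hphom (x : κ) : (p i₀ x).IsHomogeneous (m i₀) := by
    simp only [hp, Pi.add_apply, Finset.sum_apply, Pi.smul_apply, smul_eq_mul]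
    refine ((hω i₀).1 x).add (IsHomogeneous.sum _ _ _ fun i _ => ?_)
    have h1 := intComponent_mul (p := c' i i₀) (q := ω i x) (e := m i)
      (by rw [intComponent_natCast, homogeneousComponent_eq_self ((hω i).1 x)]) ((m i₀ : ℤ) - m i)
    rw [sub_add_cancel, intComponent_natCast, hc', intComponent_idem] at h1
    rw [hc', ← h1]
    exact homogeneousComponent_isHomogeneous _ _
  have hpI (x : κ) : p i₀ x ∈ hilbertIdeal M := by
    refine mem_hilbertIdeal_of_relation M hgen (T.erase i₀) (fun i _ => ha i) hnot (m i₀) (p i₀ x)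
      (fun j => - p j x) (hphom x) ?_ (ha i₀)
    have h1 := congrFun hrel x
    rw [← Finset.add_sum_erase T _ hi₀] at h1
    simp only [Pi.add_apply, Finset.sum_apply, Pi.smul_apply, smul_eq_mul, Pi.zero_apply] at h1
    simp only [neg_mul, Finset.sum_neg_distrib]
    rw [mul_comm, eq_neg_of_add_eq_zero_left h1]
    exact congrArg _ (Finset.sum_congr rfl fun j _ => mul_comm _ _)
  have hpos : p i₀ ∈ posMod M B := mem_posMod_of_mem_hilbertIdeal M B hpinv hpI
  have hzero : (posMod M B).mkQ (ω i₀) + ∑ i ∈ Tᶜ, constantCoeff (c' i i₀) •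
      (posMod M B).mkQ (ω i) = 0 := by
    have h1 : ω i₀ + ∑ i ∈ Tᶜ, constantCoeff (c' i i₀) • ω i ∈ posMod M B := by
      have h2 : ω i₀ + ∑ i ∈ Tᶜ, constantCoeff (c' i i₀) • ω i = p i₀ -
          ∑ i ∈ Tᶜ, (c' i i₀ - C (constantCoeff (c' i i₀))) • ω i := by
        simp only [hp, sub_smul, Finset.sum_sub_distrib]
        rw [add_sub_assoc, sub_sub_cancel]
        congr 1
        refine Finset.sum_congr rfl fun i _ => funext fun x => ?_
        simp [smul_eq_C_mul]
      rw [h2]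
      refine sub_mem hpos (sum_mem fun i _ => Submodule.subset_span ⟨_, ?_, ?_, ω i,
        invDeg_le_invMod (hω i), rfl⟩)
      · exact sub_mem (hc'mem i i₀) ((invAlg M).algebraMap_mem _)
      · simp
    simpa only [← Submodule.mkQ_apply, map_add, map_sum, map_smul] using
      (Submodule.Quotient.mk_eq_zero _).mpr h1
  have hlin := Fintype.linearIndependent_iff.mp hind
    (fun i => if i = i₀ then 1 else if i ∈ T then 0 else constantCoeff (c' i i₀)) (by
      rw [← hzero, ← Finset.sum_add_sum_compl T, Finset.sum_eq_single_of_mem i₀ hi₀]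
      · simp only [if_true, one_smul]
        congr 1
        refine Finset.sum_congr rfl fun i hi => ?_
        have hiT : i ∉ T := by simpa using hi
        rw [if_neg (ne_of_mem_of_not_mem hi₀ hiT).symm, if_neg hiT]
      · intro j hj hji
        simp [hji, hj]) i₀
  simp at hlin

theorem eq_zero_of_relation (hgen : Subgroup.closure {g | IsReflection (M g)} = ⊤)
    (hω : ∀ i, ω i ∈ invDeg M B (m i))
    (hind : LinearIndependent ℂ fun i => (posMod M B).mkQ (ω i))
    {a : ι → MvPolynomial (Fin n) ℂ} (ha : ∀ i, a i ∈ invAlg M)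
    (h : ∑ i, a i • ω i = 0) (i : ι) : a i = 0 := by
  refine eq_zero_of_homogeneousComponent fun k => ?_
  have := eq_zero_of_homogeneous_relation M B hgen hω hind
    (a := fun j => intComponent ((k + m i : ℤ) - m j) (a j))
    (fun j => intComponent_mem_invAlg M (ha j) _) (k + m i) (fun j => intComponent_idem _ _) (by
      ext1 x
      have h1 := congrArg (intComponent (k + m i : ℤ)) (congrFun h x)
      simp only [Finset.sum_apply, Pi.smul_apply, smul_eq_mul, map_sum, Pi.zero_apply,
        map_zero] at h1 ⊢
      rw [← h1]
      refine Finset.sum_congr rfl fun j _ => ?_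
      rw [← intComponent_mul (e := m j)
        (by rw [intComponent_natCast, homogeneousComponent_eq_self ((hω j).1 x)]), sub_add_cancel])
      i
  simpa only [add_sub_cancel_right, intComponent_natCast] using this

theorem linearIndependent_of_mkQ (hgen : Subgroup.closure {g | IsReflection (M g)} = ⊤)
    (hω : ∀ i, ω i ∈ invDeg M B (m i))
    (hind : LinearIndependent ℂ fun i => (posMod M B).mkQ (ω i)) :
    LinearIndependent (MvPolynomial (Fin n) ℂ) ω := by
  classical
  rw [Fintype.linearIndependent_iff]
  intro s hs i
  by_contra hi
  set u := ∏ g ∈ Finset.univ.erase (1 : G), linSubst (M g) (s i) with hu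
  have hnorm : u * s i = ∏ g, linSubst (M g) (s i) := by
    rw [← Finset.prod_erase_mul _ _ (Finset.mem_univ (1 : G)), map_one, linSubst_one]
    rfl
  have hnorm_mem : u * s i ∈ invAlg M := by
    rw [hnorm]
    refine mem_invAlg.mpr fun g => ?_
    rw [map_prod]
    refine Fintype.prod_equiv (Equiv.mulLeft g) _ _ fun h => ?_
    rw [linSubst_linSubst, Equiv.coe_mulLeft]
  have h0 := eq_zero_of_relation M B hgen hω hind (a := fun j => reynolds M (u * s j))
    (fun j => reynolds_mem M _) (by
      have h1 := congrArg (fun F => vecReynolds M B (u • F)) hs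
      simp only [Finset.smul_sum, map_sum, smul_zero, map_zero, smul_smul] at h1
      rw [← h1]
      exact Finset.sum_congr rfl fun j _ =>
        (vecReynolds_smul_of_mem M B _ (invDeg_le_invMod (hω j))).symm) i
  rw [reynolds_of_mem M hnorm_mem, hnorm, Finset.prod_eq_zero_iff] at h0
  obtain ⟨g, -, hg⟩ := h0
  exact hi (linSubst_injective M g (hg.trans (map_zero _).symm))

/-- The module of invariant vectors is free over the algebra of invariants. -/
theorem exists_homogeneous_basis (hgen : Subgroup.closure {g | IsReflection (M g)} = ⊤) :
    ∃ (N : ℕ) (m : Fin N → ℕ)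
    (ω : Fin N → κ → MvPolynomial (Fin n) ℂ), (∀ i, ω i ∈ invDeg M B (m i)) ∧
    LinearIndependent (MvPolynomial (Fin n) ℂ) ω ∧
    ∀ F ∈ invMod M B, F ∈ Submodule.span (invAlg M) (Set.range ω) := by
  classical
  let P : ℕ → Prop := fun N => ∃ (m : Fin N → ℕ) (ω : Fin N → κ → MvPolynomial (Fin n) ℂ),
    (∀ i, ω i ∈ invDeg M B (m i)) ∧ LinearIndependent ℂ fun i => (posMod M B).mkQ (ω i)
  have hbound {N : ℕ} (h : P N) : N ≤ Fintype.card κ := by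
    obtain ⟨m, ω, hω, hind⟩ := h
    simpa using (linearIndependent_of_mkQ M B hgen hω hind).fintype_card_le_finrank
  have hP0 : P 0 := ⟨Fin.elim0, Fin.elim0, fun i => i.elim0, linearIndependent_empty_type⟩
  obtain ⟨N, hN⟩ : ∃ N, N = Nat.findGreatest P (Fintype.card κ) := ⟨_, rfl⟩
  obtain ⟨m, ω, hω, hind⟩ : P N := hN ▸ Nat.findGreatest_spec (Nat.zero_le _) hP0
  refine ⟨N, m, ω, hω, linearIndependent_of_mkQ M B hgen hω hind, ?_⟩
  have hmax : ¬ P (N + 1) := fun h => by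
    have := Nat.le_findGreatest (hbound h) h
    omega
  have key (k : ℕ) : ∀ F ∈ invDeg M B k, F ∈ Submodule.span (invAlg M) (Set.range ω) := by
    induction k using Nat.strong_induction_on with
    | _ k ih =>
    intro F hF
    have hpos : ∀ x ∈ posMod M B, vecComponent k x ∈ Submodule.span (invAlg M) (Set.range ω) := by
      intro x hx
      induction hx using Submodule.span_induction with
      | mem x hx =>
        obtain ⟨a, ha, ha0, F', hF', rfl⟩ := hx
        rw [vecComponent_smul]
        refine sum_mem fun j hj => ?_
        rcases (Finset.mem_range_succ_iff.mp hj).lt_or_eq with h | rfl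
        · exact Submodule.smul_mem _
            (⟨_, homogeneousComponent_mem_invAlg M ha _⟩ : invAlg M)
            (ih j h _ (vecComponent_mem_invDeg hF' j))
        · rw [Nat.sub_self, homogeneousComponent_zero, ← constantCoeff_eq, ha0]
          simp
      | zero => simp
      | add x y _ _ hx hy => rw [map_add]; exact add_mem hx hy
      | smul c x _ hx =>
        rw [map_smul]
        exact Submodule.smul_of_tower_mem _ c hx
    have hdep : (posMod M B).mkQ F ∈
        Submodule.span ℂ (Set.range fun i => (posMod M B).mkQ (ω i)) := by
      by_contra hnot
      refine hmax ⟨Fin.cons k m, Fin.cons F ω, Fin.cases hF hω, ?_⟩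
      have hcons : (fun i => (posMod M B).mkQ ((Fin.cons F ω : Fin (N + 1) → κ → _) i)) =
          Fin.cons ((posMod M B).mkQ F) fun i => (posMod M B).mkQ (ω i) :=
        funext fun i => Fin.cases rfl (fun _ => rfl) i
      rw [hcons]
      exact linearIndependent_finCons.mpr ⟨hind, hnot⟩
    obtain ⟨c, hc⟩ := (Submodule.mem_span_range_iff_exists_fun ℂ).mp hdep
    have hmem : F - ∑ i, c i • ω i ∈ posMod M B := by
      rw [← Submodule.Quotient.mk_eq_zero, ← Submodule.mkQ_apply, map_sub, map_sum, sub_eq_zero]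
      simp only [map_smul]
      exact hc.symm
    have hself : vecComponent k F = F := funext fun x => homogeneousComponent_eq_self (hF.1 x)
    have h1 := hpos _ hmem
    rw [map_sub, hself, map_sum] at h1
    have h2 : ∑ i, vecComponent k (c i • ω i) ∈ Submodule.span (invAlg M) (Set.range ω) := by
      refine sum_mem fun i _ => ?_
      rw [map_smul]
      refine Submodule.smul_of_tower_mem _ (c i) ?_
      have h3 : vecComponent k (ω i) = if m i = k then ω i else 0 := by
        ext1 x
        rw [vecComponent_apply, homogeneousComponent_of_mem ((hω i).1 x)]
        split_ifs with h4 h5 h5 <;> first | rfl | omega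
      rw [h3]
      split_ifs
      · exact Submodule.subset_span ⟨i, rfl⟩
      · exact zero_mem _
    simpa using add_mem h1 h2
  intro F hF
  obtain ⟨K, hK⟩ := sum_vecComponent F
  rw [hK]
  exact sum_mem fun k _ => key k _ (vecComponent_mem_invDeg hF k)

end freeness

section hilbert

variable {G : Type*} [Group G] {n : ℕ} (M : G →* Matrix (Fin n) (Fin n) ℂ)

/-- The invariant polynomials which are homogeneous of integral degree `e`. -/
noncomputable def invPoly (e : ℤ) : Submodule ℂ (MvPolynomial (Fin n) ℂ) where
  carrier := {a | a ∈ invAlg M ∧ intComponent e a = a}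
  add_mem' := fun h h' => ⟨add_mem h.1 h'.1, by rw [map_add, h.2, h'.2]⟩
  zero_mem' := ⟨zero_mem _, map_zero _⟩
  smul_mem' := fun c _ h => ⟨(invAlg M).smul_mem h.1 c, by rw [map_smul, h.2]⟩

theorem intComponent_natCast_eq_self_iff {k : ℕ} {p : MvPolynomial (Fin n) ℂ} :
    intComponent (k : ℤ) p = p ↔ p.IsHomogeneous k := by
  rw [intComponent_natCast]
  exact ⟨fun h => h ▸ homogeneousComponent_isHomogeneous _ _, homogeneousComponent_eq_self⟩

/-- Invariant polynomials as invariant vectors with a single entry. -/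
noncomputable def invPolyEquiv (k : ℕ) :
    invPoly M k ≃ₗ[ℂ] invDeg M (1 : G →* Matrix Unit Unit ℂ) k where
  toFun a := ⟨fun _ => a.1, fun _ => intComponent_natCast_eq_self_iff.mp a.2.2, fun g => by
    ext1 x
    simp [twist_apply, mem_invAlg.mp a.2.1 g]⟩
  invFun F := ⟨F.1 (), mem_invAlg.mpr fun g => by
    simpa [twist_apply] using congrFun (F.2.2 g) (),
      intComponent_natCast_eq_self_iff.mpr (F.2.1 ())⟩
  map_add' _ _ := rfl
  map_smul' _ _ := rfl
  left_inv _ := rfl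
  right_inv _ := rfl

theorem invPoly_of_neg {e : ℤ} (he : e < 0) : invPoly M e = ⊥ := by
  rw [eq_bot_iff]
  intro a ha
  have := ha.2
  rw [intComponent_of_neg he] at this
  exact this.symm

instance (e : ℤ) : Module.Finite ℂ (invPoly M e) := by
  rcases lt_or_ge e 0 with he | he
  · rw [invPoly_of_neg M he]
    infer_instance
  · lift e to ℕ using he
    exact Module.Finite.equiv (invPolyEquiv M e).symm

theorem finrank_invPoly (k m : ℕ) : (finrank ℂ (invPoly M ((k : ℤ) - m)) : ℂ) =
    PowerSeries.coeff k (PowerSeries.X ^ m * hilbertSeries M (1 : G →* Matrix Unit Unit ℂ)) := by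
  rw [PowerSeries.coeff_X_pow_mul', hilbertSeries]
  split_ifs with h
  · rw [PowerSeries.coeff_mk, ← (invPolyEquiv M (k - m)).finrank_eq, Nat.cast_sub h]
  · rw [invPoly_of_neg M (by omega)]
    simp

variable {κ : Type*} [Fintype κ] [DecidableEq κ] (B : G →* Matrix κ κ ℂ)

/-- The Hilbert series of a free module with homogeneous basis. -/
theorem hilbertSeries_eq_of_basis {ι : Type*} [Fintype ι] {m : ι → ℕ}
    {F : ι → κ → MvPolynomial (Fin n) ℂ} (hF : ∀ i, F i ∈ invDeg M B (m i))
    (hind : LinearIndependent (MvPolynomial (Fin n) ℂ) F)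
    (hspan : ∀ H ∈ invMod M B, H ∈ Submodule.span (invAlg M) (Set.range F)) :
    hilbertSeries M B =
      (∑ i, PowerSeries.X ^ m i) * hilbertSeries M (1 : G →* Matrix Unit Unit ℂ) := by
  ext k
  rw [Finset.sum_mul, map_sum]
  simp only [← finrank_invPoly]
  let Φ : (∀ i, invPoly M ((k : ℤ) - m i)) →ₗ[ℂ] κ → MvPolynomial (Fin n) ℂ :=
    { toFun := fun a => ∑ i, (a i).1 • F i
      map_add' := fun a b => by simp [add_smul, Finset.sum_add_distrib]
      map_smul' := fun c a => by simp [Finset.smul_sum] }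
  have hΦ (a : ∀ i, invPoly M ((k : ℤ) - m i)) : Φ a = ∑ i, (a i).1 • F i := rfl
  have hinj : Function.Injective Φ := by
    rw [injective_iff_map_eq_zero]
    intro a ha
    ext1 i
    exact Subtype.ext (Fintype.linearIndependent_iff.mp hind (fun i => (a i).1) ha i)
  have hself (i : ι) (x : κ) : intComponent (m i : ℤ) (F i x) = F i x :=
    intComponent_natCast_eq_self_iff.mpr ((hF i).1 x)
  have hrange : LinearMap.range Φ = invDeg M B k := by
    apply le_antisymm
    · rintro _ ⟨a, rfl⟩
      rw [hΦ]
      refine ⟨fun x => ?_, mem_invMod.mp (sum_mem fun i _ => ?_)⟩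
      · rw [Finset.sum_apply]
        refine IsHomogeneous.sum _ _ _ fun i _ => intComponent_natCast_eq_self_iff.mp ?_
        rw [Pi.smul_apply, smul_eq_mul]
        have h := intComponent_mul (p := (a i).1) (hself i x) ((k : ℤ) - m i)
        rwa [sub_add_cancel, (a i).2.2] at h
      · exact smul_mem_invMod (a i).2.1 (invDeg_le_invMod (hF i))
    · intro H hH
      obtain ⟨c, hc⟩ := (Submodule.mem_span_range_iff_exists_fun _).mp (hspan H hH.2)
      refine ⟨fun i => ⟨intComponent ((k : ℤ) - m i) (c i).1,
        intComponent_mem_invAlg M (c i).2 _, intComponent_idem _ _⟩, ?_⟩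
      rw [hΦ]
      ext1 x
      rw [← intComponent_natCast_eq_self_iff.mpr (hH.1 x), ← hc, Finset.sum_apply,
        Finset.sum_apply, map_sum]
      refine Finset.sum_congr rfl fun i _ => ?_
      rw [Pi.smul_apply, smul_eq_mul, ← intComponent_mul (hself i x), sub_add_cancel]
      rfl
  rw [hilbertSeries, PowerSeries.coeff_mk, ← hrange, LinearMap.finrank_range_of_inj hinj,
    Module.finrank_pi_fintype, Nat.cast_sum]

end hilbert

end

section eigenvalues

variable {n : ℕ}

theorem rank_sub_one_of_diagonalization {A P Q : Matrix (Fin n) (Fin n) ℂ} {l : Fin n → ℂ}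
    (hPQ : P * Q = 1) (hA : A = P * Matrix.diagonal l * Q) :
    (A - 1).rank = (Finset.univ.filter fun i => l i ≠ 1).card := by
  classical
  have h1 : A - 1 = P * Matrix.diagonal (fun i => l i - 1) * Q := by
    have : Matrix.diagonal (fun i => l i - 1) = Matrix.diagonal l - 1 := by
      rw [← Matrix.diagonal_one, Matrix.diagonal_sub]
    rw [this, mul_sub, sub_mul, mul_one, hPQ, hA]
  have hdet : P.det * Q.det = 1 := by rw [← Matrix.det_mul, hPQ, Matrix.det_one]
  rw [h1, Matrix.rank_mul_eq_left_of_isUnit_det _ _ (IsUnit.of_mul_eq_one_right _ hdet),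
    Matrix.rank_mul_eq_right_of_isUnit_det _ _ (IsUnit.of_mul_eq_one _ hdet),
    Matrix.rank_diagonal, Fintype.card_subtype]
  simp only [sub_ne_zero]

theorem eq_one_of_rank_sub_one {A : Matrix (Fin n) (Fin n) ℂ} (h : (A - 1).rank = 0) : A = 1 := by
  rw [Matrix.rank, Submodule.finrank_eq_zero, LinearMap.range_eq_bot] at h
  rw [← sub_eq_zero]
  exact Matrix.mulVec_injective (funext fun v =>
    (LinearMap.congr_fun h v).trans (Matrix.zero_mulVec v).symm)

theorem IsReflection.rank_sub_one {A : Matrix (Fin n) (Fin n) ℂ} (h : IsReflection A) :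
    (A - 1).rank = 1 := by
  obtain ⟨h1, α, φ, h2⟩ := h
  have h3 : (A - 1).rank ≤ 1 := by
    rw [h2, add_sub_cancel_left]
    exact Matrix.rank_vecMulVec_le α φ
  have h4 : (A - 1).rank ≠ 0 := fun h => h1 (eq_one_of_rank_sub_one h)
  omega

/-- The order of vanishing of the reversed characteristic polynomial at `1`. -/
theorem exists_charpolyRev_factor {A : Matrix (Fin n) (Fin n) ℂ} {m : ℕ} (hm : m ≠ 0)
    (hA : A ^ m = 1) : ∃ q : Polynomial ℂ, (A - 1).rank ≤ n ∧
      A.charpolyRev = (1 - Polynomial.X) ^ (n - (A - 1).rank) * q ∧ q.eval 1 ≠ 0 ∧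
      ((A - 1).rank = 1 → q.eval 1 = n - A.trace ∧ q.eval 1 = 1 - A.det ∧ IsReflection A) := by
  classical
  obtain ⟨P, Q, l, hPQ, hQP, h⟩ := exists_diagonalization A hm hA
  have hrank := rank_sub_one_of_diagonalization hPQ h
  have hcard : (Finset.univ.filter fun i => l i = 1).card = n - (A - 1).rank := by
    have := Finset.card_filter_add_card_filter_not (s := (Finset.univ : Finset (Fin n)))
      (fun i => l i = 1)
    rw [hrank]
    simp only [Finset.card_univ, Fintype.card_fin, ← ne_eq] at this
    omega
  refine ⟨∏ i with l i ≠ 1, (1 - Polynomial.C (l i) * Polynomial.X), ?_, ?_, ?_, ?_⟩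
  · exact (Matrix.rank_le_width _)
  · rw [charpolyRev_conj_diagonal hPQ h, ← Finset.prod_filter_mul_prod_filter_not _
      (fun i => l i = 1), Finset.prod_congr rfl (g := fun _ => 1 - Polynomial.X),
      Finset.prod_const, hcard]
    intro i hi
    rw [(Finset.mem_filter.mp hi).2, map_one, one_mul]
  · rw [Polynomial.eval_prod, Finset.prod_ne_zero_iff]
    intro i hi
    have hi' := (Finset.mem_filter.mp hi).2
    simpa [sub_eq_zero] using hi'.symm
  · intro h1
    rw [hrank, Finset.card_eq_one] at h1
    obtain ⟨i, hi⟩ := h1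
    have hl (j : Fin n) (hj : j ≠ i) : l j = 1 := by
      by_contra hne
      exact hj (Finset.mem_singleton.mp (hi ▸ Finset.mem_filter.mpr ⟨Finset.mem_univ j, hne⟩))
    have hli : l i ≠ 1 :=
      (Finset.mem_filter.mp (hi ▸ Finset.mem_singleton_self i : i ∈ Finset.univ.filter _)).2
    have hdet : P.det * Q.det = 1 := by rw [← Matrix.det_mul, hPQ, Matrix.det_one]
    have hdiag : Matrix.diagonal l =
        1 + Matrix.vecMulVec (Pi.single i (l i - 1)) (Pi.single i 1) := by
      ext a b
      rw [Matrix.add_apply, Matrix.vecMulVec_apply]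
      by_cases hab : a = b
      · subst hab
        by_cases hai : a = i
        · subst hai; simp
        · simp [hai, hl a hai]
      · by_cases hai : a = i
        · have : b ≠ i := fun h => hab (hai.trans h.symm)
          simp [Matrix.diagonal_apply_ne _ hab, Matrix.one_apply_ne hab, this]
        · simp [Matrix.diagonal_apply_ne _ hab, Matrix.one_apply_ne hab, hai]
    rw [hi]
    refine ⟨?_, ?_, ?_, ?_⟩
    · rw [h, Matrix.trace_mul_comm, ← mul_assoc, hQP, one_mul, hdiag, Matrix.trace_add,
        Matrix.trace_vecMulVec]
      simp
    · rw [h, Matrix.det_mul, Matrix.det_mul, mul_right_comm, hdet, one_mul, Matrix.det_diagonal,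
        Finset.prod_eq_single i (fun j _ hj => hl j hj) (by simp)]
      simp
    · rintro rfl
      have := hrank
      rw [hi, sub_self, Matrix.rank_zero] at this
      simp at this
    · refine ⟨P.mulVec (Pi.single i (l i - 1)), Matrix.vecMul (Pi.single i 1) Q, ?_⟩
      rw [h, hdiag, mul_add, add_mul, mul_one, hPQ, Matrix.mul_vecMulVec, Matrix.vecMulVec_mul]

end eigenvalues

section poles

variable {G : Type*} [Group G] [Fintype G] {n : ℕ} {M : G →* Matrix (Fin n) (Fin n) ℂ}

open Polynomial in
/-- Comparing the leading terms at `1` of both sides of a graded trace identity. -/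
theorem card_and_sum_of_trace_identity (hM : Function.Injective M)
    {κ : Type*} [Fintype κ] [DecidableEq κ] {B : G →* Matrix κ κ ℂ}
    (hB : ∀ g, IsReflection (M g) → (B g).trace = Fintype.card κ - (1 - (M g).det))
    {N : ℕ} {m : Fin N → ℕ}
    (h : ∑ g, PowerSeries.C (B g).trace * ((M g).charpolyRev : PowerSeries ℂ)⁻¹ =
      (∑ i, PowerSeries.X ^ m i) * ∑ g, ((M g).charpolyRev : PowerSeries ℂ)⁻¹) :
    N = Fintype.card κ ∧ ∑ i, m i = Nat.card {g // IsReflection (M g)} := by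
  classical
  have hfac (g : G) := exists_charpolyRev_factor Fintype.card_ne_zero (pow_card_eq_one_matrix M g)
  choose q hle hq hq1 hrefl using hfac
  set j : G → ℕ := fun g => (M g - 1).rank with hj
  set E : ℂ[X] := ∑ i, X ^ m i with hE
  set Q : G → ℂ[X] := fun g => ∏ h ∈ Finset.univ.erase g, q h with hQ
  have hQq (g : G) : q g * Q g = ∏ h, q h := Finset.mul_prod_erase _ _ (Finset.mem_univ g)
  have hD0 (g : G) : PowerSeries.constantCoeff ((M g).charpolyRev : PowerSeries ℂ) ≠ 0 := by
    rw [Polynomial.constantCoeff_coe, Polynomial.coeff_zero_eq_eval_zero, Matrix.eval_charpolyRev]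
    exact one_ne_zero
  have key : ∑ g, (C (B g).trace - E) * ((1 - X) ^ j g * Q g) = 0 := by
    apply Polynomial.coe_injective
    have hterm (g : G) : (((1 - X) ^ j g * Q g : ℂ[X]) : PowerSeries ℂ) =
        ((1 - X) ^ n * ∏ h, q h : ℂ[X]) * ((M g).charpolyRev : PowerSeries ℂ)⁻¹ := by
      rw [PowerSeries.eq_mul_inv_iff_mul_eq (hD0 g), ← Polynomial.coe_mul, hq g, ← hQq g]
      have hpow : (1 - X : ℂ[X]) ^ n = (1 - X) ^ j g * (1 - X) ^ (n - j g) := by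
        rw [← pow_add, Nat.add_sub_of_le (hle g)]
      rw [hpow]
      congr 1
      ring
    rw [← Polynomial.coeToPowerSeries.ringHom_apply, map_sum]
    simp only [Polynomial.coeToPowerSeries.ringHom_apply, Polynomial.coe_mul (_ - _), hterm]
    have h0 : ∑ g, (((C (B g).trace - E : ℂ[X]) : PowerSeries ℂ) *
        ((M g).charpolyRev : PowerSeries ℂ)⁻¹) = 0 := by
      have hEc : (E : PowerSeries ℂ) = ∑ i, PowerSeries.X ^ m i := by
        rw [hE, ← Polynomial.coeToPowerSeries.ringHom_apply, map_sum]
        simp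
      simp only [Polynomial.coe_sub, sub_mul, Finset.sum_sub_distrib, Polynomial.coe_C]
      rw [h, hEc, Finset.mul_sum, sub_self]
    rw [Polynomial.coe_zero, ← mul_zero ((((1 - X) ^ n * ∏ h, q h : ℂ[X])) : PowerSeries ℂ), ← h0,
      Finset.mul_sum]
    exact Finset.sum_congr rfl fun g _ => by ring
  have hj0 (g : G) : j g = 0 ↔ g = 1 := by
    refine ⟨fun h => hM ((eq_one_of_rank_sub_one h).trans (map_one M).symm), ?_⟩
    rintro rfl
    simp [hj]
  have hj1 (g : G) : j g = 1 ↔ IsReflection (M g) :=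
    ⟨fun h => (hrefl g h).2.2, fun h => h.rank_sub_one⟩
  have hQ1 : (Q 1).eval 1 ≠ 0 := by
    rw [hQ, Polynomial.eval_prod, Finset.prod_ne_zero_iff]
    exact fun h _ => hq1 h
  have hE1 : E.eval 1 = N := by simp [hE, Polynomial.eval_finsetSum]
  have hN : (N : ℂ) = Fintype.card κ := by
    have h1 := congrArg (Polynomial.eval 1) key
    rw [Polynomial.eval_finsetSum, Finset.sum_eq_single 1] at h1
    · rw [(hj0 1).mpr rfl, pow_zero, one_mul, Polynomial.eval_mul, Polynomial.eval_zero,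
        mul_eq_zero, or_iff_left hQ1, map_one, Matrix.trace_one, Polynomial.eval_sub, hE1,
        Polynomial.eval_C, sub_eq_zero] at h1
      exact h1.symm
    · intro g _ hg
      have : j g ≠ 0 := fun h => hg ((hj0 g).mp h)
      simp [this]
    · simp
  refine ⟨mod_cast hN, ?_⟩
  have hprod : (∏ h, q h).eval 1 ≠ 0 := by
    rw [Polynomial.eval_prod, Finset.prod_ne_zero_iff]
    exact fun h _ => hq1 h
  have h1 := congrArg (fun p => p.derivative.eval 1) key
  have hq1one : (q 1).eval 1 = 1 := by
    have h2 := hq 1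
    have h3 : (M 1 - 1).rank = 0 := (hj0 1).mpr rfl
    have h4 : (1 : Matrix (Fin n) (Fin n) ℂ).charpolyRev = (1 - X) ^ n := by
      rw [charpolyRev_conj_diagonal (A := 1) (P := 1) (Q := 1) (l := fun _ => 1) (one_mul 1)
        (by simp)]
      simp
    rw [h3, map_one, h4, Nat.sub_zero] at h2
    have h5 : (1 - X : ℂ[X]) ^ n ≠ 0 := pow_ne_zero _ fun h => by
      simpa using congrArg (Polynomial.eval 0) h
    have h6 : q 1 = 1 := (mul_left_cancel₀ h5 ((mul_one _).trans h2)).symm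
    rw [h6, Polynomial.eval_one]
  have hterm (g : G) : (derivative ((C (B g).trace - E) * ((1 - X) ^ j g * Q g))).eval 1 =
      (∏ h, q h).eval 1 * ((if g = 1 then -((∑ i, m i : ℕ) : ℂ) else 0) +
        if IsReflection (M g) then 1 else 0) := by
    by_cases hg : g = 1
    · subst hg
      have hnr : ¬ IsReflection (M 1) := fun h => by
        have := (hj1 1).mpr h
        rw [(hj0 1).mpr rfl] at this
        simp at this
      rw [if_pos rfl, if_neg hnr, (hj0 1).mpr rfl, pow_zero, one_mul, derivative_mul,
        Polynomial.eval_add, Polynomial.eval_mul, Polynomial.eval_mul, Polynomial.eval_sub, hE1,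
        map_one, Matrix.trace_one, Polynomial.eval_C, hN, sub_self, zero_mul,
        add_zero, add_zero, ← hQq 1, Polynomial.eval_mul, hq1one, one_mul]
      rw [mul_comm]
      congr 1
      simp [hE, Polynomial.eval_finsetSum, derivative_X_pow]
    · rw [if_neg hg, zero_add]
      by_cases hr : IsReflection (M g)
      · rw [if_pos hr, (hj1 g).mpr hr, pow_one, mul_one, ← hQq g, Polynomial.eval_mul,
          (hrefl g ((hj1 g).mpr hr)).2.1]
        simp only [derivative_mul, derivative_sub, derivative_one, derivative_X,
          Polynomial.eval_add, Polynomial.eval_mul, Polynomial.eval_sub, hE1, Polynomial.eval_one,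
          Polynomial.eval_X, Polynomial.eval_C, Polynomial.eval_zero, hN, hB g hr]
        ring
      · rw [if_neg hr, mul_zero]
        have h2 : 2 ≤ j g := by
          have := mt (hj0 g).mp hg
          have := mt (hj1 g).mp hr
          omega
        obtain ⟨e, he⟩ := Nat.exists_eq_add_of_le h2
        rw [he, pow_add]
        simp [derivative_mul, derivative_pow]
  simp only [derivative_sum, Polynomial.eval_finsetSum, hterm, derivative_zero,
    Polynomial.eval_zero] at h1
  rw [← Finset.mul_sum, mul_eq_zero, or_iff_right hprod, Finset.sum_add_distrib,
    Finset.sum_ite_eq' Finset.univ (1 : G), if_pos (Finset.mem_univ _), Finset.sum_boole,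
    neg_add_eq_zero] at h1
  rw [Nat.card_eq_fintype_card, Fintype.card_subtype]
  exact_mod_cast h1

end poles

section

open MvPolynomial

section skew

variable {G : Type*} [Group G] {n : ℕ} {M : G →* Matrix (Fin n) (Fin n) ℂ}

theorem trace_identity_of_basis [Fintype G] {κ : Type*} [Fintype κ] [DecidableEq κ]
    (B : G →* Matrix κ κ ℂ) {ι : Type*} [Fintype ι] {m : ι → ℕ}
    {F : ι → κ → MvPolynomial (Fin n) ℂ} (hF : ∀ i, F i ∈ invDeg M B (m i))
    (hind : LinearIndependent (MvPolynomial (Fin n) ℂ) F)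
    (hspan : ∀ H ∈ invMod M B, H ∈ Submodule.span (invAlg M) (Set.range F)) :
    ∑ g, PowerSeries.C (B g).trace * ((M g).charpolyRev : PowerSeries ℂ)⁻¹ =
      (∑ i, PowerSeries.X ^ m i) * ∑ g, ((M g).charpolyRev : PowerSeries ℂ)⁻¹ := by
  have h1 := card_mul_hilbertSeries M (1 : G →* Matrix Unit Unit ℂ)
  simp only [MonoidHom.one_apply, Matrix.trace_one, Fintype.card_unit, Nat.cast_one, map_one,
    one_mul] at h1
  rw [← card_mul_hilbertSeries, hilbertSeries_eq_of_basis M B hF hind hspan, ← h1]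
  ring

variable (M) in
/-- The determinant as a matrix representation of dimension one. -/
noncomputable def detRep : G →* Matrix Unit Unit ℂ :=
  ((Matrix.scalar Unit : ℂ →+* Matrix Unit Unit ℂ) : ℂ →* _).comp (Matrix.detMonoidHom.comp M)

theorem detRep_apply (g : G) (x y : Unit) : detRep M g x y = (M g).det := by
  simp [detRep]

/-- A polynomial which transforms by the inverse of the determinant. -/
def IsSkew (M : G →* Matrix (Fin n) (Fin n) ℂ) (b : MvPolynomial (Fin n) ℂ) : Prop :=
  ∀ g, C (M g).det * linSubst (M g) b = b

theorem isSkew_iff_mem_invMod {b : MvPolynomial (Fin n) ℂ} :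
    IsSkew M b ↔ (fun _ : Unit => b) ∈ invMod M (detRep M) := by
  refine forall_congr' fun g => ?_
  rw [funext_iff]
  simp [twist_apply, detRep_apply, smul_eq_C_mul]

theorem isSkew_dvd [Fintype G] (hM : Function.Injective M)
    (hgen : Subgroup.closure {g | IsReflection (M g)} = ⊤) {δ b : MvPolynomial (Fin n) ℂ}
    (hδ : IsSkew M δ) (hδ0 : δ ≠ 0)
    (hdeg : δ.IsHomogeneous (Nat.card {g // IsReflection (M g)})) (hb : IsSkew M b) : δ ∣ b := by
  obtain ⟨N, m, ω, hω, hind, hspan⟩ := exists_homogeneous_basis M (detRep M) hgen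
  obtain ⟨hN, hm⟩ := card_and_sum_of_trace_identity hM (B := detRep M)
    (fun g _ => by simp [Matrix.trace, detRep_apply])
    (trace_identity_of_basis (detRep M) hω hind hspan)
  rw [Fintype.card_unit] at hN
  subst hN
  rw [Fin.sum_univ_one] at hm
  have hmul {p : MvPolynomial (Fin n) ℂ} (hp : IsSkew M p) :
      ∃ a : MvPolynomial (Fin n) ℂ, p = a * ω 0 () := by
    obtain ⟨c, hc⟩ := (Submodule.mem_span_range_iff_exists_fun _).mp
      (hspan _ (isSkew_iff_mem_invMod.mp hp))
    rw [Fin.sum_univ_one] at hc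
    exact ⟨c 0, (congrFun hc ()).symm⟩
  obtain ⟨a, ha⟩ := hmul hδ
  obtain ⟨a', ha'⟩ := hmul hb
  have hω0 : ω 0 () ≠ 0 := fun h => hδ0 (by rw [ha, h, mul_zero])
  have hahom : a.IsHomogeneous 0 := by
    refine isHomogeneous_of_mul_eq ((hω 0).1 ()) hω0 ?_ ha
    rwa [zero_add, hm]
  obtain ⟨c, rfl⟩ : ∃ c, a = C c :=
    ⟨_, totalDegree_eq_zero_iff_eq_C.mp ((totalDegree_zero_iff_isHomogeneous ..).mpr hahom)⟩
  have hc : c ≠ 0 := by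
    rintro rfl
    exact hδ0 (by rw [ha, map_zero, zero_mul])
  refine ⟨a' * C c⁻¹, ?_⟩
  have hcc : C c * C c⁻¹ = (1 : MvPolynomial (Fin n) ℂ) := by
    rw [← map_mul, mul_inv_cancel₀ hc, map_one]
  rw [ha, ha']
  linear_combination (-(a' * ω 0 ())) * hcc

end skew

section forms

variable {G : Type*} [Group G] {n : ℕ} {M : G →* Matrix (Fin n) (Fin n) ℂ}

variable (M) in
/-- The compound matrices as a matrix representation. -/
noncomputable def compoundRep (p : ℕ) :
    G →* Matrix (Set.powersetCard (Fin n) p) (Set.powersetCard (Fin n) p) ℂ where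
  toFun g := compound p (M g)
  map_one' := by rw [map_one, compound_one]
  map_mul' g h := by rw [map_mul, compound_mul]

theorem compoundRep_apply (p : ℕ) (g : G) : compoundRep M p g = compound p (M g) := rfl

theorem det_isHomogeneous {ι : Type*} [Fintype ι] [DecidableEq ι]
    {A : Matrix ι ι (MvPolynomial (Fin n) ℂ)} {m : ι → ℕ} (h : ∀ i j, (A i j).IsHomogeneous (m j)) :
    A.det.IsHomogeneous (∑ j, m j) := by
  rw [Matrix.det_apply]
  refine IsHomogeneous.sum _ _ _ fun σ _ => ?_
  have h1 : (∏ i, A (σ i) i).IsHomogeneous (∑ j, m j) := IsHomogeneous.prod _ _ _ fun i _ => h _ _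
  rcases Int.units_eq_one_or (Equiv.Perm.sign σ) with hs | hs <;> rw [hs]
  · rwa [one_smul]
  · rw [Units.neg_smul, one_smul]
    exact h1.neg

theorem map_C_mul_map_linSubst {κ ι : Type*} [Fintype κ] [DecidableEq κ] (B : G →* Matrix κ κ ℂ)
    (K : Matrix κ ι (MvPolynomial (Fin n) ℂ)) (g : G) (a : κ) (i : ι) :
    ((B g).map (C (σ := Fin n)) * K.map (linSubst (M g)) : Matrix κ ι (MvPolynomial (Fin n) ℂ)) a i =
      twist M B g (fun b => K b i) a := by
  simp [Matrix.mul_apply, twist_apply, smul_eq_C_mul]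

theorem trace_eq_of_isReflection [Fintype G] {g : G} (hg : IsReflection (M g)) :
    (M g).trace = n - (1 - (M g).det) := by
  obtain ⟨q, -, -, -, h⟩ := exists_charpolyRev_factor Fintype.card_ne_zero
    (pow_card_eq_one_matrix M g)
  obtain ⟨h1, h2, -⟩ := h hg.rank_sub_one
  rw [← h2, h1]
  ring

theorem exists_invariant_matrix [Fintype G] (hM : Function.Injective M)
    (hgen : Subgroup.closure {g | IsReflection (M g)} = ⊤) :
    ∃ (m : Fin n → ℕ) (Ω : Matrix (Fin n) (Fin n) (MvPolynomial (Fin n) ℂ)),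
      (∀ a i, (Ω a i).IsHomogeneous (m i)) ∧
      (∀ g, (M g).map (C (σ := Fin n)) * Ω.map (linSubst (M g)) = Ω) ∧ Ω.det ≠ 0 ∧
      ∑ i, m i = Nat.card {g // IsReflection (M g)} := by
  obtain ⟨N, m, ω, hω, hind, hspan⟩ := exists_homogeneous_basis M M hgen
  obtain ⟨hN, hm⟩ := card_and_sum_of_trace_identity hM (B := M)
    (fun g hg => by rw [Fintype.card_fin]; exact trace_eq_of_isReflection hg)
    (trace_identity_of_basis M hω hind hspan)
  rw [Fintype.card_fin] at hN
  subst hN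
  refine ⟨m, Matrix.of fun a i => ω i a, fun a i => (hω i).1 a, fun g => ?_, ?_, hm⟩
  · ext1 a i
    rw [map_C_mul_map_linSubst]
    exact congrFun ((hω i).2 g) a
  · intro h0
    obtain ⟨v, hv, hv0⟩ := Matrix.exists_mulVec_eq_zero_iff.mpr h0
    refine hv (funext (Fintype.linearIndependent_iff.mp hind v ?_))
    ext1 a
    rw [← hv0]
    simp [Matrix.mulVec, dotProduct, mul_comm]

theorem isSkew_det {Ω : Matrix (Fin n) (Fin n) (MvPolynomial (Fin n) ℂ)}
    (hΩ : ∀ g, (M g).map (C (σ := Fin n)) * Ω.map (linSubst (M g)) = Ω) : IsSkew M Ω.det := by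
  intro g
  conv_rhs => rw [← hΩ g, Matrix.det_mul]
  rw [RingHom.map_det, AlgHom.map_det]
  rfl

theorem compound_isHomogeneous {Ω : Matrix (Fin n) (Fin n) (MvPolynomial (Fin n) ℂ)} {m : Fin n → ℕ}
    (h : ∀ a i, (Ω a i).IsHomogeneous (m i)) (p : ℕ) (I J : Set.powersetCard (Fin n) p) :
    (compound p Ω I J).IsHomogeneous (∑ i ∈ J.1, m i) := by
  have h1 : ∑ i ∈ J.1, m i = ∑ j, m (Set.powersetCard.ofFinEmbEquiv.symm J j) := by
    conv_lhs => rw [← Finset.image_orderEmbOfFin_univ J.1 J.2]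
    rw [Finset.sum_image fun i _ j _ h => (Finset.orderEmbOfFin J.1 J.2).injective h]
    rfl
  rw [h1, compound, Matrix.of_apply]
  exact det_isHomogeneous fun i j => h _ _

theorem compoundRep_mul_compound {Ω : Matrix (Fin n) (Fin n) (MvPolynomial (Fin n) ℂ)}
    (hΩ : ∀ g, (M g).map (C (σ := Fin n)) * Ω.map (linSubst (M g)) = Ω) (p : ℕ) (g : G) :
    (compoundRep M p g).map (C (σ := Fin n)) * (compound p Ω).map (linSubst (M g)) =
      compound p Ω := by
  have h := compound_map p (linSubst (M g) : MvPolynomial (Fin n) ℂ →+* MvPolynomial (Fin n) ℂ) Ω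
  rw [RingHom.coe_coe] at h
  rw [compoundRep_apply, ← compound_map, ← h, ← compound_mul, hΩ]

theorem mul_comm_of_mul_eq_smul_one {κ R : Type*} [Fintype κ] [DecidableEq κ] [CommRing R]
    [IsDomain R] {A K : Matrix κ κ R} {δ : R} (hδ : δ ≠ 0) (h : A * K = δ • 1) :
    K * A = δ • 1 := by
  have hdet : K.det ≠ 0 := by
    intro h0
    have := congrArg Matrix.det h
    rw [Matrix.det_mul, h0, mul_zero, Matrix.det_smul, Matrix.det_one, mul_one] at this
    exact pow_ne_zero _ hδ this.symm
  have h1 : (K * A) * K = (δ • 1) * K := by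
    rw [Matrix.mul_assoc, h, Matrix.mul_smul, Matrix.smul_mul, Matrix.mul_one, Matrix.one_mul]
  have h2 := congrArg (· * K.adjugate) h1
  simp only [Matrix.mul_assoc _ K, Matrix.mul_adjugate, Matrix.mul_smul, Matrix.mul_one] at h2
  exact smul_right_injective _ hdet h2

theorem exists_invariant_mulVec {κ : Type*} [Fintype κ] [DecidableEq κ] {B : G →* Matrix κ κ ℂ}
    {A K : Matrix κ κ (MvPolynomial (Fin n) ℂ)} {δ : MvPolynomial (Fin n) ℂ} (hδ0 : δ ≠ 0)
    (hδ : IsSkew M δ) (hdvd : ∀ b, IsSkew M b → δ ∣ b) (hAK : A * K = δ • 1)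
    (hK : ∀ g, (B g).map (C (σ := Fin n)) * K.map (linSubst (M g)) = K)
    {H : κ → MvPolynomial (Fin n) ℂ} (hH : H ∈ invMod M B) :
    ∃ c : κ → invAlg M, H = K.mulVec fun J => (c J : MvPolynomial (Fin n) ℂ) := by
  have hKA := mul_comm_of_mul_eq_smul_one hδ0 hAK
  have hinj {u v : κ → MvPolynomial (Fin n) ℂ} (h : K.mulVec u = K.mulVec v) : u = v := by
    have := congrArg A.mulVec h
    simp only [Matrix.mulVec_mulVec, hAK, Matrix.smul_mulVec, Matrix.one_mulVec] at this
    exact smul_right_injective _ hδ0 this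
  have hKb : K.mulVec (A.mulVec H) = δ • H := by
    rw [Matrix.mulVec_mulVec, hKA, Matrix.smul_mulVec, Matrix.one_mulVec]
  have htwist (g : G) (u : κ → MvPolynomial (Fin n) ℂ) :
      twist M B g (K.mulVec u) = K.mulVec fun J => linSubst (M g) (u J) := by
    conv_rhs => rw [← hK g, ← Matrix.mulVec_mulVec]
    ext1 a
    rw [twist_apply]
    simp only [Matrix.mulVec, dotProduct, Matrix.map_apply, smul_eq_C_mul, map_sum, map_mul]
  have hskew (J : κ) : IsSkew M (A.mulVec H J) := by
    intro g
    have h1 := congrArg (twist M B g) hKb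
    rw [htwist, twist_smul, hH g] at h1
    have h2 : K.mulVec (C (σ := Fin n) (M g).det • fun J => linSubst (M g) (A.mulVec H J)) =
        K.mulVec (A.mulVec H) := by
      rw [Matrix.mulVec_smul, h1, hKb, smul_smul, hδ g]
    exact congrFun (hinj h2) J
  choose c hc using fun J => hdvd _ (hskew J)
  have hcinv (J : κ) : c J ∈ invAlg M := by
    refine mem_invAlg.mpr fun g => mul_left_cancel₀ hδ0 ?_
    have h1 := hskew J g
    rw [hc J, map_mul, ← mul_assoc, hδ g] at h1
    exact h1
  refine ⟨fun J => ⟨c J, hcinv J⟩, smul_right_injective _ hδ0 ?_⟩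
  change δ • H = δ • K.mulVec c
  rw [← hKb, ← Matrix.mulVec_smul]
  congr 1
  exact funext hc

theorem exists_exponents [Fintype G] (hM : Function.Injective M)
    (hgen : Subgroup.closure {g | IsReflection (M g)} = ⊤) :
    ∃ m : Fin n → ℕ, ∀ p : ℕ,
      ∑ g, PowerSeries.C (compound p (M g)).trace * ((M g).charpolyRev : PowerSeries ℂ)⁻¹ =
        (∑ s : Set.powersetCard (Fin n) p, PowerSeries.X ^ ∑ i ∈ s.1, m i) *
          ∑ g, ((M g).charpolyRev : PowerSeries ℂ)⁻¹ := by
  obtain ⟨m, Ω, hhom, hΩ, hdet, hm⟩ := exists_invariant_matrix hM hgen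
  have hskew := isSkew_det hΩ
  have hdvd (b) (hb : IsSkew M b) : Ω.det ∣ b :=
    isSkew_dvd hM hgen hskew hdet (hm ▸ det_isHomogeneous hhom) hb
  refine ⟨m, fun p => ?_⟩
  obtain ⟨A, hA⟩ := exists_mul_compound_eq p Ω
  have hsum (c : Set.powersetCard (Fin n) p → MvPolynomial (Fin n) ℂ) :
      ∑ J, c J • (fun I => compound p Ω I J) = (compound p Ω).mulVec c := by
    ext1 I
    simp [Matrix.mulVec, dotProduct, mul_comm]
  refine trace_identity_of_basis (compoundRep M p) (F := fun J I => compound p Ω I J)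
    (fun J => ⟨fun I => compound_isHomogeneous hhom p I J, fun g => ?_⟩) ?_ fun H hH => ?_
  · ext1 I
    rw [← map_C_mul_map_linSubst, compoundRep_mul_compound hΩ]
  · refine Fintype.linearIndependent_iff.mpr fun c hc => ?_
    rw [hsum] at hc
    have := congrArg A.mulVec hc
    rw [Matrix.mulVec_mulVec, hA, Matrix.smul_mulVec, Matrix.one_mulVec, Matrix.mulVec_zero] at this
    exact congrFun ((smul_eq_zero.mp this).resolve_left hdet)
  · obtain ⟨c, rfl⟩ := exists_invariant_mulVec hdet hskew hdvd hA (compoundRep_mul_compound hΩ p) hH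
    rw [← hsum]
    exact Submodule.sum_mem _ fun J _ => Submodule.smul_mem _ (c J) (Submodule.subset_span ⟨J, rfl⟩)

end forms

end

section conclusion

open Polynomial in
theorem exists_mem_of_prod_one_sub_pow_eq {s s' : Multiset ℕ} (hs' : ∀ a ∈ s', 0 < a)
    (h : (s.map fun a => (1 - X ^ a : ℂ[X])).prod = (s'.map fun a => (1 - X ^ a : ℂ[X])).prod)
    {k : ℕ} (hk : k ∈ s) (hk0 : 0 < k) (hmax : ∀ a ∈ s', a ≤ k) : k ∈ s' := by
  have hζ := Complex.isPrimitiveRoot_exp k hk0.ne'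
  have h1 := congrArg (Polynomial.eval (Complex.exp (2 * Real.pi * Complex.I / k))) h
  rw [Polynomial.eval_multiset_prod, Polynomial.eval_multiset_prod, Multiset.map_map,
    Multiset.map_map, Multiset.prod_eq_zero (Multiset.mem_map.mpr ⟨k, hk, ?_⟩), eq_comm,
    Multiset.prod_eq_zero_iff, Multiset.mem_map] at h1
  · obtain ⟨a, ha, ha0⟩ := h1
    have h2 : k ∣ a := hζ.dvd_of_pow_eq_one _ (sub_eq_zero.mp (by simpa using ha0)).symm
    rwa [le_antisymm (Nat.le_of_dvd (hs' a ha) h2) (hmax a ha)]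
  · simp [hζ.pow_eq_one]

open Polynomial in
theorem eq_of_prod_one_sub_pow_eq {s s' : Multiset ℕ} (hs : ∀ a ∈ s, 0 < a) (hs' : ∀ a ∈ s', 0 < a)
    (h : (s.map fun a => (1 - X ^ a : ℂ[X])).prod = (s'.map fun a => (1 - X ^ a : ℂ[X])).prod) :
    s = s' := by
  induction hc : s.card generalizing s s' with
  | zero =>
    rw [Multiset.card_eq_zero] at hc
    subst hc
    by_contra hne
    obtain ⟨a, ha⟩ := Multiset.exists_mem_of_ne_zero (Ne.symm hne)
    have h1 := congrArg (Polynomial.eval 1) h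
    rw [Polynomial.eval_multiset_prod, Polynomial.eval_multiset_prod, Multiset.map_map,
      Multiset.map_map, eq_comm, Multiset.prod_eq_zero (Multiset.mem_map.mpr ⟨a, ha, by simp⟩)] at h1
    simp at h1
  | succ N ih =>
    obtain ⟨a, ha⟩ := Multiset.card_pos_iff_exists_mem.mp (by omega : 0 < s.card)
    obtain ⟨k, hk, hmax⟩ := (s + s').toFinset.exists_max_image id
      ⟨a, by simp [ha]⟩
    simp only [Multiset.mem_toFinset, Multiset.mem_add, id] at hk hmax
    have hk0 : 0 < k := hk.elim (hs k) (hs' k)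
    have hks : k ∈ s := hk.elim id fun hk =>
      exists_mem_of_prod_one_sub_pow_eq hs h.symm hk hk0 fun a ha => hmax a (Or.inl ha)
    have hks' : k ∈ s' :=
      exists_mem_of_prod_one_sub_pow_eq hs' h hks hk0 fun a ha => hmax a (Or.inr ha)
    obtain ⟨s, rfl⟩ := Multiset.exists_cons_of_mem hks
    obtain ⟨s', rfl⟩ := Multiset.exists_cons_of_mem hks'
    simp only [Multiset.map_cons, Multiset.prod_cons, Multiset.mem_cons, forall_eq_or_imp,
      Multiset.card_cons] at h hs hs' hc
    have hne : (1 - X ^ k : ℂ[X]) ≠ 0 := fun h0 => by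
      have := congrArg (Polynomial.eval 0) h0
      simp [hk0.ne'] at this
    rw [ih hs.2 hs'.2 (mul_left_cancel₀ hne h) (by omega)]

variable {G : Type*} [Group G] [Fintype G] {n : ℕ} {M : G →* Matrix (Fin n) (Fin n) ℂ}

theorem coe_charpolyRev_comp (g : G) (r : ℕ) :
    (((M g).charpolyRev.comp (Polynomial.X ^ r) : Polynomial ℂ) : PowerSeries ℂ) =
      ∑ p ∈ Finset.range (n + 1),
        PowerSeries.C (compound p (M g)).trace * (-(PowerSeries.X ^ r)) ^ p := by
  rw [charpolyRev_eq_sum_trace_compound Fintype.card_ne_zero (pow_card_eq_one_matrix M g),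
    Polynomial.sum_comp, ← Polynomial.coeToPowerSeries.ringHom_apply, map_sum]
  refine Finset.sum_congr rfl fun p _ => ?_
  simp

theorem exists_exponents_powerSeries (hM : Function.Injective M)
    (hgen : Subgroup.closure {g | IsReflection (M g)} = ⊤) :
    ∃ m : Fin n → ℕ, ∀ r : ℕ,
      ∑ g, (((M g).charpolyRev.comp (Polynomial.X ^ r) : Polynomial ℂ) : PowerSeries ℂ) *
          ((M g).charpolyRev : PowerSeries ℂ)⁻¹ =
        (∏ i, (1 - PowerSeries.X ^ (m i + r))) *
          ∑ g, ((M g).charpolyRev : PowerSeries ℂ)⁻¹ := by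
  obtain ⟨m, hm⟩ := exists_exponents hM hgen
  refine ⟨m, fun r => ?_⟩
  have h1 : ∏ i, (1 - PowerSeries.X ^ (m i + r) : PowerSeries ℂ) =
      ∑ p ∈ Finset.range (n + 1),
        (∑ s : Set.powersetCard (Fin n) p, PowerSeries.X ^ ∑ i ∈ s.1, m i) *
          (-(PowerSeries.X ^ r)) ^ p := by
    simp only [← Finset.prod_pow_eq_pow_sum]
    rw [← prod_one_sub_mul_eq_sum]
    exact Finset.prod_congr rfl fun i _ => by rw [pow_add, mul_comm]
  simp only [h1, coe_charpolyRev_comp, Finset.sum_mul]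
  rw [Finset.sum_comm]
  refine Finset.sum_congr rfl fun p _ => ?_
  have h2 := congrArg (· * (-(PowerSeries.X ^ r) : PowerSeries ℂ) ^ p) (hm p)
  simp only [Finset.sum_mul] at h2
  convert h2 using 2
  · ring
  · ring

theorem sum_eval_div_of_powerSeries {ι : Type*} [Fintype ι] {D E : ι → Polynomial ℂ}
    {Q : Polynomial ℂ} (hD : ∀ i, (D i).eval 0 ≠ 0)
    (h : ∑ i, (E i : PowerSeries ℂ) * (D i : PowerSeries ℂ)⁻¹ =
      (Q : PowerSeries ℂ) * ∑ i, (D i : PowerSeries ℂ)⁻¹)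
    {t : ℂ} (ht : ∀ i, (D i).eval t ≠ 0) :
    ∑ i, (E i).eval t / (D i).eval t = Q.eval t * ∑ i, ((D i).eval t)⁻¹ := by
  classical
  let N (i : ι) : Polynomial ℂ := ∏ j ∈ Finset.univ.erase i, D j
  have hDN (i : ι) : D i * N i = ∏ j, D j := Finset.mul_prod_erase _ _ (Finset.mem_univ i)
  have hinv (i : ι) : (D i : PowerSeries ℂ)⁻¹ * ((∏ j, D j : Polynomial ℂ) : PowerSeries ℂ) =
      (N i : PowerSeries ℂ) := by
    rw [← hDN i, Polynomial.coe_mul, ← mul_assoc, PowerSeries.inv_mul_cancel, one_mul]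
    rw [← PowerSeries.coeff_zero_eq_constantCoeff_apply, Polynomial.coeff_coe,
      Polynomial.coeff_zero_eq_eval_zero]
    exact hD i
  have hpoly : ∑ i, E i * N i = Q * ∑ i, N i := by
    apply Polynomial.coe_injective ℂ
    replace h := congrArg (· * ((∏ j, D j : Polynomial ℂ) : PowerSeries ℂ)) h
    simp only [Finset.sum_mul, mul_assoc, hinv] at h
    simp only [← Polynomial.coeToPowerSeries.ringHom_apply] at h ⊢
    rw [map_sum, map_mul, map_sum]
    simpa only [map_mul] using h
  have heval := congrArg (Polynomial.eval t) hpoly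
  simp only [Polynomial.eval_finsetSum, Polynomial.eval_mul] at heval
  have hP : (∏ j, D j).eval t ≠ 0 := by
    rw [Polynomial.eval_prod]
    exact Finset.prod_ne_zero_iff.mpr fun i _ => ht i
  have hN (i : ι) : (N i).eval t = (∏ j, D j).eval t * ((D i).eval t)⁻¹ := by
    rw [← hDN i, Polynomial.eval_mul, mul_comm, ← mul_assoc, inv_mul_cancel₀ (ht i), one_mul]
  simp only [hN] at heval
  rw [← Finset.mul_sum] at heval
  refine mul_left_cancel₀ hP ?_
  rw [mul_left_comm, ← heval, Finset.mul_sum]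
  exact Finset.sum_congr rfl fun i _ => by rw [div_eq_mul_inv, mul_left_comm]

theorem exists_exponents_eval (hM : Function.Injective M)
    (hgen : Subgroup.closure {g | IsReflection (M g)} = ⊤) :
    ∃ m : Fin n → ℕ, ∀ (r : ℕ) (t : ℂ), (∀ g, (M g).charpolyRev.eval t ≠ 0) →
      ∑ g, (M g).charpolyRev.eval (t ^ r) / (M g).charpolyRev.eval t =
        (∏ i, (1 - t ^ (m i + r))) * ∑ g, ((M g).charpolyRev.eval t)⁻¹ := by
  obtain ⟨m, hm⟩ := exists_exponents_powerSeries hM hgen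
  refine ⟨m, fun r t ht => ?_⟩
  have hQ : ((∏ i, (1 - Polynomial.X ^ (m i + r)) : Polynomial ℂ) : PowerSeries ℂ) =
      ∏ i, (1 - PowerSeries.X ^ (m i + r)) := by
    rw [← Polynomial.coeToPowerSeries.ringHom_apply, map_prod]
    simp
  have h := sum_eval_div_of_powerSeries (fun g => by rw [Matrix.eval_charpolyRev]; exact one_ne_zero)
    ((hm r).trans (by rw [hQ])) ht
  simpa [Polynomial.eval_prod] using h

theorem map_exponents_eq {m d : Fin n → ℕ} (hd : ∀ i, 0 < d i)
    (hm : ∀ t : ℂ, (∀ g, (M g).charpolyRev.eval t ≠ 0) →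
      (Fintype.card G : ℂ) = (∏ i, (1 - t ^ (m i + 1))) * ∑ g, ((M g).charpolyRev.eval t)⁻¹)
    (hMolien : ∀ t : ℂ, (∀ g, (M g).charpolyRev.eval t ≠ 0) → (∀ i, (1 : ℂ) - t ^ d i ≠ 0) →
      (∑ g, ((M g).charpolyRev.eval t)⁻¹) / (Fintype.card G : ℂ) = ∏ i, ((1 : ℂ) - t ^ d i)⁻¹) :
    Finset.univ.val.map (fun i => m i + 1) = Finset.univ.val.map d := by
  have hG : (Fintype.card G : ℂ) ≠ 0 := Nat.cast_ne_zero.mpr Fintype.card_ne_zero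
  refine eq_of_prod_one_sub_pow_eq (by simp) (by simpa using hd) ?_
  rw [Multiset.map_map, Multiset.map_map]
  change ∏ i, (1 - Polynomial.X ^ (m i + 1) : Polynomial ℂ) = ∏ i, (1 - Polynomial.X ^ d i)
  have hne : (∏ g, (M g).charpolyRev) * ∏ i, (1 - Polynomial.X ^ d i : Polynomial ℂ) ≠ 0 := by
    intro h0
    have := congrArg (Polynomial.eval 0) h0
    simp [Polynomial.eval_prod, fun i => (hd i).ne'] at this
  refine mul_left_cancel₀ hne (Polynomial.funext fun t => ?_)
  simp only [Polynomial.eval_mul, Polynomial.eval_prod, Polynomial.eval_sub, Polynomial.eval_one,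
    Polynomial.eval_pow, Polynomial.eval_X]
  by_cases h1 : ∀ g, (M g).charpolyRev.eval t ≠ 0
  · by_cases h2 : ∀ i, (1 : ℂ) - t ^ d i ≠ 0
    · congr 1
      have h3 := hm t h1
      have h4 := hMolien t h1 h2
      rw [div_eq_iff hG] at h4
      rw [h4, ← mul_assoc, Finset.prod_inv_distrib, eq_comm, mul_eq_right₀ hG,
        mul_inv_eq_one₀ (Finset.prod_ne_zero_iff.mpr fun i _ => h2 i)] at h3
      exact h3
    · push Not at h2
      obtain ⟨i, hi⟩ := h2
      rw [Finset.prod_eq_zero (f := fun i => (1 : ℂ) - t ^ d i) (Finset.mem_univ i) hi]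
      simp
  · push Not at h1
    obtain ⟨g, hg⟩ := h1
    rw [Finset.prod_eq_zero (Finset.mem_univ g) hg]
    simp

theorem sum_charpolyRev_div_eq (hM : Function.Injective M)
    (hgen : Subgroup.closure {g | IsReflection (M g)} = ⊤) {d : Fin n → ℕ} (hd : ∀ i, 0 < d i)
    (hMolien : ∀ t : ℂ, (∀ g, (M g).charpolyRev.eval t ≠ 0) → (∀ i, (1 : ℂ) - t ^ d i ≠ 0) →
      (∑ g, ((M g).charpolyRev.eval t)⁻¹) / (Fintype.card G : ℂ) = ∏ i, ((1 : ℂ) - t ^ d i)⁻¹)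
    (r : ℕ) {t : ℂ} (ht : ∀ g, (M g).charpolyRev.eval t ≠ 0) (ht' : ∀ i, (1 : ℂ) - t ^ d i ≠ 0) :
    (∑ g, (M g).charpolyRev.eval (t ^ r) / (M g).charpolyRev.eval t) / (Fintype.card G : ℂ) =
      ∏ i, (1 - t ^ (d i + r - 1)) / (1 - t ^ d i) := by
  obtain ⟨m, hm⟩ := exists_exponents_eval hM hgen
  have hmd := map_exponents_eq hd (m := m) (fun t ht => by
    rw [← hm 1 t ht]
    simp [ht]) hMolien
  have h1 := congrArg (fun s : Multiset ℕ => (s.map fun a => 1 - t ^ (a + r - 1)).prod) hmd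
  simp only [Multiset.map_map] at h1
  change ∏ i, (1 - t ^ (m i + 1 + r - 1)) = ∏ i, (1 - t ^ (d i + r - 1)) at h1
  simp only [Nat.add_right_comm _ 1 r, Nat.add_sub_cancel] at h1
  rw [hm r t ht, h1, mul_div_assoc, hMolien t ht ht', ← Finset.prod_mul_distrib]
  simp only [div_eq_mul_inv]

end conclusion

section transfer

variable {V : Type*} [AddCommGroup V] [Module ℂ V] [FiniteDimensional ℂ V]

theorem eval_charpolyRev_toMatrix (f : Module.End ℂ V) (t : ℂ) :
    (LinearMap.toMatrix (finBasis ℂ V) (finBasis ℂ V) f).charpolyRev.eval t =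
      LinearMap.det ((1 : Module.End ℂ V) - t • f) := by
  rw [← LinearMap.det_toMatrix (finBasis ℂ V), map_sub, map_smul, LinearMap.toMatrix_one,
    Matrix.charpolyRev, ← Polynomial.coe_evalRingHom, RingHom.map_det]
  congr 1
  ext i j
  simp [Matrix.one_apply, apply_ite, mul_comm t]

theorem isReflection_toMatrix {f : Module.End ℂ V} (hf1 : f ≠ 1) {k : ℕ} (hk : k ≠ 0)
    (hfk : f ^ k = 1)
    (hf : finrank ℂ (LinearMap.ker (f - 1)) = finrank ℂ V - 1) :
    IsReflection (LinearMap.toMatrix (finBasis ℂ V) (finBasis ℂ V) f) := by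
  set A := LinearMap.toMatrix (finBasis ℂ V) (finBasis ℂ V) f with hA
  have hAk : A ^ k = 1 := by
    rw [hA, LinearMap.toMatrix_pow, hfk, LinearMap.toMatrix_one]
  have hpos : 0 < finrank ℂ V := by
    rw [finrank_pos_iff]
    by_contra hV
    rw [not_nontrivial_iff_subsingleton] at hV
    exact hf1 (LinearMap.ext fun v => Subsingleton.elim _ _)
  have hrank : (A - 1).rank = 1 := by
    have h1 : A - 1 = LinearMap.toMatrix (finBasis ℂ V) (finBasis ℂ V) (f - 1) := by
      rw [map_sub, LinearMap.toMatrix_one]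
    rw [h1, Matrix.rank_eq_finrank_range_toLin _ (finBasis ℂ V) (finBasis ℂ V),
      Matrix.toLin_toMatrix]
    have := LinearMap.finrank_range_add_finrank_ker (f - 1)
    omega
  obtain ⟨q, -, -, -, h⟩ := exists_charpolyRev_factor hk hAk
  exact (h hrank).2.2

end transfer

end ReflectionSolomon

/-- with `f(w,t) = t^{−(r−1)ℓ/2}·det(1 − t^r·w)/det(1 − t·w)`,
one has `(1/|W|)·Σ_{w∈W} f(w,t) = t^{−(r−1)ℓ/2}·Π_i (1 − t^{d_i+r−1})/(1 − t^{d_i})`,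
for a finite (Coxeter/complex) reflection group `W` with degrees `d_1,…,d_ℓ`
(characterized by Molien's formula).  This is Solomon's formula at `y = −t^r`. -/
theorem stmt16 {V : Type*} [AddCommGroup V] [Module ℂ V] [FiniteDimensional ℂ V]
    {G : Type*} [Group G] [Fintype G] (ρ : Representation ℂ G V)
    (hfaith : Function.Injective ρ)
    (hgen : Subgroup.closure {g : G | g ≠ 1 ∧
        finrank ℂ (LinearMap.ker ((ρ g : Module.End ℂ V) - 1)) = finrank ℂ V - 1} = ⊤)
    (d : Fin (finrank ℂ V) → ℕ) (hd : ∀ i, 0 < d i)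
    (hMolien : ∀ t : ℂ,
      (∀ g : G, LinearMap.det ((1 : Module.End ℂ V) - t • ρ g) ≠ 0) →
      (∀ i, (1 : ℂ) - t ^ d i ≠ 0) →
      (∑ g : G, (LinearMap.det ((1 : Module.End ℂ V) - t • ρ g))⁻¹) /
          (Fintype.card G : ℂ) = ∏ i, ((1 : ℂ) - t ^ d i)⁻¹)
    (r : ℕ) (hr : 0 < r) :
    ∀ t : ℂ, t ≠ 0 →
      (∀ g : G, LinearMap.det ((1 : Module.End ℂ V) - t • ρ g) ≠ 0) →
      (∀ i, (1 : ℂ) - t ^ d i ≠ 0) →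
      (∑ g : G,
          t ^ (-(((r : ℂ) - 1) * (finrank ℂ V : ℂ)) / 2) *
            (LinearMap.det ((1 : Module.End ℂ V) - t ^ r • ρ g) /
              LinearMap.det ((1 : Module.End ℂ V) - t • ρ g))) /
          (Fintype.card G : ℂ) =
        t ^ (-(((r : ℂ) - 1) * (finrank ℂ V : ℂ)) / 2) *
          ∏ i, (1 - t ^ (d i + r - 1)) / (1 - t ^ d i) := by
  intro t _ ht ht'
  let M : G →* Matrix (Fin (finrank ℂ V)) (Fin (finrank ℂ V)) ℂ :=
    (LinearMap.toMatrixAlgEquiv (finBasis ℂ V) : Module.End ℂ V →* _).comp ρ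
  have hM : Function.Injective M :=
    (LinearMap.toMatrixAlgEquiv (finBasis ℂ V)).injective.comp hfaith
  have hdet (g : G) (t : ℂ) : LinearMap.det ((1 : Module.End ℂ V) - t • ρ g) =
      (M g).charpolyRev.eval t :=
    (ReflectionSolomon.eval_charpolyRev_toMatrix (ρ g) t).symm
  have hrefl : Subgroup.closure {g | ReflectionSolomon.IsReflection (M g)} = ⊤ := by
    refine top_le_iff.mp (hgen ▸ Subgroup.closure_mono fun g hg => ?_)
    refine ReflectionSolomon.isReflection_toMatrix (fun h => hg.1 (hfaith ?_))
      (Fintype.card_ne_zero (α := G)) ?_ hg.2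
    · rw [h, map_one]
    · rw [← map_pow, pow_card_eq_one, map_one]
  simp only [hdet] at hMolien ht ⊢
  rw [← Finset.mul_sum, mul_div_assoc,
    ReflectionSolomon.sum_charpolyRev_div_eq hM hrefl hd hMolien r ht ht']
end
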